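/- Let X be a Hilbert cube manifold and let A, B be dense vanishing strongly shrinkable decompositions of X such that every element of A and of B is cellular in X. If any two sets A ∈ A° and B ∈ B° are ambiently homeomorphic in X, then the decompositions A and B are topologically equivalent. -/

import Mathlib

open Set Topology unitInterval

noncomputable section

/-! ### General notions -/

/-- `X` is completely metrizable: its topology is generated by a complete metric. -/
def CompletelyMetrizable (X : Type*) [t : TopologicalSpace X] : Prop :=
  ∃ m : MetricSpace X, m.toUniformSpace.toTopologicalSpace = t ∧
    @CompleteSpace X m.toUniformSpace

/-- The model cube `I^n` for `n ≤ ω`: `some k` codes the finite cube `I^k`,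
`none` codes the Hilbert cube `I^ω`. -/
def ModelCube : Option ℕ → Type
  | some k => Fin k → unitInterval
  | none => ℕ → unitInterval

instance : (n : Option ℕ) → TopologicalSpace (ModelCube n)
  | some k => inferInstanceAs (TopologicalSpace (Fin k → unitInterval))
  | none => inferInstanceAs (TopologicalSpace (ℕ → unitInterval))

/-- A manifold modeled on `E`: a paracompact space each point of which has an open
neighborhood homeomorphic to an open subset of `E`. -/
def IsManifoldModeledOn (M : Type*) [TopologicalSpace M] (E : Type*) [TopologicalSpace E] :
    Prop :=
  ParacompactSpace M ∧
    ∀ x : M, ∃ O : Set M, IsOpen O ∧ x ∈ O ∧ ∃ U : Set E, IsOpen U ∧ Nonempty (↥O ≃ₜ ↥U)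

/-- The pair `(X, A)` is homeomorphic to the pair `(Y, B)`. -/
def PairHomeo {X Y : Type*} [TopologicalSpace X] [TopologicalSpace Y]
    (A : Set X) (B : Set Y) : Prop :=
  ∃ e : X ≃ₜ Y, ⇑e '' A = B

/-- The cube `I^n` sitting inside `ℝ^n`. -/
def stdCube (n : ℕ) : Set (Fin n → ℝ) := {f | ∀ i, f i ∈ Icc (0 : ℝ) 1}

/-- The copy of `I^ω × [0,1]` sitting inside `I^ω × [0,2)`. -/
def hilbertCollar : Set ((ℕ → unitInterval) × ↥(Ico (0 : ℝ) 2)) := {p | (p.2 : ℝ) ≤ 1}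

/-- The Hilbert cube `I^ω`. -/
abbrev HilbertCube : Type := ℕ → unitInterval

/-- The space `I^ω × [0,1)`. -/
abbrev HilbertHalfOpen : Type := HilbertCube × ↥(Ico (0 : ℝ) 1)

/-- `B` is a tame ball in the `I^n`-manifold `M`: it has an open neighborhood `O` such
that the pair `(O, B)` is homeomorphic to `(ℝ^n, I^n)` (for finite `n`), resp. to
`(I^ω × [0,2), I^ω × [0,1])` (for `n = ω`). -/
def IsTameBall (n : Option ℕ) {M : Type*} [TopologicalSpace M] (B : Set M) : Prop :=
  ∃ O : Set M, IsOpen O ∧ B ⊆ O ∧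
    match n with
    | some k => PairHomeo {x : ↥O | (x : M) ∈ B} (stdCube k)
    | none => PairHomeo {x : ↥O | (x : M) ∈ B} hilbertCollar

/-- The family of all tame balls of the `I^n`-manifold `X`. -/
def tameBalls (n : Option ℕ) (X : Type*) [TopologicalSpace X] : Set (Set X) :=
  {B | IsTameBall n B}

/-- A family of subsets of `X` is vanishing if for any open cover `𝒰` of `X` the subfamily
of sets contained in no member of `𝒰` is locally finite in `X`. -/
def VanishingFamily {X : Type*} [TopologicalSpace X] (F : Set (Set X)) : Prop :=
  ∀ 𝒰 : Set (Set X), (∀ u ∈ 𝒰, IsOpen u) → ⋃₀ 𝒰 = univ →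
    LocallyFinite (fun A : {A : Set X // A ∈ F ∧ ∀ u ∈ 𝒰, ¬ A ⊆ u} => (A : Set X))

/-- The family of connected components of the complement of `S`. -/
def complComponents {X : Type*} [TopologicalSpace X] (S : Set X) : Set (Set X) :=
  {C | ∃ x ∈ Sᶜ, C = connectedComponentIn Sᶜ x}

/-- A spongy subset of an `I^n`-manifold. -/
def IsSpongy (n : Option ℕ) {M : Type*} [TopologicalSpace M] (S : Set M) : Prop :=
  IsClosed S ∧ IsNowhereDense S ∧
  VanishingFamily (complComponents S) ∧
  (∀ C ∈ complComponents S, ∀ C' ∈ complComponents S, C ≠ C' →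
    closure C ∩ closure C' = ∅) ∧
  ∀ C ∈ complComponents S, IsTameBall n (closure C)

/-- `S` is a universal nowhere dense subset of `M`. -/
def UniversalNowhereDense {M : Type*} [TopologicalSpace M] (S : Set M) : Prop :=
  IsNowhereDense S ∧ ∀ A : Set M, IsNowhereDense A → ∃ h : M ≃ₜ M, ⇑h '' A ⊆ S

/-- `(f, g) ≺ 𝒜` : for each `z` with `f z ≠ g z` the doubleton `{f z, g z}` lies in some
member of `𝒜`. -/
def Near {Z X : Type*} (f g : Z → X) (𝒜 : Set (Set X)) : Prop :=
  ∀ z : Z, f z ≠ g z → ∃ A ∈ 𝒜, f z ∈ A ∧ g z ∈ A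

/-- The star `St(A, 𝒰)` of a set `A` with respect to a family `𝒰`. -/
def covStar {X : Type*} (A : Set X) (𝒰 : Set (Set X)) : Set X :=
  ⋃₀ {u ∈ 𝒰 | (u ∩ A).Nonempty}

/-- A compact set `K ⊆ X` is locally shrinkable if for each open neighborhood `O` of `K`
and each open cover `𝒱` of `O` there is a homeomorphism of `X` supported in `O` moving `K`
into a member of `𝒱`. -/
def LocallyShrinkable {X : Type*} [TopologicalSpace X] (K : Set X) : Prop :=
  ∀ O : Set X, IsOpen O → K ⊆ O →
    ∀ 𝒱 : Set (Set X), (∀ v ∈ 𝒱, IsOpen v ∧ v ⊆ O) → O ⊆ ⋃₀ 𝒱 →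
      ∃ h : X ≃ₜ X, (∀ x ∉ O, h x = x) ∧ ∃ v ∈ 𝒱, ⇑h '' K ⊆ v

/-- A family of sets is ambiently invariant if it is invariant under images of
homeomorphisms of the ambient space. -/
def AmbientlyInvariant {X : Type*} [TopologicalSpace X] (𝒦 : Set (Set X)) : Prop :=
  ∀ h : X ≃ₜ X, ∀ K ∈ 𝒦, ⇑h '' K ∈ 𝒦

/-- The local shift property of a family of sets. -/
def LocalShiftProperty {X : Type*} [TopologicalSpace X] (𝒦 : Set (Set X)) : Prop :=
  ∀ x : X, ∀ O ∈ 𝓝 x, ∃ U ∈ 𝓝 x, U ⊆ O ∧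
    ∀ A ∈ 𝒦, ∀ B ∈ 𝒦, A ⊆ U → B ⊆ U →
      ∃ h : X ≃ₜ X, ⇑h '' A = B ∧ ∀ y ∉ O, h y = y

/-- A tame family of compact subsets of `X`. -/
def IsTameFamily {X : Type*} [TopologicalSpace X] (𝒦 : Set (Set X)) : Prop :=
  (∀ K ∈ 𝒦, IsCompact K) ∧ AmbientlyInvariant 𝒦 ∧ (∀ K ∈ 𝒦, LocallyShrinkable K) ∧
    LocalShiftProperty 𝒦 ∧ ∀ U : Set X, IsOpen U → U.Nonempty → ∃ K ∈ 𝒦, K ⊆ U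

/-- `X` is strongly locally homogeneous. -/
def StronglyLocallyHomogeneous (X : Type*) [TopologicalSpace X] : Prop :=
  ∀ x : X, ∀ O ∈ 𝓝 x, ∃ U ∈ 𝓝 x, U ⊆ O ∧
    ∀ y ∈ U, ∃ h : X ≃ₜ X, h x = y ∧ ∀ z ∉ O, h z = z

/-- `X` is topologically homogeneous. -/
def TopologicallyHomogeneous (X : Type*) [TopologicalSpace X] : Prop :=
  ∀ x y : X, ∃ h : X ≃ₜ X, h x = y

/-- `A` is σ-discrete in `X`: a countable union of closed discrete subsets of `X`. -/
def SigmaDiscrete {X : Type*} [TopologicalSpace X] (A : Set X) : Prop :=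
  ∃ f : ℕ → Set X, A = ⋃ n, f n ∧ ∀ n, IsClosed (f n) ∧ DiscreteTopology ↥(f n)

/-! ### Decompositions -/

/-- A decomposition of a topological space `X`: a cover of `X` by pairwise disjoint
nonempty compact subsets. -/
structure Decomposition (X : Type*) [TopologicalSpace X] where
  pieces : Set (Set X)
  nonempty' : ∀ A ∈ pieces, A.Nonempty
  isCompact' : ∀ A ∈ pieces, IsCompact A
  disjoint' : ∀ A ∈ pieces, ∀ B ∈ pieces, A ≠ B → Disjoint A B
  covers : ∀ x : X, ∃ A ∈ pieces, x ∈ A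

namespace Decomposition

variable {X : Type*} [TopologicalSpace X] (D : Decomposition X)

/-- The decomposition space `X/D` (as a set it is the set of pieces). -/
def Space : Type _ := {A : Set X // A ∈ D.pieces}

/-- The quotient map `q_D : X → X/D`. -/
noncomputable def q (x : X) : D.Space := ⟨(D.covers x).choose, (D.covers x).choose_spec.1⟩

/-- The quotient topology on the decomposition space. -/
instance : TopologicalSpace D.Space := TopologicalSpace.coinduced D.q inferInstance

/-- The non-degeneracy part `D°` of a decomposition, viewed inside the decomposition
space. -/
def nondeg : Set D.Space := {A | ¬ (A.1 : Set X).Subsingleton}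

/-- The union of the non-degenerate pieces of a decomposition. -/
def nondegUnion : Set X := ⋃₀ {A ∈ D.pieces | ¬ A.Subsingleton}

/-- A `D`-saturated subset of `X`. -/
def Saturated (U : Set X) : Prop := ∀ A ∈ D.pieces, (A ∩ U).Nonempty → A ⊆ U

/-- A decomposition is upper semicontinuous if saturations of closed sets are closed. -/
def IsUSC : Prop :=
  ∀ F : Set X, IsClosed F → IsClosed (⋃₀ {A ∈ D.pieces | (A ∩ F).Nonempty})

/-- A decomposition is vanishing if for every open cover `𝒰` of `X` the family of pieces
contained in no member of `𝒰` is discrete in `X`. -/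
def Vanishing : Prop :=
  ∀ 𝒰 : Set (Set X), (∀ u ∈ 𝒰, IsOpen u) → ⋃₀ 𝒰 = univ →
    ∀ x : X, ∃ V ∈ 𝓝 x, ∀ A ∈ D.pieces, (∀ u ∈ 𝒰, ¬ A ⊆ u) →
      ∀ B ∈ D.pieces, (∀ u ∈ 𝒰, ¬ B ⊆ u) →
        (V ∩ A).Nonempty → (V ∩ B).Nonempty → A = B

/-- The restriction of `D` to a (`D`-saturated open) set `U` is shrinkable: for each
`D`-saturated open cover `𝒰` of `U` and each open cover `𝒱` of `U` there is a
homeomorphism `h` of the subspace `U` with `(h, id) ≺ 𝒰` and `{h(A) : A ∈ D, A ⊆ U} ≺ 𝒱`. -/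
def ShrinkableOn (U : Set X) : Prop :=
  ∀ 𝒰 : Set (Set X),
    (∀ u ∈ 𝒰, IsOpen u ∧ u ⊆ U ∧ ∀ A ∈ D.pieces, A ⊆ U → (A ∩ u).Nonempty → A ⊆ u) →
    U ⊆ ⋃₀ 𝒰 →
    ∀ 𝒱 : Set (Set X), (∀ v ∈ 𝒱, IsOpen v ∧ v ⊆ U) → U ⊆ ⋃₀ 𝒱 →
      ∃ h : ↥U ≃ₜ ↥U,
        Near (fun x : ↥U => (h x : X)) (fun x : ↥U => (x : X)) 𝒰 ∧
        ∀ A ∈ D.pieces, A ⊆ U →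
          ∃ v ∈ 𝒱, (fun x : ↥U => (x : X)) '' (⇑h '' {x : ↥U | (x : X) ∈ A}) ⊆ v

/-- A decomposition is strongly shrinkable if its restriction to any `D`-saturated open
set is shrinkable. -/
def StronglyShrinkable : Prop :=
  ∀ U : Set X, IsOpen U → D.Saturated U → D.ShrinkableOn U

/-- A decomposition is `𝒦`-tame if it is vanishing, strongly shrinkable, and all its
non-degenerate pieces belong to `𝒦`. -/
def KTame (𝒦 : Set (Set X)) : Prop :=
  D.Vanishing ∧ D.StronglyShrinkable ∧ ∀ A ∈ D.pieces, ¬ A.Subsingleton → A ∈ 𝒦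

/-- A decomposition is dense if its non-degeneracy part is dense in the decomposition
space. -/
def IsDenseDecomp : Prop := Dense D.nondeg

/-- A decomposition is discrete if its non-degeneracy part is closed and discrete in
the decomposition space. -/
def IsDiscreteDecomp : Prop := IsClosed D.nondeg ∧ DiscreteTopology ↥D.nondeg

end Decomposition

/-- A homeomorphism `φ : X/A → X/B` is `(A,B)`-liftable if it lifts to a homeomorphism
`Φ : X → X` with `q_B ∘ Φ = φ ∘ q_A`. -/
def Liftable {X : Type*} [TopologicalSpace X] (A B : Decomposition X)
    (φ : A.Space ≃ₜ B.Space) : Prop :=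
  ∃ Φ : X ≃ₜ X, ∀ x : X, B.q (Φ x) = φ (A.q x)

/-- Two decompositions of `X` are topologically equivalent if some homeomorphism of `X`
maps the first family of pieces onto the second. -/
def TopEquivDecomp {X : Type*} [TopologicalSpace X] (A B : Decomposition X) : Prop :=
  ∃ Φ : X ≃ₜ X, (fun S : Set X => ⇑Φ '' S) '' A.pieces = B.pieces

/-- A `𝒦`-spongy subset of `X`. -/
def IsKSpongy {X : Type*} [TopologicalSpace X] (𝒦 : Set (Set X)) (S : Set X) : Prop :=
  ∃ D : Decomposition X, D.KTame 𝒦 ∧ D.IsDenseDecomp ∧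
    Sᶜ = ⋃ A ∈ D.pieces, interior A

/-! ### Shape notions -/

/-- `K` is point-like in `X`. -/
def PointLike {X : Type*} [TopologicalSpace X] (K : Set X) : Prop :=
  ∀ N : Set X, IsClosed N → K ⊆ interior N →
    ∃ x ∈ interior N, Nonempty (↥(N \ K) ≃ₜ ↥(N \ {x}))

/-- `K` is contractible in `U`: the inclusion `K ↪ U` is homotopic to a constant map. -/
def ContractibleIn {X : Type*} [TopologicalSpace X] (K U : Set X) : Prop :=
  ∃ hKU : K ⊆ U, ∃ y : ↥U,
    (ContinuousMap.mk (Set.inclusion hKU) (continuous_inclusion hKU)).Homotopic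
      (ContinuousMap.const ↥K y)

/-- `K` is cell-like in `X`: `K` is contractible in each of its neighborhoods. -/
def CellLike {X : Type*} [TopologicalSpace X] (K : Set X) : Prop :=
  ∀ U : Set X, IsOpen U → K ⊆ U → ContractibleIn K U

/-- `K` is cellular (with model `E`): every neighborhood of `K` contains a neighborhood
of `K` homeomorphic to `E`. -/
def CellularIn (E : Type*) [TopologicalSpace E] {X : Type*} [TopologicalSpace X]
    (K : Set X) : Prop :=
  ∀ U : Set X, IsOpen U → K ⊆ U → ∃ V ∈ 𝓝ˢ K, V ⊆ U ∧ Nonempty (↥V ≃ₜ E)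

/-- `X` is locally contractible. -/
def LocallyContractible (X : Type*) [TopologicalSpace X] : Prop :=
  ∀ x : X, ∀ U ∈ 𝓝 x, ∃ V ∈ 𝓝 x, V ⊆ U ∧ ContractibleIn V U

/-- The piecewise linear homeomorphism of `[lo, hi]` moving `a` to `b`, extended by the identity. -/
def slideFun (lo hi a b s : ℝ) : ℝ :=
  s + (b - a) * max 0 (min ((s - lo) / (a - lo)) ((hi - s) / (hi - a)))

section SlideFun

variable {lo hi a b s : ℝ}

lemma slideFun_of_not_mem (ha : lo < a) (ha' : a < hi) (hs : s ≤ lo ∨ hi ≤ s) :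
    slideFun lo hi a b s = s := by
  have : min ((s - lo) / (a - lo)) ((hi - s) / (hi - a)) ≤ 0 := by
    rcases hs with h | h
    · exact (min_le_left _ _).trans (div_nonpos_of_nonpos_of_nonneg (by linarith) (by linarith))
    · exact (min_le_right _ _).trans (div_nonpos_of_nonpos_of_nonneg (by linarith) (by linarith))
  simp [slideFun, max_eq_left this]

lemma slideFun_self : slideFun lo hi a a s = s := by simp [slideFun]

lemma slideFun_of_le (ha : lo < a) (ha' : a < hi) (h1 : lo ≤ s) (h2 : s ≤ a) :
    slideFun lo hi a b s = lo + (s - lo) * (b - lo) / (a - lo) := by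
  have h3 : (0 : ℝ) ≤ (s - lo) / (a - lo) := div_nonneg (by linarith) (by linarith)
  have h4 : (s - lo) / (a - lo) ≤ (hi - s) / (hi - a) :=
    ((div_le_one (by linarith)).2 (by linarith)).trans ((one_le_div (by linarith)).2 (by linarith))
  rw [slideFun, min_eq_left h4, max_eq_right h3]
  have : a - lo ≠ 0 := by linarith
  field_simp
  ring

lemma slideFun_of_ge (ha : lo < a) (ha' : a < hi) (h1 : a ≤ s) (h2 : s ≤ hi) :
    slideFun lo hi a b s = hi - (hi - s) * (hi - b) / (hi - a) := by
  have h3 : (0 : ℝ) ≤ (hi - s) / (hi - a) := div_nonneg (by linarith) (by linarith)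
  have h4 : (hi - s) / (hi - a) ≤ (s - lo) / (a - lo) :=
    ((div_le_one (by linarith)).2 (by linarith)).trans ((one_le_div (by linarith)).2 (by linarith))
  rw [slideFun, min_eq_right h4, max_eq_right h3]
  have : hi - a ≠ 0 := by linarith
  field_simp
  ring

lemma slideFun_at (ha : lo < a) (ha' : a < hi) : slideFun lo hi a b a = b := by
  rw [slideFun_of_le ha ha' ha.le le_rfl]
  have : a - lo ≠ 0 := by linarith
  field_simp
  ring

lemma slideFun_le_side (ha : lo < a) (ha' : a < hi) (hb : lo < b) (h1 : lo ≤ s) (h2 : s ≤ a) :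
    lo ≤ slideFun lo hi a b s ∧ slideFun lo hi a b s ≤ b := by
  rw [slideFun_of_le ha ha' h1 h2]
  have h : 0 < a - lo := by linarith
  constructor
  · have : 0 ≤ (s - lo) * (b - lo) / (a - lo) :=
      div_nonneg (mul_nonneg (by linarith) (by linarith)) h.le
    linarith
  · have : (s - lo) * (b - lo) / (a - lo) ≤ b - lo := by
      rw [div_le_iff₀ h]
      nlinarith
    linarith

lemma slideFun_ge_side (ha : lo < a) (ha' : a < hi) (hb : b < hi) (h1 : a ≤ s) (h2 : s ≤ hi) :
    b ≤ slideFun lo hi a b s ∧ slideFun lo hi a b s ≤ hi := by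
  rw [slideFun_of_ge ha ha' h1 h2]
  have h : 0 < hi - a := by linarith
  constructor
  · have : (hi - s) * (hi - b) / (hi - a) ≤ hi - b := by
      rw [div_le_iff₀ h]
      nlinarith
    linarith
  · have : 0 ≤ (hi - s) * (hi - b) / (hi - a) :=
      div_nonneg (mul_nonneg (by linarith) (by linarith)) h.le
    linarith

lemma slideFun_mem (ha : lo < a) (ha' : a < hi) (hb : lo < b) (hb' : b < hi)
    (h : s ∈ Icc lo hi) : slideFun lo hi a b s ∈ Icc lo hi := by
  rcases le_total s a with h1 | h1
  · have := slideFun_le_side ha ha' hb h.1 h1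
    exact ⟨this.1, by linarith⟩
  · have := slideFun_ge_side ha ha' hb' h1 h.2
    exact ⟨by linarith, this.2⟩

lemma slideFun_inv (ha : lo < a) (ha' : a < hi) (hb : lo < b) (hb' : b < hi) :
    slideFun lo hi b a (slideFun lo hi a b s) = s := by
  rcases le_total s lo with h0 | h0
  · rw [slideFun_of_not_mem ha ha' (Or.inl h0), slideFun_of_not_mem hb hb' (Or.inl h0)]
  rcases le_total hi s with h0' | h0'
  · rw [slideFun_of_not_mem ha ha' (Or.inr h0'), slideFun_of_not_mem hb hb' (Or.inr h0')]
  rcases le_total s a with h1 | h1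
  · have := slideFun_le_side ha ha' hb h0 h1
    rw [slideFun_of_le hb hb' this.1 this.2, slideFun_of_le ha ha' h0 h1]
    have h2 : a - lo ≠ 0 := by linarith
    have h3 : b - lo ≠ 0 := by linarith
    field_simp
    ring
  · have := slideFun_ge_side ha ha' hb' h1 h0'
    rw [slideFun_of_ge hb hb' this.1 this.2, slideFun_of_ge ha ha' h1 h0']
    have h2 : hi - a ≠ 0 := by linarith
    have h3 : hi - b ≠ 0 := by linarith
    field_simp
    ring

lemma abs_slideFun_sub_le (ha : lo < a) (ha' : a < hi) :
    |slideFun lo hi a b s - s| ≤ |b - a| := by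
  have h : max 0 (min ((s - lo) / (a - lo)) ((hi - s) / (hi - a))) ≤ 1 := by
    refine max_le zero_le_one ?_
    rcases le_total s a with h1 | h1
    · exact (min_le_left _ _).trans ((div_le_one (by linarith)).2 (by linarith))
    · exact (min_le_right _ _).trans ((div_le_one (by linarith)).2 (by linarith))
  rw [slideFun, add_sub_cancel_left, abs_mul, abs_of_nonneg (le_max_left (0 : ℝ) _)]
  exact mul_le_of_le_one_right (abs_nonneg _) h

lemma abs_slideFun_sub_at_le {m : ℝ} (hm : 0 < m) (ha : lo + m ≤ a) (ha' : a ≤ hi - m)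
    (hb : lo < b) (hb' : b < hi) (hw : hi - lo ≤ 1) (h : s ∈ Icc lo hi) :
    |slideFun lo hi a b s - b| ≤ |s - a| / m := by
  have h0 : lo < a := by linarith
  have h0' : a < hi := by linarith
  rw [le_div_iff₀ hm]
  rcases le_total s a with h1 | h1
  · rw [slideFun_of_le h0 h0' h.1 h1]
    have e : lo + (s - lo) * (b - lo) / (a - lo) - b = (s - a) * ((b - lo) / (a - lo)) := by
      have h2 : a - lo ≠ 0 := by linarith
      field_simp
      ring
    have h3 : 0 ≤ (b - lo) / (a - lo) := div_nonneg (by linarith) (by linarith)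
    rw [e, abs_mul, abs_of_nonneg h3, mul_assoc]
    refine mul_le_of_le_one_right (abs_nonneg _) ?_
    rw [div_mul_eq_mul_div, div_le_one (by linarith)]
    nlinarith
  · rw [slideFun_of_ge h0 h0' h1 h.2]
    have e : hi - (hi - s) * (hi - b) / (hi - a) - b = (s - a) * ((hi - b) / (hi - a)) := by
      have h2 : hi - a ≠ 0 := by linarith
      field_simp
      ring
    have h3 : 0 ≤ (hi - b) / (hi - a) := div_nonneg (by linarith) (by linarith)
    rw [e, abs_mul, abs_of_nonneg h3, mul_assoc]
    refine mul_le_of_le_one_right (abs_nonneg _) ?_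
    rw [div_mul_eq_mul_div, div_le_one (by linarith)]
    nlinarith

lemma Continuous.slideFun {Z : Type*} [TopologicalSpace Z] {f g k : Z → ℝ} (hf : Continuous f)
    (hg : Continuous g) (hk : Continuous k) (h : ∀ z, lo < f z ∧ f z < hi) :
    Continuous fun z => slideFun lo hi (f z) (g z) (k z) := by
  unfold _root_.slideFun
  refine hk.add ((hg.sub hf).mul (continuous_const.max (Continuous.min ?_ ?_)))
  · exact (hk.sub continuous_const).div (hf.sub continuous_const) fun z => by linarith [h z]
  · exact (continuous_const.sub hk).div (continuous_const.sub hf) fun z => by linarith [h z]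

end SlideFun

/-- The homeomorphism `h` is the identity off `O`. -/
def SuppIn {Y : Type*} [TopologicalSpace Y] (h : Y ≃ₜ Y) (O : Set Y) : Prop := ∀ x ∉ O, h x = x

namespace SuppIn

variable {Y : Type*} [TopologicalSpace Y] {g h : Y ≃ₜ Y} {O O' : Set Y}

lemma refl (O : Set Y) : SuppIn (Homeomorph.refl Y) O := fun _ _ => rfl

lemma mono (H : SuppIn h O) (hO : O ⊆ O') : SuppIn h O' := fun x hx => H x fun h' => hx (hO h')

lemma trans (H : SuppIn g O) (H' : SuppIn h O) : SuppIn (g.trans h) O := fun x hx => by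
  rw [Homeomorph.trans_apply, H x hx, H' x hx]

lemma symm (H : SuppIn h O) : SuppIn h.symm O := fun x hx => by
  rw [Homeomorph.symm_apply_eq, H x hx]

lemma apply_mem (H : SuppIn h O) {x : Y} (hx : x ∈ O) : h x ∈ O := by
  by_contra h'
  have := H _ h'
  rw [h.injective this] at h'
  exact h' hx

end SuppIn

/-- The function `A` on a product does not depend on the coordinates in `T`. -/
def IndepOf {E Z : Type*} (A : (ℕ → E) → Z) (T : Set ℕ) : Prop :=
  ∀ x y : ℕ → E, (∀ j ∉ T, x j = y j) → A x = A y

/-- The projection of the line onto the unit interval. -/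
def toI (s : ℝ) : unitInterval := projIcc 0 1 zero_le_one s

lemma coe_toI {s : ℝ} (h : s ∈ Icc (0 : ℝ) 1) : (toI s : ℝ) = s := by
  rw [toI, projIcc_of_mem _ h]

lemma continuous_toI : Continuous toI := continuous_projIcc (h := zero_le_one)

lemma exists_slide (i : ℕ) {lo hi : ℝ} (h0 : 0 ≤ lo) (h1 : hi ≤ 1)
    {A B : (ℕ → unitInterval) → ℝ}
    (hA : Continuous A) (hB : Continuous B) (hAi : IndepOf A {i}) (hBi : IndepOf B {i})
    (hA' : ∀ x, lo < A x ∧ A x < hi) (hB' : ∀ x, lo < B x ∧ B x < hi) :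
    ∃ g : (ℕ → unitInterval) ≃ₜ (ℕ → unitInterval), ∀ x, (∀ j, j ≠ i → g x j = x j) ∧
      (g x i : ℝ) = slideFun lo hi (A x) (B x) (x i) := by
  set F : ((ℕ → unitInterval) → ℝ) → ((ℕ → unitInterval) → ℝ) → (ℕ → unitInterval) →
    (ℕ → unitInterval) :=
    fun A B x => Function.update x i (toI (slideFun lo hi (A x) (B x) (x i))) with hF
  have mem : ∀ {a b : ℝ} (s : unitInterval), lo < a ∧ a < hi → lo < b ∧ b < hi →
      slideFun lo hi a b s ∈ Icc (0 : ℝ) 1 := by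
    intro a b s ha hb
    by_cases hs : (s : ℝ) ∈ Icc lo hi
    · exact Icc_subset_Icc h0 h1 (slideFun_mem ha.1 ha.2 hb.1 hb.2 hs)
    · rw [slideFun_of_not_mem ha.1 ha.2]
      · exact s.2
      · by_contra! h
        exact hs ⟨h.1.le, h.2.le⟩
  have cont : ∀ A B : (ℕ → unitInterval) → ℝ, Continuous A → Continuous B →
      (∀ x, lo < A x ∧ A x < hi) → Continuous (F A B) := by
    intro A B hA hB hA'
    refine continuous_id.update i (continuous_toI.comp (Continuous.slideFun hA hB ?_ hA'))
    exact continuous_subtype_val.comp (continuous_apply i)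
  have inv : ∀ A B : (ℕ → unitInterval) → ℝ, IndepOf A {i} → IndepOf B {i} →
      (∀ x, lo < A x ∧ A x < hi) → (∀ x, lo < B x ∧ B x < hi) → ∀ x, F B A (F A B x) = x := by
    intro A B hAi hBi hA' hB' x
    have e : ∀ j ∉ ({i} : Set ℕ), F A B x j = x j := fun j hj => by
      simp only [hF]
      rw [Function.update_of_ne hj]
    ext j
    by_cases hj : j = i
    · subst hj
      have e2 : (F A B x j : ℝ) = slideFun lo hi (A x) (B x) (x j) := by
        simp only [hF, Function.update_self]
        exact coe_toI (mem _ (hA' x) (hB' x))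
      have e3 : (F B A (F A B x) j : ℝ) =
          slideFun lo hi (B (F A B x)) (A (F A B x)) (F A B x j) := by
        simp only [hF, Function.update_self]
        exact coe_toI (mem _ (hB' _) (hA' _))
      rw [e3, hAi _ _ e, hBi _ _ e, e2, slideFun_inv (hA' x).1 (hA' x).2 (hB' x).1 (hB' x).2]
    · have : F B A (F A B x) j = F A B x j := by
        simp only [hF]
        rw [Function.update_of_ne hj]
      rw [this, e j hj]
  refine ⟨⟨⟨F A B, F B A, inv A B hAi hBi hA' hB', inv B A hBi hAi hB' hA'⟩,
    cont A B hA hB hA', cont B A hB hA hB'⟩, fun x => ⟨fun j hj => ?_, ?_⟩⟩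
  · exact Function.update_of_ne hj _ _
  · change (Function.update x i _ i : ℝ) = _
    rw [Function.update_self]
    exact coe_toI (mem _ (hA' x) (hB' x))

lemma lerp_mem_Ioo {lo hi a b c : ℝ} (ha : lo < a ∧ a < hi) (hb : lo < b ∧ b < hi)
    (h0 : 0 ≤ c) (h1 : c ≤ 1) : lo < a + c * (b - a) ∧ a + c * (b - a) < hi := by
  have := (convex_Ioo lo hi) ha hb (sub_nonneg.2 h1) h0 (by ring)
  simp only [smul_eq_mul, mem_Ioo] at this
  constructor <;> linarith [this.1, this.2]

lemma exists_cornerSlide {t k : ℕ} (htk : t ≠ k) {lo hi μ : ℝ} (hμ : 0 < μ) (h0 : -1 + μ ≤ lo)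
    (h1 : hi ≤ 1 - μ) {a : ℝ} (ha : lo < a ∧ a < hi) {B : (ℕ → unitInterval) → ℝ}
    (hB : Continuous B) (hBi : IndepOf B {t, k}) (hB' : ∀ x, lo < B x ∧ B x < hi) :
    ∃ g : (ℕ → unitInterval) ≃ₜ (ℕ → unitInterval), ∀ x, (∀ j, j ≠ t → j ≠ k → g x j = x j) ∧
      ∃ m s' : ℝ, m = min (x t : ℝ) (x k) ∧
        s' = slideFun lo hi a (a + max 0 (1 - m / μ) * (B x - a)) (x t - x k) ∧
        (g x t : ℝ) = m + max s' 0 ∧ (g x k : ℝ) = m + max (-s') 0 := by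
  have hbd : ∀ (m : ℝ) (x : ℕ → unitInterval), 0 ≤ m →
      lo < a + max 0 (1 - m / μ) * (B x - a) ∧ a + max 0 (1 - m / μ) * (B x - a) < hi := by
    intro m x hm
    have e1 : max 0 (1 - m / μ) ≤ 1 := max_le zero_le_one (by
      have := div_nonneg hm hμ.le
      linarith)
    have e2 : 0 ≤ max 0 (1 - m / μ) := le_max_left _ _
    exact lerp_mem_Ioo ha (hB' x) e2 e1
  set mm : (ℕ → unitInterval) → ℝ := fun x => min (x t : ℝ) (x k) with hmm
  have hmm0 : ∀ x, 0 ≤ mm x := fun x => le_min (x t).2.1 (x k).2.1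
  set G : (ℕ → unitInterval) → ℝ := fun x => a + max 0 (1 - mm x / μ) * (B x - a) with hG
  set S1 : (ℕ → unitInterval) → ℝ := fun x => slideFun lo hi a (G x) (x t - x k) with hS1
  set S2 : (ℕ → unitInterval) → ℝ := fun x => slideFun lo hi (G x) a (x t - x k) with hS2
  set F : ((ℕ → unitInterval) → ℝ) → (ℕ → unitInterval) → (ℕ → unitInterval) :=
    fun S x => Function.update (Function.update x t (toI (mm x + max (S x) 0))) k
      (toI (mm x + max (-S x) 0)) with hF
  have ct : Continuous fun x : ℕ → unitInterval => (x t : ℝ) :=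
    continuous_subtype_val.comp (continuous_apply t)
  have ck : Continuous fun x : ℕ → unitInterval => (x k : ℝ) :=
    continuous_subtype_val.comp (continuous_apply k)
  have cm : Continuous mm := ct.min ck
  have cG : Continuous G := by fun_prop
  have cF : ∀ S, Continuous S → Continuous (F S) := by
    intro S hS
    refine (continuous_id.update t (continuous_toI.comp ?_)).update k (continuous_toI.comp ?_)
    · exact cm.add (hS.max continuous_const)
    · exact cm.add (hS.neg.max continuous_const)
  have key : ∀ S : (ℕ → unitInterval) → ℝ, (∀ x, (μ ≤ mm x ∨ (x t - x k : ℝ) ∉ Icc lo hi →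
      S x = x t - x k) ∧ ((x t - x k : ℝ) ∈ Icc lo hi → S x ∈ Icc lo hi)) →
      ∀ x, (F S x t : ℝ) = mm x + max (S x) 0 ∧ (F S x k : ℝ) = mm x + max (-S x) 0 := by
    intro S hS x
    have e1 : F S x t = toI (mm x + max (S x) 0) := by
      simp only [hF]
      rw [Function.update_of_ne htk, Function.update_self]
    have e2 : F S x k = toI (mm x + max (-S x) 0) := by
      simp only [hF]
      rw [Function.update_self]
    have b1 := (x t).2.1
    have b2 := (x k).2.1
    have b3 := (x t).2.2
    have b4 := (x k).2.2
    have : mm x + max (S x) 0 ∈ Icc (0 : ℝ) 1 ∧ mm x + max (-S x) 0 ∈ Icc (0 : ℝ) 1 := by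
      have hm := hmm0 x
      by_cases hc : μ ≤ mm x ∨ (x t - x k : ℝ) ∉ Icc lo hi
      · rw [(hS x).1 hc]
        simp only [hmm, mem_Icc]
        rcases le_total (x t : ℝ) (x k) with h | h
        · rw [min_eq_left h, max_eq_right (by linarith), max_eq_left (by linarith)]
          refine ⟨⟨?_, ?_⟩, ?_, ?_⟩ <;> linarith
        · rw [min_eq_right h, max_eq_left (by linarith), max_eq_right (by linarith)]
          refine ⟨⟨?_, ?_⟩, ?_, ?_⟩ <;> linarith
      · push Not at hc
        have := (hS x).2 hc.2
        refine ⟨⟨?_, ?_⟩, ?_, ?_⟩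
        · have := le_max_right (S x) 0
          linarith
        · have : max (S x) 0 ≤ 1 - μ := max_le (by linarith [this.2]) (by linarith)
          linarith
        · have := le_max_right (-S x) 0
          linarith
        · have : max (-S x) 0 ≤ 1 - μ := max_le (by linarith [this.1]) (by linarith)
          linarith
    rw [e1, e2]
    exact ⟨coe_toI this.1, coe_toI this.2⟩
  have hGb : ∀ x, lo < G x ∧ G x < hi := fun x => hbd _ _ (hmm0 x)
  have hGμ : ∀ x, μ ≤ mm x → G x = a := by
    intro x hx
    have : 1 - mm x / μ ≤ 0 := by
      have := (one_le_div hμ).2 hx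
      linarith
    simp only [hG]
    rw [max_eq_left this]
    ring
  have not_mem : ∀ {s : ℝ}, s ∉ Icc lo hi → s ≤ lo ∨ hi ≤ s := by
    intro s hs
    by_contra! h
    exact hs ⟨h.1.le, h.2.le⟩
  have hS1' : ∀ x, (μ ≤ mm x ∨ (x t - x k : ℝ) ∉ Icc lo hi → S1 x = x t - x k) ∧
      ((x t - x k : ℝ) ∈ Icc lo hi → S1 x ∈ Icc lo hi) := by
    refine fun x => ⟨?_, fun h => slideFun_mem ha.1 ha.2 (hGb x).1 (hGb x).2 h⟩
    rintro (h | h)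
    · simp only [hS1]
      rw [hGμ x h, slideFun_self]
    · exact slideFun_of_not_mem ha.1 ha.2 (not_mem h)
  have hS2' : ∀ x, (μ ≤ mm x ∨ (x t - x k : ℝ) ∉ Icc lo hi → S2 x = x t - x k) ∧
      ((x t - x k : ℝ) ∈ Icc lo hi → S2 x ∈ Icc lo hi) := by
    refine fun x => ⟨?_, fun h => slideFun_mem (hGb x).1 (hGb x).2 ha.1 ha.2 h⟩
    rintro (h | h)
    · simp only [hS2]
      rw [hGμ x h, slideFun_self]
    · exact slideFun_of_not_mem (hGb x).1 (hGb x).2 (not_mem h)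
  have k1 := key S1 hS1'
  have k2 := key S2 hS2'
  have hoff : ∀ S x j, j ≠ t → j ≠ k → F S x j = x j := by
    intro S x j h1 h2
    simp only [hF]
    rw [Function.update_of_ne h2, Function.update_of_ne h1]
  have hmsub : ∀ S : (ℕ → unitInterval) → ℝ, ∀ x, (F S x t : ℝ) = mm x + max (S x) 0 ∧
      (F S x k : ℝ) = mm x + max (-S x) 0 → mm (F S x) = mm x ∧
      (F S x t - F S x k : ℝ) = S x ∧ B (F S x) = B x := by
    rintro S x ⟨h1, h2⟩
    refine ⟨?_, ?_, hBi _ _ fun j hj => ?_⟩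
    · simp only [hmm, h1, h2]
      rcases le_total (S x) 0 with h | h
      · rw [max_eq_right h, max_eq_left (by linarith : (0 : ℝ) ≤ -S x), min_eq_left (by linarith)]
        exact add_zero _
      · rw [max_eq_left h, max_eq_right (by linarith : -S x ≤ 0), min_eq_right (by linarith)]
        exact add_zero _
    · rw [h1, h2]
      rcases le_total (S x) 0 with h | h
      · rw [max_eq_right h, max_eq_left (by linarith : (0 : ℝ) ≤ -S x)]
        ring
      · rw [max_eq_left h, max_eq_right (by linarith : -S x ≤ 0)]
        ring
    · simp only [mem_insert_iff, mem_singleton_iff, not_or] at hj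
      exact hoff S x j hj.1 hj.2
  have rec_ : ∀ x : ℕ → unitInterval, (mm x + max (x t - x k : ℝ) 0 = x t) ∧
      (mm x + max (-(x t - x k : ℝ)) 0 = x k) := by
    intro x
    simp only [hmm]
    rcases le_total (x t : ℝ) (x k) with h | h
    · rw [min_eq_left h, max_eq_right (by linarith), max_eq_left (by linarith)]
      constructor <;> ring
    · rw [min_eq_right h, max_eq_left (by linarith), max_eq_right (by linarith)]
      constructor <;> ring
  have inv : ∀ S S' : (ℕ → unitInterval) → ℝ, (∀ x, (F S x t : ℝ) = mm x + max (S x) 0 ∧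
      (F S x k : ℝ) = mm x + max (-S x) 0) → (∀ x, (F S' x t : ℝ) = mm x + max (S' x) 0 ∧
      (F S' x k : ℝ) = mm x + max (-S' x) 0) → (∀ x, S' (F S x) = x t - x k) →
      ∀ x, F S' (F S x) = x := by
    intro S S' h h' hSS x
    have e := hmsub S x (h x)
    have e' := h' (F S x)
    rw [e.1, hSS, (rec_ x).1, (rec_ x).2] at e'
    ext j
    by_cases hjt : j = t
    · rw [hjt, e'.1]
    by_cases hjk : j = k
    · rw [hjk, e'.2]
    · rw [hoff _ _ j hjt hjk, hoff _ _ j hjt hjk]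
  have hG' : ∀ S : (ℕ → unitInterval) → ℝ, ∀ x, (F S x t : ℝ) = mm x + max (S x) 0 ∧
      (F S x k : ℝ) = mm x + max (-S x) 0 → G (F S x) = G x := by
    intro S x h
    have e := hmsub S x h
    simp only [hG]
    rw [e.1, e.2.2]
  have inv1 : ∀ x, F S2 (F S1 x) = x := by
    refine inv S1 S2 k1 k2 fun x => ?_
    simp only [hS2]
    rw [hG' S1 x (k1 x), (hmsub S1 x (k1 x)).2.1]
    exact slideFun_inv ha.1 ha.2 (hGb x).1 (hGb x).2
  have inv2 : ∀ x, F S1 (F S2 x) = x := by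
    refine inv S2 S1 k2 k1 fun x => ?_
    simp only [hS1]
    rw [hG' S2 x (k2 x), (hmsub S2 x (k2 x)).2.1]
    exact slideFun_inv (hGb x).1 (hGb x).2 ha.1 ha.2
  refine ⟨⟨⟨F S1, F S2, inv1, inv2⟩, cF _ ?_, cF _ ?_⟩, fun x => ⟨hoff S1 x, mm x, S1 x, rfl, rfl,
    k1 x⟩⟩
  · exact Continuous.slideFun continuous_const cG (ct.sub ck) fun _ => ha
  · exact Continuous.slideFun cG continuous_const (ct.sub ck) hGb

lemma IsCompact.exists_pos_le {Z : Type*} [TopologicalSpace Z] {K : Set Z} (hK : IsCompact K)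
    {f : Z → ℝ} (hf : ContinuousOn f K) (h : ∀ x ∈ K, 0 < f x) : ∃ a, 0 < a ∧ ∀ x ∈ K, a ≤ f x :=
  hK.exists_forall_le' hf h

lemma continuous_coord (i : ℕ) : Continuous fun x : ℕ → unitInterval => (x i : ℝ) :=
  continuous_subtype_val.comp (continuous_apply i)

/-- The basic open box of the Hilbert cube. -/
def coordBox (c : ℕ → unitInterval) (n : ℕ) (r : ℝ) : Set (ℕ → unitInterval) :=
  {x | ∀ i < n, |(x i : ℝ) - c i| < r}

section Box

variable {c : ℕ → unitInterval} {n : ℕ} {r ρ : ℝ}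

lemma isOpen_coordBox : IsOpen (coordBox c n r) := by
  have : coordBox c n r = ⋂ i ∈ Finset.range n, {x | |(x i : ℝ) - c i| < r} := by
    ext x
    simp [coordBox]
  rw [this]
  refine isOpen_biInter_finset fun i _ => isOpen_lt ?_ continuous_const
  exact ((continuous_coord i).sub continuous_const).abs

lemma isClosed_closedCoordBox :
    IsClosed {x : ℕ → unitInterval | ∀ i < n, |(x i : ℝ) - c i| ≤ r} := by
  have : {x : ℕ → unitInterval | ∀ i < n, |(x i : ℝ) - c i| ≤ r} =
      ⋂ i ∈ Finset.range n, {x | |(x i : ℝ) - c i| ≤ r} := by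
    ext x
    simp
  rw [this]
  refine isClosed_biInter fun i _ => isClosed_le ?_ continuous_const
  exact ((continuous_coord i).sub continuous_const).abs

lemma mem_coordBox_self (hr : 0 < r) : c ∈ coordBox c n r := fun i _ => by simpa using hr

lemma exists_coordBox_subset {W : Set (ℕ → unitInterval)} (hW : W ∈ 𝓝 c) (m : ℕ) :
    ∃ n, m ≤ n ∧ ∃ r, 0 < r ∧ {x : ℕ → unitInterval | ∀ i < n, |(x i : ℝ) - c i| ≤ r} ⊆ W := by
  rw [nhds_pi, Filter.mem_pi] at hW
  obtain ⟨J, hI, t, ht, htW⟩ := hW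
  have h1 : ∀ i, ∃ r, 0 < r ∧ ∀ y : unitInterval, |(y : ℝ) - c i| ≤ r → y ∈ t i := by
    intro i
    obtain ⟨r, hr, h⟩ := Metric.nhds_basis_closedBall.mem_iff.1 (ht i)
    refine ⟨r, hr, fun y hy => h ?_⟩
    rw [Metric.mem_closedBall, Subtype.dist_eq, Real.dist_eq]
    exact hy
  choose R hR hRt using h1
  obtain ⟨b, hb⟩ := hI.bddAbove
  have h2 : ∃ r, 0 < r ∧ ∀ i ∈ hI.toFinset, r ≤ R i := by
    induction hI.toFinset using Finset.induction_on with
    | empty => exact ⟨1, one_pos, by simp⟩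
    | insert a s _ ih =>
      obtain ⟨r, hr, h⟩ := ih
      refine ⟨min r (R a), lt_min hr (hR a), fun i hi => ?_⟩
      rcases Finset.mem_insert.1 hi with rfl | hi
      · exact min_le_right _ _
      · exact (min_le_left _ _).trans (h i hi)
  obtain ⟨r, hr, hrR⟩ := h2
  refine ⟨max m (b + 1), le_max_left _ _, r, hr, fun x hx => htW fun i hi => hRt i _ ?_⟩
  exact (hx i (lt_max_of_lt_right (Nat.lt_succ_of_le (hb hi)))).trans
    (hrR i (hI.mem_toFinset.2 hi))

lemma exists_closedBox_of_compact {K : Set (ℕ → unitInterval)} (hK : IsCompact K)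
    (h : K ⊆ coordBox c n r) (hr : 0 < r) :
    ∃ ρ, 0 < ρ ∧ ρ < r ∧ ∀ x ∈ K, ∀ i < n, |(x i : ℝ) - c i| ≤ ρ := by
  have : ∀ m ≤ n, ∃ ρ, 0 < ρ ∧ ρ < r ∧ ∀ x ∈ K, ∀ i < m, |(x i : ℝ) - c i| ≤ ρ := by
    intro m
    induction m with
    | zero => exact fun _ => ⟨r / 2, by linarith, by linarith, by simp⟩
    | succ m ih =>
      intro hm
      obtain ⟨ρ, h0, h1, h2⟩ := ih (by omega)
      obtain ⟨a, ha, ha'⟩ := hK.exists_pos_le (f := fun x => r - |(x m : ℝ) - c m|)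
        (continuous_const.sub ((continuous_coord m).sub continuous_const).abs).continuousOn
        (fun x hx => by have := h hx m (by omega); linarith)
      refine ⟨max ρ (r - a), lt_max_of_lt_left h0, max_lt h1 (by linarith), fun x hx i hi => ?_⟩
      rcases Nat.lt_succ_iff_lt_or_eq.1 hi with hi | rfl
      · exact (h2 x hx i hi).trans (le_max_left _ _)
      · have := ha' x hx
        exact le_max_of_le_right (by linarith)
  exact this n le_rfl

/-- A continuous cut-off which is `1` on the box of radius `ρ` and `0` off the box of radius `r`,
ignoring the coordinates in `T`. -/
def boxCut (c : ℕ → unitInterval) (n : ℕ) (ρ r : ℝ) (T : Finset ℕ) (x : ℕ → unitInterval) : ℝ :=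
  ∏ i ∈ Finset.range n \ T, max 0 (min 1 ((r - |(x i : ℝ) - c i|) / (r - ρ)))

variable {T : Finset ℕ}

lemma continuous_boxCut : Continuous (boxCut c n ρ r T) := by
  refine continuous_finsetProd _ fun i _ => continuous_const.max (continuous_const.min ?_)
  exact (continuous_const.sub ((continuous_coord i).sub continuous_const).abs).div_const _

lemma boxCut_nonneg (x : ℕ → unitInterval) : 0 ≤ boxCut c n ρ r T x :=
  Finset.prod_nonneg fun _ _ => le_max_left _ _

lemma boxCut_le_one (x) : boxCut c n ρ r T x ≤ 1 :=
  Finset.prod_le_one (fun _ _ => le_max_left _ _) fun _ _ => max_le zero_le_one (min_le_left _ _)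

lemma indepOf_boxCut : IndepOf (boxCut c n ρ r T) T := by
  intro x y h
  refine Finset.prod_congr rfl fun i hi => ?_
  rw [h i (Finset.mem_sdiff.1 hi).2]

lemma boxCut_eq_one (h : ρ < r) {x} (hx : ∀ i < n, |(x i : ℝ) - c i| ≤ ρ) :
    boxCut c n ρ r T x = 1 := by
  refine Finset.prod_eq_one fun i hi => ?_
  have := hx i (Finset.mem_range.1 (Finset.mem_sdiff.1 hi).1)
  have h2 : 1 ≤ (r - |(x i : ℝ) - c i|) / (r - ρ) :=
    (one_le_div (by linarith)).2 (by linarith)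
  rw [min_eq_left h2, max_eq_right zero_le_one]

lemma boxCut_eq_zero (h : ρ < r) {x} {i : ℕ} (hi : i < n) (hiT : i ∉ T)
    (hx : r ≤ |(x i : ℝ) - c i|) : boxCut c n ρ r T x = 0 := by
  refine Finset.prod_eq_zero (Finset.mem_sdiff.2 ⟨Finset.mem_range.2 hi, hiT⟩) ?_
  have h2 : (r - |(x i : ℝ) - c i|) / (r - ρ) ≤ 0 :=
    div_nonpos_of_nonpos_of_nonneg (by linarith) (by linarith)
  exact max_eq_left ((min_le_right _ _).trans h2)

/-- The lower end of the `i`-th side of a box. -/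
def boxLo (c : ℕ → unitInterval) (n : ℕ) (r : ℝ) (i : ℕ) : ℝ :=
  if i < n then max 0 (c i - r) else 0

/-- The upper end of the `i`-th side of a box. -/
def boxHi (c : ℕ → unitInterval) (n : ℕ) (r : ℝ) (i : ℕ) : ℝ :=
  if i < n then min 1 (c i + r) else 1

lemma boxLo_nonneg (i : ℕ) : 0 ≤ boxLo c n r i := by
  unfold boxLo
  split_ifs
  · exact le_max_left _ _
  · exact le_rfl

lemma boxHi_le_one (i : ℕ) : boxHi c n r i ≤ 1 := by
  unfold boxHi
  split_ifs
  · exact min_le_left _ _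
  · exact le_rfl

lemma lt_boxLo_boxHi {i : ℕ} {v : ℝ} (h0 : 0 < v) (h1 : v < 1) (h : i < n → |v - c i| < r) :
    boxLo c n r i < v ∧ v < boxHi c n r i := by
  unfold boxLo boxHi
  split_ifs with hi
  · have := abs_lt.1 (h hi)
    exact ⟨max_lt h0 (by linarith), lt_min h1 (by linarith)⟩
  · exact ⟨h0, h1⟩

lemma exists_boxSlide (hρ : ρ < r) (i : ℕ) {A B : (ℕ → unitInterval) → ℝ}
    (hA : Continuous A) (hB : Continuous B) (hAi : IndepOf A {i}) (hBi : IndepOf B {i})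
    (hA' : ∀ x, boxLo c n r i < A x ∧ A x < boxHi c n r i)
    (hB' : ∀ x, boxLo c n r i < B x ∧ B x < boxHi c n r i) :
    ∃ g : (ℕ → unitInterval) ≃ₜ (ℕ → unitInterval), SuppIn g (coordBox c n r) ∧
      ∀ x, (∀ j, j ≠ i → g x j = x j) ∧ |(g x i : ℝ) - x i| ≤ |B x - A x| ∧
        ((∀ l < n, |(x l : ℝ) - c l| ≤ ρ) →
          (g x i : ℝ) = slideFun (boxLo c n r i) (boxHi c n r i) (A x) (B x) (x i)) := by
  set L := boxCut c n ρ r {i} with hL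
  have hLi : IndepOf L {i} := by
    have := indepOf_boxCut (c := c) (n := n) (ρ := ρ) (r := r) (T := {i})
    simpa using this
  set B' : (ℕ → unitInterval) → ℝ := fun x => A x + L x * (B x - A x) with hB2
  obtain ⟨g, hg⟩ := exists_slide i (boxLo_nonneg (c := c) (n := n) (r := r) i)
    (boxHi_le_one (c := c) (n := n) (r := r) i)
    hA (B := B') (hA.add (continuous_boxCut.mul (hB.sub hA))) hAi
    (fun x y h => by simp only [hB2]; rw [hAi x y h, hBi x y h, hLi x y h]) hA'
    (fun x => lerp_mem_Ioo (hA' x) (hB' x) (boxCut_nonneg _) (boxCut_le_one _))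
  refine ⟨g, fun x hx => ?_, fun x => ⟨(hg x).1, ?_, fun hx => ?_⟩⟩
  · ext j
    by_cases hj : j = i
    swap
    · rw [(hg x).1 j hj]
    rw [hj, (hg x).2]
    simp only [coordBox, mem_ofPred_eq, not_forall, not_lt] at hx
    obtain ⟨l, hl, hlr⟩ := hx
    by_cases hli : l = i
    · subst hli
      refine slideFun_of_not_mem (hA' x).1 (hA' x).2 ?_
      simp only [boxLo, boxHi, if_pos hl]
      rcases le_abs.1 hlr with h | h
      · exact Or.inr (min_le_of_right_le (by linarith))
      · exact Or.inl (le_max_of_le_right (by linarith))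
    · have : L x = 0 := boxCut_eq_zero hρ hl (by simpa using hli) hlr
      have e : B' x = A x := by simp only [hB2, this]; ring
      rw [e, slideFun_self]
  · rw [(hg x).2]
    refine (abs_slideFun_sub_le (hA' x).1 (hA' x).2).trans ?_
    simp only [hB2]
    rw [add_sub_cancel_left, abs_mul, abs_of_nonneg (boxCut_nonneg _)]
    exact mul_le_of_le_one_left (abs_nonneg _) (boxCut_le_one _)
  · have : L x = 1 := boxCut_eq_one hρ hx
    have e : B' x = B x := by simp only [hB2, this]; ring
    rw [(hg x).2, e]

lemma indepOf_const {E Z : Type*} (a : Z) (T : Set ℕ) : IndepOf (fun _ : ℕ → E => a) T :=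
  fun _ _ _ => rfl

lemma exists_slide_point {x : ℕ → unitInterval} (hr : 0 < r) (hx : x ∈ coordBox c n r) {i : ℕ}
    {v : ℝ}
    (hi : 0 < (x i : ℝ)) (hi' : (x i : ℝ) < 1) (hv : 0 < v) (hv' : v < 1)
    (h : i < n → |v - c i| < r) :
    ∃ g : (ℕ → unitInterval) ≃ₜ (ℕ → unitInterval), SuppIn g (coordBox c n r) ∧
      (∀ y j, j ≠ i → g y j = y j) ∧ (g x i : ℝ) = v := by
  obtain ⟨ρ, -, hρ, h3⟩ := exists_closedBox_of_compact (isCompact_singleton (x := x))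
    (singleton_subset_iff.2 hx) hr
  have h1 := lt_boxLo_boxHi (c := c) (n := n) (r := r) hi hi' (fun hin => hx i hin)
  have h2 := lt_boxLo_boxHi (c := c) (n := n) (r := r) hv hv' h
  obtain ⟨g, hg, hg'⟩ := exists_boxSlide hρ i (A := fun _ => (x i : ℝ)) (B := fun _ => v)
    continuous_const continuous_const (indepOf_const _ _) (indepOf_const _ _)
    (fun _ => h1) (fun _ => h2)
  refine ⟨g, hg, fun y => (hg' y).1, ?_⟩
  rw [(hg' x).2.2 (h3 x rfl), slideFun_at h1.1 h1.2]

lemma exists_boxCorner (hρ : ρ < r) {t k : ℕ} (htk : t ≠ k) {lo hi μ : ℝ} (hμ : 0 < μ)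
    (h0 : -1 + μ ≤ lo) (h1 : hi ≤ 1 - μ) {a b : ℝ} (ha : lo < a ∧ a < hi) (hb : lo < b ∧ b < hi)
    (ht : t < n → (c t : ℝ) < r ∧ μ + max hi 0 ≤ r)
    (hk : k < n → (c k : ℝ) < r ∧ μ + max (-lo) 0 ≤ r) :
    ∃ g : (ℕ → unitInterval) ≃ₜ (ℕ → unitInterval), SuppIn g (coordBox c n r) ∧
      ∀ x, (∀ j, j ≠ t → j ≠ k → g x j = x j) ∧ |(g x t : ℝ) - x t| ≤ |b - a| ∧
        |(g x k : ℝ) - x k| ≤ |b - a| ∧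
        ((∀ l < n, |(x l : ℝ) - c l| ≤ ρ) → min (x t : ℝ) (x k) = 0 →
          (g x t : ℝ) = max (slideFun lo hi a b (x t - x k)) 0 ∧
          (g x k : ℝ) = max (-slideFun lo hi a b (x t - x k)) 0) := by
  set L := boxCut c n ρ r {t, k} with hL
  have hLi : IndepOf L {t, k} := by
    have := indepOf_boxCut (c := c) (n := n) (ρ := ρ) (r := r) (T := {t, k})
    simpa using this
  obtain ⟨g, hg⟩ := exists_cornerSlide htk hμ h0 h1 ha (B := fun x => a + L x * (b - a))
    (continuous_const.add (continuous_boxCut.mul continuous_const))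
    (fun x y h => by simp only [hLi x y h])
    (fun x => lerp_mem_Ioo ha hb (boxCut_nonneg _) (boxCut_le_one _))
  have xt : ∀ x : ℕ → unitInterval, (x t : ℝ) = min (x t : ℝ) (x k) + max (x t - x k : ℝ) 0 := by
    intro x
    rcases le_total (x t : ℝ) (x k) with h | h
    · rw [min_eq_left h, max_eq_right (by linarith)]; ring
    · rw [min_eq_right h, max_eq_left (by linarith)]; ring
  have xk : ∀ x : ℕ → unitInterval, (x k : ℝ) = min (x t : ℝ) (x k) + max (-(x t - x k : ℝ)) 0 := by
    intro x
    rcases le_total (x t : ℝ) (x k) with h | h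
    · rw [min_eq_left h, max_eq_left (by linarith)]; ring
    · rw [min_eq_right h, max_eq_right (by linarith)]; ring
  refine ⟨g, fun x hx => ?_, fun x => ?_⟩
  · obtain ⟨e1, m, s', hm, hs', e2, e3⟩ := hg x
    suffices hs : s' = x t - x k by
      rw [hs, hm] at e2 e3
      rw [← xt] at e2
      rw [← xk] at e3
      ext j
      by_cases hjt : j = t
      · rw [hjt, e2]
      by_cases hjk : j = k
      · rw [hjk, e3]
      · rw [e1 j hjt hjk]
    simp only [coordBox, mem_ofPred_eq, not_forall, not_lt] at hx
    obtain ⟨l, hl, hlr⟩ := hx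
    have key : ∀ u : unitInterval, (c l : ℝ) < r → r ≤ |(u : ℝ) - c l| → r ≤ u := by
      intro u h1 h2
      have h3 := u.2.1
      have h4 := (c l).2.1
      rcases le_abs.1 h2 with h | h <;> linarith
    have hz : μ ≤ m → s' = x t - x k := by
      intro h
      have : max 0 (1 - m / μ) = 0 := max_eq_left (by
        have := (one_le_div hμ).2 h
        linarith)
      rw [hs', this, zero_mul, add_zero, slideFun_self]
    by_cases hlt : l = t
    · subst hlt
      obtain ⟨q1, q2⟩ := ht hl
      have q3 := key _ q1 hlr
      by_cases hmμ : μ ≤ m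
      · exact hz hmμ
      · rw [hs']
        refine slideFun_of_not_mem ha.1 ha.2 (Or.inr ?_)
        have q4 := xt x
        rw [← hm] at q4
        have q5 : max hi 0 < max (x l - x k : ℝ) 0 := by linarith
        rcases lt_max_iff.1 q5 with q6 | q6
        · exact ((le_max_left _ _).trans_lt q6).le
        · exact absurd q6 (not_lt.2 (le_max_right _ _))
    by_cases hlk : l = k
    · subst hlk
      obtain ⟨q1, q2⟩ := hk hl
      have q3 := key _ q1 hlr
      by_cases hmμ : μ ≤ m
      · exact hz hmμ
      · rw [hs']
        refine slideFun_of_not_mem ha.1 ha.2 (Or.inl ?_)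
        have q4 := xk x
        rw [← hm] at q4
        have q5 : max (-lo) 0 < max (-(x t - x l : ℝ)) 0 := by linarith
        rcases lt_max_iff.1 q5 with q6 | q6
        · have := (le_max_left (-lo) 0).trans_lt q6
          linarith
        · exact absurd q6 (not_lt.2 (le_max_right _ _))
    · have : L x = 0 := boxCut_eq_zero hρ hl (by simp [hlt, hlk]) hlr
      rw [hs', this]
      simp only [zero_mul, add_zero, sub_self, mul_zero]
      exact slideFun_self
  · obtain ⟨e1, m, s', hm, hs', e2, e3⟩ := hg x
    have hm0 : 0 ≤ m := hm ▸ le_min (x t).2.1 (x k).2.1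
    have hss : |s' - (x t - x k)| ≤ |b - a| := by
      rw [hs']
      refine (abs_slideFun_sub_le ha.1 ha.2).trans ?_
      rw [add_sub_cancel_left, add_sub_cancel_left, abs_mul, abs_mul, ← mul_assoc]
      refine mul_le_of_le_one_left (abs_nonneg _) ?_
      rw [abs_of_nonneg (le_max_left (0 : ℝ) _), abs_of_nonneg (boxCut_nonneg _)]
      refine mul_le_one₀ (max_le zero_le_one ?_) (boxCut_nonneg _) (boxCut_le_one _)
      have := div_nonneg hm0 hμ.le
      linarith
    refine ⟨e1, ?_, ?_, fun hx hmin => ?_⟩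
    · rw [e2, xt x, ← hm, add_sub_add_left_eq_sub]
      exact (abs_max_sub_max_le_abs _ _ _).trans hss
    · rw [e3, xk x, ← hm, add_sub_add_left_eq_sub]
      refine (abs_max_sub_max_le_abs _ _ _).trans ?_
      rwa [neg_sub_neg, abs_sub_comm]
    · have hL1 : L x = 1 := boxCut_eq_one hρ hx
      have e : s' = slideFun lo hi a b (x t - x k) := by
        rw [hs', hm, hmin, hL1]
        congr 1
        simp
      rw [hmin] at hm
      rw [e2, e3, e, hm, zero_add, zero_add]
      exact ⟨rfl, rfl⟩

end Box

/-- The reflection of the `k`-th coordinate of the Hilbert cube. -/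
def flipAt (k : ℕ) : (ℕ → unitInterval) ≃ₜ (ℕ → unitInterval) where
  toFun x := Function.update x k (σ (x k))
  invFun x := Function.update x k (σ (x k))
  left_inv x := by simp
  right_inv x := by simp
  continuous_toFun := continuous_id.update k (continuous_symm.comp (continuous_apply k))
  continuous_invFun := continuous_id.update k (continuous_symm.comp (continuous_apply k))

lemma flipAt_flipAt (k : ℕ) (x : ℕ → unitInterval) : flipAt k (flipAt k x) = x :=
  (flipAt k).left_inv x

lemma flipAt_self (k : ℕ) (x : ℕ → unitInterval) : (flipAt k x k : ℝ) = 1 - x k := by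
  simp [flipAt, coe_symm_eq]

lemma flipAt_of_ne {k j : ℕ} (h : j ≠ k) (x : ℕ → unitInterval) : flipAt k x j = x j :=
  Function.update_of_ne h _ _

lemma abs_flipAt_sub (k j : ℕ) (x y : ℕ → unitInterval) :
    |(flipAt k x j : ℝ) - flipAt k y j| = |(x j : ℝ) - y j| := by
  by_cases h : j = k
  · subst h
    rw [flipAt_self, flipAt_self, abs_sub_comm]
    congr 1
    ring
  · rw [flipAt_of_ne h, flipAt_of_ne h]

lemma flipAt_mem_coordBox {k n : ℕ} {c x : ℕ → unitInterval} {r : ℝ} :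
    flipAt k x ∈ coordBox (flipAt k c) n r ↔ x ∈ coordBox c n r := by
  simp only [coordBox, mem_ofPred_eq, abs_flipAt_sub]

/-- The conjugate of `g` by the reflection of the `k`-th coordinate. -/
def flipConj (k : ℕ) (g : (ℕ → unitInterval) ≃ₜ (ℕ → unitInterval)) :
    (ℕ → unitInterval) ≃ₜ (ℕ → unitInterval) := ((flipAt k).trans g).trans (flipAt k)

lemma flipConj_apply (k : ℕ) (g : (ℕ → unitInterval) ≃ₜ (ℕ → unitInterval))
    (x : ℕ → unitInterval) : flipConj k g x = flipAt k (g (flipAt k x)) := rfl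

lemma SuppIn.flipConj {k n : ℕ} {c : ℕ → unitInterval} {r : ℝ}
    {g : (ℕ → unitInterval) ≃ₜ (ℕ → unitInterval)} (h : SuppIn g (coordBox (flipAt k c) n r)) :
    SuppIn (flipConj k g) (coordBox c n r) := fun x hx => by
  rw [flipConj_apply, h _ (fun h' => hx (flipAt_mem_coordBox.1 h')), flipAt_flipAt]

section Interior

variable {c : ℕ → unitInterval} {n : ℕ} {r : ℝ}

lemma interiorize_aux {x : ℕ → unitInterval} (hr : 0 < r) (hx : x ∈ coordBox c n r)
    {t k : ℕ} (htk : t ≠ k) (hk : n ≤ k) (ht : (x t : ℝ) = 0) (hxk : (x k : ℝ) < 1) :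
    ∃ g : (ℕ → unitInterval) ≃ₜ (ℕ → unitInterval), SuppIn g (coordBox c n r) ∧
      (∀ y i, i ≠ t → i ≠ k → g y i = y i) ∧ 0 < (g x t : ℝ) ∧ (g x t : ℝ) < 1 := by
  obtain ⟨ρ, -, hρ, h3⟩ := exists_closedBox_of_compact (isCompact_singleton (x := x))
    (singleton_subset_iff.2 hx) hr
  have hk0 := (x k).2.1
  obtain ⟨μ, hμ, h1, h2⟩ : ∃ μ : ℝ, 0 < μ ∧ μ ≤ (1 - x k) / 2 ∧ μ ≤ r / 4 :=
    ⟨min ((1 - x k) / 2) (r / 4), lt_min (by linarith) (by linarith), min_le_left _ _,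
      min_le_right _ _⟩
  obtain ⟨g, hg, hg'⟩ := exists_boxCorner (c := c) (n := n) hρ htk hμ (lo := -1 + μ) (hi := μ)
    le_rfl (by linarith) (a := -(x k : ℝ)) (b := μ / 2)
    ⟨by linarith, by linarith⟩ ⟨by linarith, by linarith⟩
    (fun htn => by
      have := hx t htn
      rw [ht, zero_sub, abs_neg, abs_of_nonneg (c t).2.1] at this
      refine ⟨this, ?_⟩
      rw [max_eq_left hμ.le]
      linarith)
    (fun hkn => absurd hkn (by omega))
  refine ⟨g, hg, fun y => (hg' y).1, ?_⟩
  have := ((hg' x).2.2.2 (h3 x rfl) (by rw [ht]; exact min_eq_left hk0)).1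
  rw [ht, zero_sub, slideFun_at (by linarith) (by linarith), max_eq_left (by linarith)] at this
  rw [this]
  constructor <;> linarith

lemma interiorize_aux' {x : ℕ → unitInterval} (hr : 0 < r) (hx : x ∈ coordBox c n r)
    {t k : ℕ} (htk : t ≠ k) (hk : n ≤ k) (ht : (x t : ℝ) = 0) :
    ∃ g : (ℕ → unitInterval) ≃ₜ (ℕ → unitInterval), SuppIn g (coordBox c n r) ∧
      (∀ y i, i ≠ t → i ≠ k → g y i = y i) ∧ 0 < (g x t : ℝ) ∧ (g x t : ℝ) < 1 := by
  by_cases hxk : (x k : ℝ) < 1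
  · exact interiorize_aux hr hx htk hk ht hxk
  · have h1 := (x k).2.2
    obtain ⟨g, h1, h2, h3⟩ := interiorize_aux (c := flipAt k c) (x := flipAt k x) hr
      (flipAt_mem_coordBox.2 hx) htk hk (by rw [flipAt_of_ne htk, ht])
      (by rw [flipAt_self]; linarith)
    refine ⟨flipConj k g, h1.flipConj, fun y i hi hik => ?_, ?_⟩
    · rw [flipConj_apply, flipAt_of_ne hik, h2 _ i hi hik, flipAt_of_ne hik]
    · rw [flipConj_apply, flipAt_of_ne htk]
      exact h3

lemma exists_interiorize {x : ℕ → unitInterval} (hr : 0 < r) (hx : x ∈ coordBox c n r)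
    (t N : ℕ) : ∃ g : (ℕ → unitInterval) ≃ₜ (ℕ → unitInterval), SuppIn g (coordBox c n r) ∧
      (∀ y, ∀ i < N, i ≠ t → g y i = y i) ∧ 0 < (g x t : ℝ) ∧ (g x t : ℝ) < 1 := by
  obtain ⟨k, hk⟩ : ∃ k, n + N + t < k := ⟨_, Nat.lt_succ_self _⟩
  have htk : t ≠ k := by omega
  have h0 := (x t).2.1
  have h1 := (x t).2.2
  rcases h0.eq_or_lt with h0 | h0
  · obtain ⟨g, h1, h2, h3⟩ := interiorize_aux' hr hx htk (by omega) h0.symm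
    exact ⟨g, h1, fun y i hi hit => h2 y i hit (by omega), h3⟩
  rcases h1.eq_or_lt with h1 | h1
  · obtain ⟨g, h1, h2, h3⟩ := interiorize_aux' (c := flipAt t c) (x := flipAt t x) hr
      (flipAt_mem_coordBox.2 hx) htk (by omega) (by rw [flipAt_self, h1, sub_self])
    refine ⟨flipConj t g, h1.flipConj, fun y i hi hit => ?_, ?_⟩
    · rw [flipConj_apply, flipAt_of_ne hit, h2 _ i hit (by omega), flipAt_of_ne hit]
    · rw [flipConj_apply, flipAt_self]
      constructor <;> linarith [h3.1, h3.2]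
  · exact ⟨Homeomorph.refl _, SuppIn.refl _, fun _ _ _ _ => rfl, h0, h1⟩

lemma exists_interior_near (w : unitInterval) {ε : ℝ} (hε : 0 < ε) :
    ∃ v : ℝ, 0 < v ∧ v < 1 ∧ |v - w| < ε := by
  have h0 := w.2.1
  have h1 := w.2.2
  have h2 : (w : ℝ) ∈ closure (Ioo (0 : ℝ) 1) := by
    rw [closure_Ioo zero_ne_one]
    exact w.2
  obtain ⟨v, hv, hvw⟩ := Metric.mem_closure_iff.1 h2 ε hε
  exact ⟨v, hv.1, hv.2, by rwa [Real.dist_eq, abs_sub_comm] at hvw⟩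

lemma exists_transport_coordBox {x : ℕ → unitInterval} (hr : 0 < r) (hx : x ∈ coordBox c n r)
    {W : Set (ℕ → unitInterval)} (hW : IsOpen W) (hWV : (W ∩ coordBox c n r).Nonempty) :
    ∃ h : (ℕ → unitInterval) ≃ₜ (ℕ → unitInterval), SuppIn h (coordBox c n r) ∧ h x ∈ W := by
  obtain ⟨w, hw, hwV⟩ := hWV
  obtain ⟨m, -, ε, hε, hWε⟩ := exists_coordBox_subset (hW.mem_nhds hw) n
  have key : ∀ j, ∃ h : (ℕ → unitInterval) ≃ₜ (ℕ → unitInterval),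
      SuppIn h (coordBox c n r) ∧ ∀ i < j, |(h x i : ℝ) - w i| ≤ ε := by
    intro j
    induction j with
    | zero => exact ⟨_, SuppIn.refl _, by simp⟩
    | succ j ih =>
      obtain ⟨h, hh, hj⟩ := ih
      obtain ⟨g, hg, hg2, hg3⟩ := exists_interiorize hr (hh.apply_mem hx) j j
      obtain ⟨ε', h0, h1, h2⟩ : ∃ ε', 0 < ε' ∧ ε' ≤ ε ∧ (j < n → ε' + |(w j : ℝ) - c j| ≤ r) := by
        by_cases hjn : j < n
        · have := hwV j hjn
          exact ⟨min ε (r - |(w j : ℝ) - c j|), lt_min hε (by linarith), min_le_left _ _, fun _ => by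
            linarith [min_le_right ε (r - |(w j : ℝ) - c j|)]⟩
        · exact ⟨ε, hε, le_rfl, fun h => absurd h hjn⟩
      obtain ⟨v, hv0, hv1, hv⟩ := exists_interior_near (w j) h0
      obtain ⟨s, hs, hs1, hs2⟩ := exists_slide_point hr (hg.apply_mem (hh.apply_mem hx)) hg3.1 hg3.2
        hv0 hv1 (fun hjn => by
          have := h2 hjn
          have := abs_sub_le v (w j) (c j)
          linarith)
      refine ⟨(h.trans g).trans s, (hh.trans hg).trans hs, fun i hi => ?_⟩
      simp only [Homeomorph.trans_apply]
      rcases Nat.lt_succ_iff_lt_or_eq.1 hi with hi | rfl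
      · rw [hs1 _ i hi.ne, hg2 _ i hi hi.ne]
        exact hj i hi
      · rw [hs2]
        exact hv.le.trans h1
  obtain ⟨h, hh, hm⟩ := key m
  exact ⟨h, hh, hWε hm⟩

/-- `K` can be pushed off finitely many pairs of opposite sides of the Hilbert cube by arbitrarily
small homeomorphisms supported in `V`. -/
def Pushable (V K : Set (ℕ → unitInterval)) : Prop :=
  ∀ (S : Finset ℕ) (N : ℕ) (ε : ℝ), 0 < ε →
    ∃ g : (ℕ → unitInterval) ≃ₜ (ℕ → unitInterval), SuppIn g V ∧
      (∀ y, ∀ i < N, |(g y i : ℝ) - y i| ≤ ε) ∧ ∀ x ∈ K, ∀ k ∈ S, 0 < (g x k : ℝ) ∧ (g x k : ℝ) < 1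

lemma push_low {K : Set (ℕ → unitInterval)} (hK : IsCompact K) (hr : 0 < r)
    (hKV : K ⊆ coordBox c n r) {t k : ℕ} (htn : n ≤ t) (hKt : ∀ x ∈ K, (x t : ℝ) = 0)
    (htk : t ≠ k) {ε : ℝ} (hε : 0 < ε) :
    ∃ g : (ℕ → unitInterval) ≃ₜ (ℕ → unitInterval), SuppIn g (coordBox c n r) ∧
      (∀ y i, i ≠ t → i ≠ k → g y i = y i) ∧ (∀ y i, |(g y i : ℝ) - y i| ≤ ε) ∧
      ∀ x ∈ K, (g x t : ℝ) = 0 ∧ 0 < (g x k : ℝ) ∧ ((x k : ℝ) < 1 → (g x k : ℝ) < 1) := by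
  by_cases hc : k < n ∧ r ≤ c k
  · refine ⟨_, SuppIn.refl _, fun _ _ _ _ => rfl, fun y i => by simpa using hε.le, fun x hx =>
      ⟨hKt x hx, ?_, id⟩⟩
    have := abs_lt.1 (hKV hx k hc.1)
    change (0 : ℝ) < x k
    linarith [hc.2]
  obtain ⟨ρ, -, hρ, h3⟩ := exists_closedBox_of_compact hK hKV hr
  obtain ⟨μ, hμ, h1, h2, h2'⟩ : ∃ μ : ℝ, 0 < μ ∧ μ ≤ ε ∧ μ ≤ r / 4 ∧ μ ≤ 1 / 4 :=
    ⟨min ε (min (r / 4) (1 / 4)), lt_min hε (lt_min (by linarith) (by norm_num)), min_le_left _ _,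
      (min_le_right _ _).trans (min_le_left _ _), (min_le_right _ _).trans (min_le_right _ _)⟩
  obtain ⟨g, hg, hg'⟩ := exists_boxCorner (c := c) (n := n) hρ htk hμ (lo := -μ) (hi := μ)
    (by linarith) (by linarith) (a := 0) (b := -(μ / 2))
    ⟨by linarith, by linarith⟩ ⟨by linarith, by linarith⟩
    (fun h => absurd h (by omega))
    (fun hkn => ⟨by
      by_contra! h
      exact hc ⟨hkn, h⟩, by rw [neg_neg, max_eq_left hμ.le]; linarith⟩)
  have hab : |-(μ / 2) - 0| ≤ ε := by
    rw [sub_zero, abs_neg, abs_of_pos (by linarith)]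
    linarith
  refine ⟨g, hg, fun y => (hg' y).1, fun y i => ?_, fun x hx => ?_⟩
  · by_cases hit : i = t
    · rw [hit]
      exact (hg' y).2.1.trans hab
    by_cases hik : i = k
    · rw [hik]
      exact (hg' y).2.2.1.trans hab
    · rw [(hg' y).1 i hit hik]
      simpa using hε.le
  · have hk0 := (x k).2.1
    have := (hg' x).2.2.2 (h3 x hx) (by rw [hKt x hx]; exact min_eq_left hk0)
    rw [hKt x hx, zero_sub] at this
    rw [this.1, this.2]
    rcases le_total (-(x k : ℝ)) (-μ) with h | h
    · rw [slideFun_of_not_mem (by linarith) hμ (Or.inl h)]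
      refine ⟨max_eq_right (by linarith), lt_max_of_lt_left (by linarith), fun h' => ?_⟩
      rw [neg_neg]
      exact max_lt h' one_pos
    · have := slideFun_le_side (lo := -μ) (hi := μ) (a := 0) (b := -(μ / 2)) (s := -(x k : ℝ))
        (by linarith) hμ (by linarith) h (by linarith)
      refine ⟨max_eq_right (by linarith), lt_max_of_lt_left (by linarith), fun h' => ?_⟩
      exact max_lt (by linarith) one_pos

lemma push_one {K : Set (ℕ → unitInterval)} (hK : IsCompact K) (hr : 0 < r)
    (hKV : K ⊆ coordBox c n r) {t k : ℕ} (htn : n ≤ t) (hKt : ∀ x ∈ K, (x t : ℝ) = 0)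
    (htk : t ≠ k) {ε : ℝ} (hε : 0 < ε) :
    ∃ g : (ℕ → unitInterval) ≃ₜ (ℕ → unitInterval), SuppIn g (coordBox c n r) ∧
      (∀ y i, i ≠ t → i ≠ k → g y i = y i) ∧ (∀ y i, |(g y i : ℝ) - y i| ≤ ε) ∧
      ∀ x ∈ K, (g x t : ℝ) = 0 ∧ 0 < (g x k : ℝ) ∧ (g x k : ℝ) < 1 := by
  obtain ⟨g, hg, hg1, hg2, hg3⟩ := push_low hK hr hKV htn hKt htk (half_pos hε)
  have hK2 : IsCompact (flipAt k '' (g '' K)) :=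
    (hK.image g.continuous).image (flipAt k).continuous
  obtain ⟨h, hh, hh1, hh2, hh3⟩ := push_low (c := flipAt k c) hK2 hr (by
      rintro _ ⟨_, ⟨x, hx, rfl⟩, rfl⟩
      exact flipAt_mem_coordBox.2 (hg.apply_mem (hKV hx))) htn (by
      rintro _ ⟨_, ⟨x, hx, rfl⟩, rfl⟩
      rw [flipAt_of_ne htk]
      exact (hg3 x hx).1) htk (half_pos hε)
  refine ⟨g.trans (flipConj k h), hg.trans hh.flipConj, fun y i hit hik => ?_, fun y i => ?_,
    fun x hx => ?_⟩
  · rw [Homeomorph.trans_apply, flipConj_apply, flipAt_of_ne hik, hh1 _ i hit hik,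
      flipAt_of_ne hik, hg1 y i hit hik]
  · rw [Homeomorph.trans_apply, flipConj_apply]
    have e1 := hh2 (flipAt k (g y)) i
    rw [← abs_flipAt_sub k, flipAt_flipAt] at e1
    have := abs_sub_le (flipAt k (h (flipAt k (g y))) i : ℝ) (g y i) (y i)
    linarith [hg2 y i]
  · rw [Homeomorph.trans_apply, flipConj_apply, flipAt_of_ne htk, flipAt_self]
    obtain ⟨a1, a2, a3⟩ := hh3 _ (mem_image_of_mem _ (mem_image_of_mem _ hx))
    rw [flipAt_self] at a3
    have a4 := a3 (by linarith [(hg3 x hx).2.1])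
    exact ⟨a1, by linarith, by linarith⟩

lemma push_many {K : Set (ℕ → unitInterval)} (hK : IsCompact K) (hr : 0 < r)
    (hKV : K ⊆ coordBox c n r) {t : ℕ} (htn : n ≤ t) (hKt : ∀ x ∈ K, (x t : ℝ) = 0)
    (S : Finset ℕ) : t ∉ S → ∀ {ε : ℝ}, 0 < ε →
    ∃ g : (ℕ → unitInterval) ≃ₜ (ℕ → unitInterval), SuppIn g (coordBox c n r) ∧
      (∀ y i, |(g y i : ℝ) - y i| ≤ ε) ∧
      ∀ x ∈ K, (g x t : ℝ) = 0 ∧ ∀ k ∈ S, 0 < (g x k : ℝ) ∧ (g x k : ℝ) < 1 := by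
  induction S using Finset.induction_on with
  | empty => exact fun _ ε hε => ⟨_, SuppIn.refl _, fun y i => by simpa using hε.le,
      fun x hx => ⟨hKt x hx, by simp⟩⟩
  | insert a s ha ih =>
    intro hts ε hε
    simp only [Finset.mem_insert, not_or] at hts
    obtain ⟨g, hg, hg2, hg3⟩ := ih hts.2 (half_pos hε)
    obtain ⟨h, hh, hh1, hh2, hh3⟩ := push_one (hK.image g.continuous) hr (by
      rintro _ ⟨x, hx, rfl⟩
      exact hg.apply_mem (hKV hx)) htn (by
      rintro _ ⟨x, hx, rfl⟩
      exact (hg3 x hx).1) hts.1 (half_pos hε)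
    refine ⟨g.trans h, hg.trans hh, fun y i => ?_, fun x hx => ?_⟩
    · have := abs_sub_le (h (g y) i : ℝ) (g y i) (y i)
      rw [Homeomorph.trans_apply]
      linarith [hg2 y i, hh2 (g y) i]
    · have h1 := hh3 _ (mem_image_of_mem _ hx)
      refine ⟨h1.1, fun k hk => ?_⟩
      rw [Homeomorph.trans_apply]
      by_cases hka : k = a
      · rw [hka]
        exact h1.2
      · rw [hh1 _ k (fun h => hts.2 (h ▸ (Finset.mem_insert.1 hk).resolve_left hka)) hka]
        exact (hg3 x hx).2 k ((Finset.mem_insert.1 hk).resolve_left hka)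

lemma pushable_of_side {K : Set (ℕ → unitInterval)} (hK : IsCompact K) (hr : 0 < r)
    (hKV : K ⊆ coordBox c n r) {t : ℕ} (htn : n ≤ t) (hKt : ∀ x ∈ K, (x t : ℝ) = 0) :
    Pushable (coordBox c n r) K := by
  intro S N ε hε
  obtain ⟨k, hkS, hk⟩ : ∃ k ∉ S, n + N + t < k := by
    obtain ⟨k, hk⟩ := (insert (n + N + t) S).exists_nat_subset_range
    refine ⟨k, fun h => ?_, ?_⟩
    · exact lt_irrefl k (Finset.mem_range.1 (hk (Finset.mem_insert_of_mem h)))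
    · exact Finset.mem_range.1 (hk (Finset.mem_insert_self _ _))
  have htk : t ≠ k := by omega
  obtain ⟨g, hg, hg2, hg3⟩ := push_many hK hr hKV htn hKt (insert k (S.erase t))
    (by simp [htk]) (half_pos hε)
  have hK1 := hK.image g.continuous
  have hK1V : g '' K ⊆ coordBox c n r := by
    rintro _ ⟨x, hx, rfl⟩
    exact hg.apply_mem (hKV hx)
  obtain ⟨a, ha, ha1⟩ := hK1.exists_pos_le (f := fun x => 1 - (x k : ℝ))
    (continuous_const.sub (continuous_coord k)).continuousOn (by
      rintro _ ⟨x, hx, rfl⟩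
      linarith [((hg3 x hx).2 k (by simp)).2])
  obtain ⟨μ, hμ, h1, h2⟩ : ∃ μ : ℝ, 0 < μ ∧ μ ≤ ε / 2 ∧ μ ≤ 1 / 2 :=
    ⟨min (ε / 2) (1 / 2), lt_min (by linarith) (by norm_num), min_le_left _ _, min_le_right _ _⟩
  have hlo : boxLo c n r k = 0 := if_neg (by omega)
  have hhi : boxHi c n r k = 1 := if_neg (by omega)
  obtain ⟨ρ, -, hρ, h3⟩ := exists_closedBox_of_compact hK1 hK1V hr
  have hA : boxLo c n r k < max (1 / 2) (1 - a) ∧ max (1 / 2) (1 - a) < boxHi c n r k := by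
    rw [hlo, hhi]
    exact ⟨lt_max_of_lt_left (by norm_num), max_lt (by norm_num) (by linarith)⟩
  have hB : boxLo c n r k < μ / 4 ∧ μ / 4 < boxHi c n r k := by
    rw [hlo, hhi]
    constructor <;> linarith
  obtain ⟨s, hs, hs'⟩ := exists_boxSlide hρ k (A := fun _ => max (1 / 2) (1 - a))
    (B := fun _ => μ / 4) continuous_const continuous_const (indepOf_const _ _) (indepOf_const _ _)
    (fun _ => hA) (fun _ => hB)
  have hK2 : IsCompact (s '' (g '' K)) := hK1.image s.continuous
  have hK2V : s '' (g '' K) ⊆ coordBox c n r := by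
    rintro _ ⟨x, hx, rfl⟩
    exact hs.apply_mem (hK1V hx)
  have hsk : ∀ x ∈ K, (s (g x) k : ℝ) ≤ μ / 4 := by
    intro x hx
    rw [(hs' _).2.2 (h3 _ (mem_image_of_mem _ hx))]
    refine (slideFun_le_side hA.1 hA.2 hB.1 ?_ ?_).2
    · rw [hlo]
      exact (g x k).2.1
    · exact le_max_of_le_right (by linarith [ha1 _ (mem_image_of_mem _ hx)])
  obtain ⟨ρ', -, hρ', h3'⟩ := exists_closedBox_of_compact hK2 hK2V hr
  obtain ⟨q, hq, hq'⟩ := exists_boxCorner (c := c) (n := n) hρ' htk hμ (lo := -μ) (hi := μ)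
    (by linarith) (by linarith) (a := -(μ / 4)) (b := μ / 4)
    ⟨by linarith, by linarith⟩ ⟨by linarith, by linarith⟩
    (fun h => absurd h (by omega)) (fun h => absurd h (by omega))
  refine ⟨(g.trans s).trans q, (hg.trans hs).trans hq, fun y i hi => ?_, fun x hx j hj => ?_⟩
  · simp only [Homeomorph.trans_apply]
    have hik : i ≠ k := by omega
    have e1 : |(q (s (g y)) i : ℝ) - s (g y) i| ≤ ε / 2 := by
      by_cases hit : i = t
      · rw [hit]
        refine (hq' _).2.1.trans ?_
        rw [abs_of_pos (by linarith)]
        linarith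
      · rw [(hq' _).1 i hit hik]
        simpa using (half_pos hε).le
    rw [(hs' _).1 i hik] at e1
    have := abs_sub_le (q (s (g y)) i : ℝ) (g y i) (y i)
    linarith [hg2 y i]
  · simp only [Homeomorph.trans_apply]
    have hjk : j ≠ k := fun h => hkS (h ▸ hj)
    by_cases hjt : j = t
    · rw [hjt]
      have e0 : (s (g x) t : ℝ) = 0 := by
        rw [(hs' _).1 t htk]
        exact (hg3 x hx).1
      have e1 := (s (g x) k).2.1
      have := ((hq' _).2.2.2 (h3' _ (mem_image_of_mem _ (mem_image_of_mem _ hx)))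
        (by rw [e0]; exact min_eq_left e1)).1
      rw [e0, zero_sub] at this
      have e2 := hsk x hx
      have e3 := slideFun_ge_side (lo := -μ) (hi := μ) (a := -(μ / 4)) (b := μ / 4)
        (s := -(s (g x) k : ℝ)) (by linarith) (by linarith) (by linarith) (by linarith)
        (by linarith)
      rw [this, max_eq_left (by linarith)]
      constructor <;> linarith
    · rw [(hq' _).1 j hjt hjk, (hs' _).1 j hjk]
      exact (hg3 x hx).2 j (by simp [hjk, hjt, hj])

end Interior

section Carriers

variable {c : ℕ → unitInterval} {n : ℕ} {r : ℝ}

lemma exists_write_one {K : Set (ℕ → unitInterval)} (hK : IsCompact K) (hr : 0 < r)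
    (hKV : K ⊆ coordBox c n r) {k : ℕ} (hk : n ≤ k) (hkK : ∀ x ∈ K, 0 < (x k : ℝ) ∧ (x k : ℝ) < 1)
    {γ : (ℕ → unitInterval) → ℝ} (hγ : Continuous γ) (hγk : IndepOf γ {k})
    (hγ01 : ∀ x, 0 < γ x ∧ γ x < 1) {δ : ℝ} (hδ : 0 < δ) :
    ∃ g : (ℕ → unitInterval) ≃ₜ (ℕ → unitInterval), SuppIn g (coordBox c n r) ∧
      (∀ x, ∀ j ≠ k, g x j = x j) ∧ ∀ x ∈ K, |(g x k : ℝ) - γ x| ≤ δ := by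
  wlog hδ1 : δ < 1 generalizing δ
  · obtain ⟨g, h1, h2, h3⟩ := this (δ := 1 / 2) (by norm_num) (by norm_num)
    exact ⟨g, h1, h2, fun x hx => (h3 x hx).trans (by linarith)⟩
  obtain ⟨a₁, ha₁, h₁⟩ := hK.exists_pos_le (continuous_coord k).continuousOn
    fun x hx => (hkK x hx).1
  obtain ⟨a₂, ha₂, h₂⟩ := hK.exists_pos_le (f := fun x => 1 - (x k : ℝ))
    (continuous_const.sub (continuous_coord k)).continuousOn fun x hx => by linarith [(hkK x hx).2]
  obtain ⟨a, ha0, ha1, haK⟩ : ∃ a, 0 < a ∧ a < 1 ∧ ∀ x ∈ K, a ≤ (x k : ℝ) ∧ (x k : ℝ) ≤ 1 - a := by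
    refine ⟨min (1 / 2) (min a₁ a₂), by positivity,
      (min_le_left _ _).trans_lt (by norm_num), fun x hx => ?_⟩
    have h3 : min (1 / 2) (min a₁ a₂) ≤ a₁ := (min_le_right _ _).trans (min_le_left _ _)
    have h4 : min (1 / 2) (min a₁ a₂) ≤ a₂ := (min_le_right _ _).trans (min_le_right _ _)
    have h5 := h₂ x hx
    exact ⟨h3.trans (h₁ x hx), by linarith⟩
  have hlo : boxLo c n r k = 0 := if_neg (by omega)
  have hhi : boxHi c n r k = 1 := if_neg (by omega)
  obtain ⟨ρ, -, hρ, hKρ⟩ := exists_closedBox_of_compact hK hKV hr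
  have had : 0 < a * δ := mul_pos ha0 hδ
  have had1 : a * δ < 1 := by nlinarith
  obtain ⟨g₁, s₁, H₁⟩ := exists_boxSlide (c := c) hρ k (A := fun _ => 1 - a) (B := fun _ => δ)
    continuous_const continuous_const (indepOf_const _ _) (indepOf_const _ _)
    (fun x => by rw [hlo, hhi]; constructor <;> linarith)
    (fun x => by rw [hlo, hhi]; constructor <;> linarith)
  obtain ⟨g₂, s₂, H₂⟩ := exists_boxSlide (c := c) hρ k (A := fun _ => a * δ) (B := γ)
    continuous_const hγ (indepOf_const _ _) hγk
    (fun x => by rw [hlo, hhi]; constructor <;> linarith) (fun x => by rw [hlo, hhi]; exact hγ01 x)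
  refine ⟨g₁.trans g₂, s₁.trans s₂, fun x j hj => ?_, fun x hx => ?_⟩
  · simp only [Homeomorph.trans_apply]
    rw [(H₂ _).1 j hj, (H₁ _).1 j hj]
  simp only [Homeomorph.trans_apply]
  have e1 := (H₁ x).2.2 (hKρ x hx)
  have e2 := (H₂ (g₁ x)).2.2 fun l hl => by
    rw [(H₁ _).1 l (by omega)]
    exact hKρ x hx l hl
  have hgx : γ (g₁ x) = γ x := hγk _ _ fun j hj => (H₁ _).1 j (by simpa using hj)
  rw [hlo, hhi] at e1 e2
  obtain ⟨k1, k2⟩ := haK x hx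
  rw [slideFun_of_le (by linarith) (by linarith) (by linarith) k2] at e1
  simp only [zero_add, sub_zero] at e1
  have b1 : a * δ ≤ (g₁ x k : ℝ) := by
    rw [e1, le_div_iff₀ (by linarith)]
    nlinarith
  have b2 : (g₁ x k : ℝ) ≤ δ := by
    rw [e1, div_le_iff₀ (by linarith)]
    nlinarith
  rw [hgx, slideFun_of_ge had had1 b1 (g₁ x k).2.2] at e2
  obtain ⟨c1, c2⟩ := hγ01 x
  rw [e2, abs_le]
  set s := (g₁ x k : ℝ)
  have d1 : (1 - s) * (1 - γ x) / (1 - a * δ) ≤ 1 - γ x := by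
    rw [div_le_iff₀ (by linarith)]
    nlinarith
  have d2 : (1 - δ) * (1 - γ x) ≤ (1 - s) * (1 - γ x) / (1 - a * δ) := by
    rw [le_div_iff₀ (by linarith)]
    have : (1 - δ) * (1 - γ x) ≤ (1 - s) * (1 - γ x) := by nlinarith
    have h0 : 0 ≤ (1 - δ) * (1 - γ x) := mul_nonneg (by linarith) (by linarith)
    nlinarith
  constructor <;> nlinarith

lemma exists_write {K : Set (ℕ → unitInterval)} (hK : IsCompact K) (hr : 0 < r)
    (hKV : K ⊆ coordBox c n r) {p : ℕ} (hp : n ≤ p) {γ : ℕ → (ℕ → unitInterval) → ℝ}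
    (hγ : ∀ k, Continuous (γ k)) (hγp : ∀ k, IndepOf (γ k) {j | p ≤ j})
    (hγ01 : ∀ k x, 0 < γ k x ∧ γ k x < 1) {δ : ℝ} (hδ : 0 < δ) (T : Finset ℕ)
    (hT : ∀ k ∈ T, p ≤ k) (hKT : ∀ x ∈ K, ∀ k ∈ T, 0 < (x k : ℝ) ∧ (x k : ℝ) < 1) :
    ∃ g : (ℕ → unitInterval) ≃ₜ (ℕ → unitInterval), SuppIn g (coordBox c n r) ∧
      (∀ x, ∀ j ∉ T, g x j = x j) ∧ ∀ x ∈ K, ∀ k ∈ T, |(g x k : ℝ) - γ k x| ≤ δ := by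
  induction T using Finset.induction_on with
  | empty => exact ⟨Homeomorph.refl _, SuppIn.refl _, fun _ _ _ => rfl, by simp⟩
  | insert k T hkT ih =>
    obtain ⟨g, hg, hg1, hg2⟩ := ih (fun k hk => hT k (Finset.mem_insert_of_mem hk))
      fun x hx k hk => hKT x hx k (Finset.mem_insert_of_mem hk)
    obtain ⟨g', hg', hg1', hg2'⟩ := exists_write_one (c := c) (hK.image g.continuous) hr
      (by rintro _ ⟨x, hx, rfl⟩; exact hg.apply_mem (hKV hx)) (hp.trans (hT k (by simp)))
      (by
        rintro _ ⟨x, hx, rfl⟩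
        rw [hg1 x k hkT]
        exact hKT x hx k (by simp)) (hγ k)
      (fun x y h => hγp k x y fun j hj => h j fun e => hj (by
        rw [mem_singleton_iff.1 e]; exact hT k (by simp))) (hγ01 k) hδ
    refine ⟨g.trans g', hg.trans hg', fun x j hj => ?_, fun x hx j hj => ?_⟩
    · simp only [Homeomorph.trans_apply]
      rw [hg1' _ _ fun h => hj (h ▸ Finset.mem_insert_self _ _),
        hg1 _ _ fun h => hj (Finset.mem_insert_of_mem h)]
    · simp only [Homeomorph.trans_apply]
      by_cases hjk : j = k
      · subst hjk
        have := hg2' _ (mem_image_of_mem _ hx)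
        rwa [hγp j (g x) x fun l hl => hg1 x l fun h =>
          hl (hT l (Finset.mem_insert_of_mem h))] at this
      · rw [hg1' _ _ hjk]
        exact hg2 x hx j (Finset.mem_of_mem_insert_of_ne hj hjk)

lemma abs_max_min_sub_le {lo hi s t : ℝ} (ht : lo ≤ t) (ht' : t ≤ hi) :
    |max lo (min s hi) - t| ≤ |s - t| := by
  rcases le_total s hi with h | h
  · rw [min_eq_left h]
    rcases le_total lo s with h' | h'
    · rw [max_eq_right h']
    · rw [max_eq_left h', abs_of_nonpos (by linarith), abs_of_nonpos (by linarith)]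
      linarith
  · rw [min_eq_right h, max_eq_right (by linarith), abs_of_nonneg (by linarith),
      abs_of_nonneg (by linarith)]
    linarith

lemma exists_read_one {K : Set (ℕ → unitInterval)} (hK : IsCompact K) (hr : 0 < r)
    (hKV : K ⊆ coordBox c n r) {i k k' : ℕ} (hk : k ≠ i) (hk' : k' ≠ i) {b δ θ e : ℝ}
    (hb : 0 < b) (he : 0 ≤ e) (hb2 : boxLo c n r i + b ≤ boxHi c n r i - b)
    (hKb : ∀ x ∈ K, boxLo c n r i + b ≤ x i ∧ (x i : ℝ) ≤ boxHi c n r i - b)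
    (hKk : ∀ x ∈ K, |(x k : ℝ) - x i| ≤ δ) :
    ∃ g : (ℕ → unitInterval) ≃ₜ (ℕ → unitInterval), SuppIn g (coordBox c n r) ∧
      (∀ x, ∀ j ≠ i, g x j = x j) ∧ (∀ x, |(g x i : ℝ) - x i| ≤ e) ∧
      ∀ x ∈ K, ∀ v : ℝ, boxLo c n r i ≤ v → v ≤ boxHi c n r i → |(x k' : ℝ) - v| ≤ θ →
        |(x i : ℝ) - v| ≤ e + θ → |(g x i : ℝ) - v| ≤ δ / b + 3 * θ + 2 * b + δ := by
  set lo := boxLo c n r i with hlo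
  set hi := boxHi c n r i with hhi
  obtain ⟨ρ, -, hρ, hKρ⟩ := exists_closedBox_of_compact hK hKV hr
  set A : (ℕ → unitInterval) → ℝ := fun x => max (lo + b) (min (x k) (hi - b)) with hA
  set w : (ℕ → unitInterval) → ℝ := fun x => max (lo + b) (min (x k') (hi - b)) with hw
  set B : (ℕ → unitInterval) → ℝ := fun x => A x + max (-e) (min (w x - A x) e) with hB
  have hAc : Continuous A := continuous_const.max ((continuous_coord k).min continuous_const)
  have hwc : Continuous w := continuous_const.max ((continuous_coord k').min continuous_const)
  have hA1 : ∀ x, lo + b ≤ A x ∧ A x ≤ hi - b := fun x =>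
    ⟨le_max_left _ _, max_le hb2 (min_le_right _ _)⟩
  have hw1 : ∀ x, lo + b ≤ w x ∧ w x ≤ hi - b := fun x =>
    ⟨le_max_left _ _, max_le hb2 (min_le_right _ _)⟩
  have hB1 : ∀ x, lo + b ≤ B x ∧ B x ≤ hi - b := by
    intro x
    obtain ⟨a1, a2⟩ := hA1 x
    obtain ⟨w1, w2⟩ := hw1 x
    have : min 0 (w x - A x) ≤ max (-e) (min (w x - A x) e) := by
      refine le_max_of_le_right (le_min (min_le_right _ _) ((min_le_left _ _).trans he))
    have h2 : max (-e) (min (w x - A x) e) ≤ max 0 (w x - A x) :=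
      max_le ((by linarith : -e ≤ 0).trans (le_max_left _ _))
        ((min_le_left _ _).trans (le_max_right _ _))
    simp only [hB]
    constructor
    · rcases min_choice 0 (w x - A x) with h | h <;> rw [h] at this <;> linarith
    · rcases max_choice 0 (w x - A x) with h | h <;> rw [h] at h2 <;> linarith
  have hAi : IndepOf A {i} := fun x y h => by simp only [hA]; rw [h k (by simpa using hk)]
  have hwi : IndepOf w {i} := fun x y h => by simp only [hw]; rw [h k' (by simpa using hk')]
  obtain ⟨g, hg, H⟩ := exists_boxSlide (c := c) hρ i (A := A) (B := B) hAc
    (hAc.add (continuous_const.max ((hwc.sub hAc).min continuous_const))) hAi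
    (fun x y h => by simp only [hB]; rw [hAi x y h, hwi x y h])
    (fun x => ⟨by linarith [(hA1 x).1], by linarith [(hA1 x).2]⟩)
    (fun x => ⟨by linarith [(hB1 x).1], by linarith [(hB1 x).2]⟩)
  have hBA : ∀ x, |B x - A x| ≤ e := fun x => by
    simp only [hB, add_sub_cancel_left]
    exact abs_le.2 ⟨le_max_left _ _, max_le (by linarith) (min_le_right _ _)⟩
  refine ⟨g, hg, fun x => (H x).1, fun x => (H x).2.1.trans (hBA x), fun x hx v hv1 hv2 h1 h2 => ?_⟩
  rw [(H x).2.2 (hKρ x hx)]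
  have k1 : |A x - x i| ≤ δ :=
    (abs_max_min_sub_le (hKb x hx).1 (hKb x hx).2).trans (hKk x hx)
  have k2 : |w x - v| ≤ θ + b := by
    obtain ⟨q1, q2⟩ := abs_le.1 h1
    rw [abs_le]
    simp only [hw]
    constructor
    · rcases le_total (x k' : ℝ) (hi - b) with h | h
      · rw [min_eq_left h]
        have := le_max_right (lo + b) (x k' : ℝ)
        linarith
      · rw [min_eq_right h]
        have := le_max_right (lo + b) (hi - b)
        linarith [abs_nonneg ((x k' : ℝ) - v)]
    · rw [sub_le_iff_le_add]
      refine max_le ?_ ((min_le_left _ _).trans ?_) <;> linarith [abs_nonneg ((x k' : ℝ) - v)]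
  have k3 : |slideFun lo hi (A x) (B x) (x i) - B x| ≤ |(x i : ℝ) - A x| / b := by
    refine abs_slideFun_sub_at_le hb (hA1 x).1 (hA1 x).2 (by linarith [(hB1 x).1])
      (by linarith [(hB1 x).2]) ?_ ⟨by linarith [(hKb x hx).1], by linarith [(hKb x hx).2]⟩
    have := boxLo_nonneg (c := c) (n := n) (r := r) i
    have := boxHi_le_one (c := c) (n := n) (r := r) i
    linarith
  have k4 : |(x i : ℝ) - A x| / b ≤ δ / b := by
    rw [abs_sub_comm]
    gcongr
  have k5 : |B x - w x| ≤ 2 * θ + b + δ := by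
    obtain ⟨q1, q2⟩ := abs_le.1 k1
    obtain ⟨q3, q4⟩ := abs_le.1 k2
    obtain ⟨q5, q6⟩ := abs_le.1 h2
    have q7 : 0 ≤ θ := (abs_nonneg _).trans h1
    have q8 : 0 ≤ δ := (abs_nonneg _).trans k1
    rw [abs_le]
    simp only [hB]
    rcases le_total (w x - A x) e with h | h
    · rw [min_eq_left h]
      rcases le_total (-e) (w x - A x) with h' | h'
      · rw [max_eq_right h']
        constructor <;> linarith
      · rw [max_eq_left h']
        constructor <;> linarith
    · rw [min_eq_right h, max_eq_right (by linarith)]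
      constructor <;> linarith
  have t1 := abs_sub_le (slideFun lo hi (A x) (B x) (x i)) (B x) v
  have t2 := abs_sub_le (B x) (w x) v
  linarith

lemma exists_read {K : Set (ℕ → unitInterval)} (hK : IsCompact K) (hr : 0 < r)
    (hKV : K ⊆ coordBox c n r) {N : ℕ} {k k' : ℕ → ℕ} (hk : ∀ i, N ≤ k i) (hk' : ∀ i, N ≤ k' i)
    {b δ θ : ℝ} {e : ℕ → ℝ}
    (hb : 0 < b) (he : ∀ i, 0 ≤ e i) (hb2 : ∀ i < N, boxLo c n r i + b ≤ boxHi c n r i - b)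
    (hKb : ∀ x ∈ K, ∀ i < N, boxLo c n r i + b ≤ x i ∧ (x i : ℝ) ≤ boxHi c n r i - b)
    (hKk : ∀ x ∈ K, ∀ i < N, |(x (k i) : ℝ) - x i| ≤ δ) :
    ∀ s ≤ N, ∃ g : (ℕ → unitInterval) ≃ₜ (ℕ → unitInterval), SuppIn g (coordBox c n r) ∧
      (∀ x, ∀ j, s ≤ j → g x j = x j) ∧ (∀ x i, |(g x i : ℝ) - x i| ≤ e i) ∧
      ∀ x ∈ K, ∀ i < s, ∀ v : ℝ, boxLo c n r i ≤ v → v ≤ boxHi c n r i → |(x (k' i) : ℝ) - v| ≤ θ →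
        |(x i : ℝ) - v| ≤ e i + θ → |(g x i : ℝ) - v| ≤ δ / b + 3 * θ + 2 * b + δ := by
  intro s
  induction s with
  | zero => exact fun _ => ⟨Homeomorph.refl _, SuppIn.refl _, fun _ _ _ => rfl,
      fun x i => by simpa using he i, by simp⟩
  | succ s ih =>
    intro hs
    obtain ⟨g, hg, hg1, hg2, hg3⟩ := ih (by omega)
    have hks : k s ≠ s := by have := hk s; omega
    have hks' : k' s ≠ s := by have := hk' s; omega
    have fk : ∀ x, g x (k s) = x (k s) := fun x => hg1 x _ (by have := hk s; omega)
    have fk' : ∀ x, g x (k' s) = x (k' s) := fun x => hg1 x _ (by have := hk' s; omega)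
    obtain ⟨g', hg', hg1', hg2', hg3'⟩ := exists_read_one (c := c) (hK.image g.continuous) hr
      (by rintro _ ⟨x, hx, rfl⟩; exact hg.apply_mem (hKV hx)) hks hks' (δ := δ) (θ := θ) hb (he s)
      (hb2 s (by omega))
      (by
        rintro _ ⟨x, hx, rfl⟩
        rw [hg1 x s le_rfl]
        exact hKb x hx s (by omega))
      (by
        rintro _ ⟨x, hx, rfl⟩
        rw [hg1 x s le_rfl, fk]
        exact hKk x hx s (by omega))
    refine ⟨g.trans g', hg.trans hg', fun x j hj => ?_, fun x i => ?_,
      fun x hx i hi v v1 v2 v3 v4 => ?_⟩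
    · simp only [Homeomorph.trans_apply]
      rw [hg1' _ _ (by omega), hg1 _ _ (by omega)]
    · simp only [Homeomorph.trans_apply]
      by_cases his : i = s
      · subst his
        simpa [hg1 x i le_rfl] using hg2' (g x)
      · rw [hg1' _ _ his]
        exact hg2 x i
    · simp only [Homeomorph.trans_apply]
      by_cases his : i = s
      · subst his
        exact hg3' _ (mem_image_of_mem _ hx) v v1 v2 (by rwa [fk']) (by rwa [hg1 x i le_rfl])
      · rw [hg1' _ _ his]
        exact hg3 x hx i (by omega) v v1 v2 v3 v4

end Carriers

lemma exists_modulus {W : Set ((ℕ → unitInterval) × (ℕ → unitInterval))} (hW : IsOpen W)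
    (hd : ∀ x, (x, x) ∈ W) :
    ∃ (p : ℕ) (δ : ℝ), 0 < δ ∧ ∀ x y : ℕ → unitInterval,
      (∀ j < p, |(x j : ℝ) - y j| ≤ δ) → (x, y) ∈ W := by
  let E : ℕ → Set ((ℕ → unitInterval) × (ℕ → unitInterval)) := fun p =>
    {z | ∀ j < p, |(z.1 j : ℝ) - z.2 j| ≤ 1 / (p + 1)}
  have hE : ∀ p, IsClosed (E p) := by
    intro p
    have : E p = ⋂ j ∈ Finset.range p, {z | |(z.1 j : ℝ) - z.2 j| ≤ 1 / (p + 1)} := by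
      ext z
      simp [E]
    rw [this]
    refine isClosed_biInter fun j _ => isClosed_le ?_ continuous_const
    exact (((continuous_coord j).comp continuous_fst).sub
      ((continuous_coord j).comp continuous_snd)).abs
  have hmono : ∀ p q, p ≤ q → E q ⊆ E p := by
    intro p q hpq z hz j hj
    refine (hz j (by omega)).trans ?_
    exact one_div_le_one_div_of_le (by positivity) (by exact_mod_cast Nat.succ_le_succ hpq)
  obtain ⟨p, hp⟩ := exists_subset_nhds_of_isCompact' (V := E) (U := W)
    (fun p q => ⟨max p q, hmono _ _ (le_max_left _ _), hmono _ _ (le_max_right _ _)⟩)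
    (fun p => (hE p).isCompact) hE (by
      rintro ⟨x, y⟩ hxy
      have : x = y := by
        funext j
        by_contra hne
        have h0 : 0 < |(x j : ℝ) - y j| :=
          abs_pos.2 (sub_ne_zero.2 fun h => hne (Subtype.ext h))
        obtain ⟨m, hm⟩ := exists_nat_one_div_lt h0
        have h1 : (x, y) ∈ E (m + j + 1) := mem_iInter.1 hxy _
        have h2 := h1 j (by omega)
        have h3 : (1 : ℝ) / (((m + j + 1 : ℕ) : ℝ) + 1) ≤ 1 / (m + 1) := by
          refine one_div_le_one_div_of_le (by positivity) ?_
          push_cast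
          have : (0 : ℝ) ≤ j := j.cast_nonneg
          linarith
        simp only at h2
        linarith
      subst this
      exact hW.mem_nhds (hd x))
  exact ⟨p, 1 / (p + 1), by positivity, fun x y h => hp h⟩

lemma exists_modulus_coord {M : (ℕ → unitInterval) → ℕ → unitInterval} (hM : Continuous M) (N : ℕ)
    {η : ℝ} (hη : 0 < η) : ∃ (p : ℕ) (δ : ℝ), 0 < δ ∧ ∀ x y : ℕ → unitInterval,
      (∀ j < p, |(x j : ℝ) - y j| ≤ δ) → ∀ i < N, |(M x i : ℝ) - M y i| < η := by
  refine exists_modulus (W := {z | ∀ i < N, |(M z.1 i : ℝ) - M z.2 i| < η}) ?_ fun x i _ => by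
    simpa using hη
  have : {z : (ℕ → unitInterval) × (ℕ → unitInterval) | ∀ i < N, |(M z.1 i : ℝ) - M z.2 i| < η} =
      ⋂ i ∈ Finset.range N, {z | |(M z.1 i : ℝ) - M z.2 i| < η} := by
    ext z
    simp
  rw [this]
  refine isOpen_biInter_finset fun i _ => isOpen_lt ?_ continuous_const
  exact (((continuous_coord i).comp (hM.comp continuous_fst)).sub
    ((continuous_coord i).comp (hM.comp continuous_snd))).abs

section Approx

variable {c : ℕ → unitInterval} {n : ℕ} {r : ℝ}

lemma mem_boxLo_boxHi {x : ℕ → unitInterval} (hx : x ∈ coordBox c n r) (i : ℕ) :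
    boxLo c n r i ≤ x i ∧ (x i : ℝ) ≤ boxHi c n r i := by
  unfold boxLo boxHi
  split_ifs with hi
  · have := abs_lt.1 (hx i hi)
    exact ⟨max_le (x i).2.1 (by linarith), le_min (x i).2.2 (by linarith)⟩
  · exact (x i).2

lemma exists_margin {K : Set (ℕ → unitInterval)} (hK : IsCompact K) (hKne : K.Nonempty)
    (hKV : K ⊆ coordBox c n r) {N : ℕ} (hK01 : ∀ x ∈ K, ∀ i < N, 0 < (x i : ℝ) ∧ (x i : ℝ) < 1)
    {η : ℝ} (hη : 0 < η) :
    ∃ b, 0 < b ∧ b ≤ η ∧ ∀ i < N, boxLo c n r i + b ≤ boxHi c n r i - b ∧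
      ∀ x ∈ K, boxLo c n r i + b ≤ x i ∧ (x i : ℝ) ≤ boxHi c n r i - b := by
  suffices H : ∃ b, 0 < b ∧ b ≤ η ∧ ∀ i < N,
      ∀ x ∈ K, boxLo c n r i + b ≤ x i ∧ (x i : ℝ) ≤ boxHi c n r i - b by
    obtain ⟨b, h1, h2, h3⟩ := H
    obtain ⟨x, hx⟩ := hKne
    exact ⟨b, h1, h2, fun i hi => ⟨(h3 i hi x hx).1.trans (h3 i hi x hx).2, h3 i hi⟩⟩
  induction N with
  | zero => exact ⟨η, hη, le_rfl, by simp⟩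
  | succ N ih =>
    obtain ⟨b, b0, b1, hb⟩ := ih fun x hx i hi => hK01 x hx i (by omega)
    obtain ⟨a₁, ha₁, h₁⟩ := hK.exists_pos_le (f := fun x => (x N : ℝ) - boxLo c n r N)
      ((continuous_coord N).sub continuous_const).continuousOn fun x hx => by
        have := lt_boxLo_boxHi (c := c) (n := n) (r := r) (hK01 x hx N (by omega)).1
          (hK01 x hx N (by omega)).2 fun h => hKV hx N h
        linarith [this.1]
    obtain ⟨a₂, ha₂, h₂⟩ := hK.exists_pos_le (f := fun x => boxHi c n r N - (x N : ℝ))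
      (continuous_const.sub (continuous_coord N)).continuousOn fun x hx => by
        have := lt_boxLo_boxHi (c := c) (n := n) (r := r) (hK01 x hx N (by omega)).1
          (hK01 x hx N (by omega)).2 fun h => hKV hx N h
        linarith [this.2]
    have m1 : min b (min a₁ a₂) ≤ a₁ := (min_le_right _ _).trans (min_le_left _ _)
    have m2 : min b (min a₁ a₂) ≤ a₂ := (min_le_right _ _).trans (min_le_right _ _)
    have m3 : min b (min a₁ a₂) ≤ b := min_le_left _ _
    refine ⟨min b (min a₁ a₂), by positivity, m3.trans b1, fun i hi x hx => ?_⟩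
    rcases Nat.lt_succ_iff_lt_or_eq.1 hi with h | rfl
    · have := hb i h x hx
      constructor <;> linarith
    · have h3 := h₁ x hx
      have h4 := h₂ x hx
      constructor <;> linarith

/-- A pushable compact subset of a box can be moved arbitrarily close to any prescribed map into the
box by a homeomorphism which does not move points much farther than that map does. -/
theorem exists_approx (hr : 0 < r) {K : Set (ℕ → unitInterval)} (hK : IsCompact K)
    (hKV : K ⊆ coordBox c n r) (hP : Pushable (coordBox c n r) K)
    {m : (ℕ → unitInterval) → ℕ → unitInterval} (hm : ContinuousOn m K)
    (hmV : MapsTo m K (coordBox c n r)) {e : ℕ → ℝ} (he : ∀ i, 0 ≤ e i)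
    (hclose : ∀ x ∈ K, ∀ i, |(x i : ℝ) - m x i| ≤ e i) (N : ℕ) {η : ℝ} (hη : 0 < η) :
    ∃ g : (ℕ → unitInterval) ≃ₜ (ℕ → unitInterval), SuppIn g (coordBox c n r) ∧
      (∀ x, ∀ i < N, |(g x i : ℝ) - x i| ≤ e i + η) ∧
      ∀ x ∈ K, ∀ i < N, |(g x i : ℝ) - m x i| ≤ η := by
  rcases K.eq_empty_or_nonempty with rfl | hKne
  · exact ⟨Homeomorph.refl _, SuppIn.refl _, fun x i _ => by simpa using by linarith [he i],
      by simp⟩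
  obtain ⟨M, hM⟩ := ContinuousMap.exists_restrict_eq hK.isClosed ⟨K.domRestrict m, hm.domRestrict⟩
  have hMm : ∀ x ∈ K, M x = m x := fun x hx => congrArg (fun f => f ⟨x, hx⟩) hM
  set ζ := η / 13 with hζ
  have hζ0 : 0 < ζ := by positivity
  obtain ⟨p₀, δ₀, hδ₀, hmod⟩ := exists_modulus_coord M.continuous N hζ0
  set p := max p₀ (max n N) with hp
  have hpp : p₀ ≤ p := le_max_left _ _
  have hpn : n ≤ p := (le_max_left _ _).trans (le_max_right _ _)
  have hpN : N ≤ p := (le_max_right _ _).trans (le_max_right _ _)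
  let tr : (ℕ → unitInterval) → ℕ → unitInterval := fun x j => if j < p then x j else 0
  have htr : Continuous tr := continuous_pi fun j => by
    simp only [tr]
    split_ifs
    · exact continuous_apply j
    · exact continuous_const
  have htri : ∀ x y : ℕ → unitInterval, (∀ j ∉ {j | p ≤ j}, x j = y j) → tr x = tr y := by
    intro x y h
    funext j
    simp only [tr]
    split_ifs with hj
    · exact h j (by simpa using hj)
    · rfl
  obtain ⟨f, hf, hf1, hf2⟩ := hP (Finset.range (p + 2 * N)) p (min δ₀ ζ) (by positivity)
  have hK' := hK.image f.continuous
  have hKV' : f '' K ⊆ coordBox c n r := by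
    rintro _ ⟨x, hx, rfl⟩
    exact hf.apply_mem (hKV hx)
  obtain ⟨b, b0, b1, hb⟩ := exists_margin hK' (hKne.image f) hKV' (N := N) (by
    rintro _ ⟨x, hx, rfl⟩ i hi
    exact hf2 x hx i (Finset.mem_range.2 (by omega))) (η := min ζ (1 / 3)) (by positivity)
  have b2 : b ≤ ζ := b1.trans (min_le_left _ _)
  have b3 : b ≤ 1 / 3 := b1.trans (min_le_right _ _)
  let u : ℕ → (ℕ → unitInterval) → ℝ := fun j x =>
    if (j - p) % 2 = 0 then tr x ((j - p) / 2) else M (tr x) ((j - p) / 2)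
  have hu : ∀ j, Continuous (u j) := by
    intro j
    simp only [u]
    split_ifs
    · exact (continuous_coord _).comp htr
    · exact (continuous_coord _).comp (M.continuous.comp htr)
  have hu01 : ∀ j x, 0 ≤ u j x ∧ u j x ≤ 1 := by
    intro j x
    simp only [u]
    split_ifs
    · exact (tr x _).2
    · exact (M (tr x) _).2
  obtain ⟨w, hw, hw1, hw2⟩ := exists_write (c := c) (n := n) (p := p) hK' hr hKV' hpn
    (γ := fun j x => max b (min (u j x) (1 - b)))
    (fun j => continuous_const.max ((hu j).min continuous_const))
    (fun j x y h => by simp only [u, htri x y h])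
    (fun j x => ⟨lt_max_of_lt_left b0,
      max_lt (by linarith) ((min_le_right _ _).trans_lt (by linarith))⟩)
    (δ := b * ζ) (by positivity) (Finset.Ico p (p + 2 * N)) (fun k hk => (Finset.mem_Ico.1 hk).1)
    (by
      rintro _ ⟨x, hx, rfl⟩ k hk
      exact hf2 x hx k (Finset.mem_range.2 (Finset.mem_Ico.1 hk).2))
  have hwp : ∀ x, ∀ i < p, w x i = x i := fun x i hi => hw1 x i fun h => by
    have := (Finset.mem_Ico.1 h).1
    omega
  have hbζ : b * ζ ≤ ζ := by nlinarith
  obtain ⟨g, hg, -, hg2, hg3⟩ := exists_read (c := c) (N := N) (hK'.image w.continuous) hr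
    (by rintro _ ⟨y, hy, rfl⟩; exact hw.apply_mem (hKV' hy))
    (k := fun i => p + 2 * i) (k' := fun i => p + 2 * i + 1) (fun i => by omega) (fun i => by omega)
    (δ := b * ζ) (θ := 3 * ζ) b0 he (fun i hi => (hb i hi).1)
    (by
      rintro _ ⟨y, hy, rfl⟩ i hi
      rw [hwp y i (by omega)]
      exact (hb i hi).2 y hy)
    (by
      rintro _ ⟨y, hy, rfl⟩ i hi
      rw [hwp y i (by omega)]
      have h1 := hw2 y hy (p + 2 * i) (Finset.mem_Ico.2 ⟨by omega, by omega⟩)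
      have h2 : u (p + 2 * i) y = y i := by
        have e1 : p + 2 * i - p = 2 * i := by omega
        simp only [u, tr, e1]
        rw [if_pos (by omega), if_pos (by omega)]
        congr 2
        omega
      simp only [h2] at h1
      obtain ⟨q1, q2⟩ := (hb i hi).2 y hy
      have := boxLo_nonneg (c := c) (n := n) (r := r) i
      have := boxHi_le_one (c := c) (n := n) (r := r) i
      rwa [min_eq_left (by linarith), max_eq_right (by linarith)] at h1) N le_rfl
  refine ⟨(f.trans w).trans g, (hf.trans hw).trans hg, fun x i hi => ?_, fun x hx i hi => ?_⟩
  · simp only [Homeomorph.trans_apply]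
    have h1 := hg2 (w (f x)) i
    rw [hwp _ i (by omega)] at h1
    have h2 := hf1 x i (by omega)
    have h3 : min δ₀ ζ ≤ ζ := min_le_right _ _
    have := abs_sub_le (g (w (f x)) i : ℝ) (f x i) (x i)
    linarith
  · simp only [Homeomorph.trans_apply]
    have hfx := mem_image_of_mem f hx
    have h2 := hf1 x i (by omega)
    have h3 : min δ₀ ζ ≤ ζ := min_le_right _ _
    obtain ⟨v1, v2⟩ := mem_boxLo_boxHi (hmV hx) i
    have hfin := hg3 _ (mem_image_of_mem w hfx) i hi (m x i) v1 v2 (by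
      have h1 := hw2 _ hfx (p + 2 * i + 1) (Finset.mem_Ico.2 ⟨by omega, by omega⟩)
      have e2 : u (p + 2 * i + 1) (f x) = M (tr (f x)) i := by
        have e1 : p + 2 * i + 1 - p = 2 * i + 1 := by omega
        simp only [u, e1]
        rw [if_neg (by omega), show (2 * i + 1) / 2 = i by omega]
      have h4 : |(M (tr (f x)) i : ℝ) - m x i| < ζ := by
        rw [← hMm x hx]
        refine hmod _ _ (fun j hj => ?_) i hi
        simp only [tr, if_pos (show j < p by omega)]
        exact (hf1 x j (by omega)).trans (min_le_left _ _)
      have h5 : |max b (min (u (p + 2 * i + 1) (f x)) (1 - b)) - u (p + 2 * i + 1) (f x)| ≤ b := by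
        obtain ⟨q1, q2⟩ := hu01 (p + 2 * i + 1) (f x)
        rw [abs_le]
        constructor
        · have := le_max_right b (min (u (p + 2 * i + 1) (f x)) (1 - b))
          have h6 : u (p + 2 * i + 1) (f x) - b ≤ min (u (p + 2 * i + 1) (f x)) (1 - b) :=
            le_min (by linarith) (by linarith)
          linarith
        · rw [sub_le_iff_le_add]
          exact max_le (by linarith) ((min_le_left _ _).trans (by linarith))
      simp only [e2] at h1 h5
      have t1 := abs_sub_le (w (f x) (p + 2 * i + 1) : ℝ)
        (max b (min (M (tr (f x)) i : ℝ) (1 - b))) (M (tr (f x)) i)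
      have t2 := abs_sub_le (w (f x) (p + 2 * i + 1) : ℝ) (M (tr (f x)) i) (m x i)
      linarith) (by
      rw [hwp _ i (by omega)]
      have t1 := abs_sub_le (f x i : ℝ) (x i) (m x i)
      have t2 := hclose x hx i
      linarith)
    have e3 : b * ζ / b = ζ := by field_simp
    rw [e3] at hfin
    linarith

end Approx

lemma exists_seq_of_step {S : Type*} {P : ℕ → S → Prop} {R : ℕ → S → S → Prop} {s₀ : S}
    (h₀ : P 0 s₀) (hstep : ∀ n s, P n s → ∃ s', P (n + 1) s' ∧ R n s s') :
    ∃ u : ℕ → S, u 0 = s₀ ∧ (∀ n, P n (u n)) ∧ ∀ n, R n (u n) (u (n + 1)) := by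
  choose F hF using hstep
  let v : (n : ℕ) → {s // P n s} := fun n =>
    Nat.rec ⟨s₀, h₀⟩ (fun n s => ⟨F n s.1 s.2, (hF n s.1 s.2).1⟩) n
  exact ⟨fun n => (v n).1, rfl, fun n => (v n).2, fun n => (hF n (v n).1 (v n).2).2⟩

lemma exists_homeomorph_limit {Y : Type*} [MetricSpace Y] [CompactSpace Y] (Φ : ℕ → Y ≃ₜ Y) (B : ℝ)
    (h : ∀ n x, dist (Φ n x) (Φ (n + 1) x) ≤ B / 2 ^ n)
    (h' : ∀ n x, dist ((Φ n).symm x) ((Φ (n + 1)).symm x) ≤ B / 2 ^ n) :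
    ∃ Ψ : Y ≃ₜ Y, ∀ x, Filter.Tendsto (fun n => Φ n x) Filter.atTop (𝓝 (Ψ x)) ∧
      Filter.Tendsto (fun n => (Φ n).symm x) Filter.atTop (𝓝 (Ψ.symm x)) := by
  have key : ∀ f : ℕ → Y → Y, (∀ n, Continuous (f n)) →
      (∀ n x, dist (f n x) (f (n + 1) x) ≤ B / 2 ^ n) →
      ∃ F : Y → Y, Continuous F ∧ TendstoUniformly f F Filter.atTop := by
    intro f hf hd
    have hd' : ∀ x n, dist (f n x) (f (n + 1) x) ≤ 2 * B / 2 / 2 ^ n := fun x n => by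
      have := hd n x
      rwa [mul_div_cancel_left₀ B (two_ne_zero)]
    choose F hF using fun x => cauchySeq_tendsto_of_complete (cauchySeq_of_le_geometric_two (hd' x))
    have hu : TendstoUniformly f F Filter.atTop := by
      rw [Metric.tendstoUniformly_iff]
      intro ε hε
      have h0 : Filter.Tendsto (fun n : ℕ => 2 * B / 2 ^ n) Filter.atTop (𝓝 0) := by
        have := (tendsto_pow_atTop_nhds_zero_of_lt_one (r := (1 / 2 : ℝ)) (by norm_num)
          (by norm_num)).const_mul (2 * B)
        simpa [div_eq_mul_inv] using this
      filter_upwards [h0.eventually_lt_const hε] with n hn x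
      rw [dist_comm]
      exact (dist_le_of_le_geometric_two_of_tendsto (hd' x) (hF x) n).trans_lt hn
    exact ⟨F, hu.continuous (Filter.Frequently.of_forall hf), hu⟩
  obtain ⟨F, hFc, hF⟩ := key (fun n x => Φ n x) (fun n => (Φ n).continuous) h
  obtain ⟨G, hGc, hG⟩ := key (fun n x => (Φ n).symm x) (fun n => (Φ n).symm.continuous) h'
  have hFG : ∀ x, F (G x) = x := fun x => by
    have := hF.tendsto_comp (x := G x) hFc.continuousAt (hG.tendsto_at x)
    simp only [Homeomorph.apply_symm_apply] at this
    exact tendsto_nhds_unique this tendsto_const_nhds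
  have hGF : ∀ x, G (F x) = x := fun x => by
    have := hG.tendsto_comp (x := F x) hGc.continuousAt (hF.tendsto_at x)
    simp only [Homeomorph.symm_apply_apply] at this
    exact tendsto_nhds_unique this tendsto_const_nhds
  exact ⟨⟨⟨F, G, hGF, hFG⟩, hFc, hGc⟩, fun x => ⟨hF.tendsto_at x, hG.tendsto_at x⟩⟩

lemma exists_dist_homeomorph_limit (Y : Type*) [TopologicalSpace Y] [CompactSpace Y]
    [TopologicalSpace.MetrizableSpace Y] :
    ∃ D : Y → Y → ℝ, Continuous (Function.uncurry D) ∧ (∀ x, D x x = 0) ∧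
      (∀ x y, D x y = 0 → x = y) ∧ (∀ x y, 0 ≤ D x y) ∧
      ∀ (Φ : ℕ → Y ≃ₜ Y) (B : ℝ), (∀ n x, D (Φ n x) (Φ (n + 1) x) ≤ B / 2 ^ n) →
        (∀ n x, D ((Φ n).symm x) ((Φ (n + 1)).symm x) ≤ B / 2 ^ n) →
        ∃ Ψ : Y ≃ₜ Y, ∀ x, Filter.Tendsto (fun n => Φ n x) Filter.atTop (𝓝 (Ψ x)) ∧
          Filter.Tendsto (fun n => (Φ n).symm x) Filter.atTop (𝓝 (Ψ.symm x)) := by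
  let := TopologicalSpace.metrizableSpaceMetric Y
  exact ⟨fun x y => dist x y, continuous_dist, dist_self, fun x y h => dist_eq_zero.1 h,
    fun x y => dist_nonneg, exists_homeomorph_limit⟩

/-- A homeomorphism supported in a compact subset of the source of a partial homeomorphism can be
transported to the target. -/
lemma exists_conj_extend {Y Y' : Type*} [TopologicalSpace Y] [TopologicalSpace Y'] [T2Space Y']
    (f : OpenPartialHomeomorph Y Y') {E : Set Y} (hE : IsCompact E) (hEf : E ⊆ f.source)
    {φ : Y ≃ₜ Y} (hφ : SuppIn φ E) :
    ∃ ψ : Y' ≃ₜ Y', SuppIn ψ (f '' E) ∧ ∀ x ∈ f.source, ψ (f x) = f (φ x) := by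
  classical
  have hsrc : ∀ {φ : Y ≃ₜ Y}, SuppIn φ E → ∀ {x}, x ∈ f.source → φ x ∈ f.source := by
    intro φ hφ x hx
    by_cases h : x ∈ E
    · exact hEf (hφ.apply_mem h)
    · rwa [hφ x h]
  have hcl : IsClosed (f '' E) := (hE.image_of_continuousOn (f.continuousOn.mono hEf)).isClosed
  let T : (Y ≃ₜ Y) → Y' → Y' := fun φ y => if y ∈ f.target then f (φ (f.symm y)) else y
  have hTf : ∀ φ : Y ≃ₜ Y, ∀ x ∈ f.source, T φ (f x) = f (φ x) := fun φ x hx => by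
    simp only [T, if_pos (f.map_source hx), f.left_inv hx]
  have hTs : ∀ {φ : Y ≃ₜ Y}, SuppIn φ E → ∀ y ∉ f '' E, T φ y = y := by
    intro φ hφ y hy
    by_cases h : y ∈ f.target
    · have h1 : f.symm y ∉ E := fun h' => hy ⟨_, h', f.right_inv h⟩
      simp only [T, if_pos h, hφ _ h1, f.right_inv h]
    · simp only [T, if_neg h]
  have hTc : ∀ {φ : Y ≃ₜ Y}, SuppIn φ E → Continuous (T φ) := by
    intro φ hφ
    rw [continuous_iff_continuousAt]
    intro y
    by_cases h : y ∈ f.target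
    · have hc : ContinuousAt (fun y => f (φ (f.symm y))) y :=
        ContinuousAt.comp (g := f) (f := fun y => φ (f.symm y))
          (f.continuousAt (hsrc hφ (f.map_target h)))
          (φ.continuous.continuousAt.comp (f := f.symm) (f.continuousAt_symm h))
      refine hc.congr ?_
      filter_upwards [f.open_target.mem_nhds h] with z hz
      simp only [T, if_pos hz]
    · have hy : y ∉ f '' E := fun ⟨x, hx, e⟩ => h (e ▸ f.map_source (hEf hx))
      refine continuousAt_id.congr ?_
      filter_upwards [hcl.isOpen_compl.mem_nhds hy] with z hz
      exact (hTs hφ z hz).symm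
  have hTT : ∀ {φ : Y ≃ₜ Y}, SuppIn φ E → ∀ y, T φ.symm (T φ y) = y := by
    intro φ hφ y
    by_cases h : y ∈ f.target
    · have h1 := f.map_target h
      rw [← f.right_inv h, hTf _ _ h1, hTf _ _ (hsrc hφ h1), φ.symm_apply_apply]
    · simp only [T, if_neg h]
  refine ⟨⟨⟨T φ, T φ.symm, hTT hφ, fun y => ?_⟩, hTc hφ, hTc hφ.symm⟩, hTs hφ, hTf φ⟩
  have := hTT hφ.symm y
  rwa [Homeomorph.symm_symm] at this

lemma IsCompact.exists_modulus_coord {E : Set (ℕ → unitInterval)} (hE : IsCompact E)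
    {f : (ℕ → unitInterval) → ℕ → unitInterval} (hf : ContinuousOn f E) (N : ℕ) {η : ℝ}
    (hη : 0 < η) : ∃ (p : ℕ) (δ : ℝ), 0 < δ ∧ ∀ x ∈ E, ∀ y ∈ E,
      (∀ j < p, |(x j : ℝ) - y j| ≤ δ) → ∀ i < N, |(f x i : ℝ) - f y i| < η := by
  obtain ⟨M, hM⟩ := ContinuousMap.exists_restrict_eq hE.isClosed ⟨E.domRestrict f, hf.domRestrict⟩
  have hMm : ∀ x ∈ E, M x = f x := fun x hx => congrArg (fun f => f ⟨x, hx⟩) hM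
  obtain ⟨p, δ, hδ, h⟩ := _root_.exists_modulus_coord M.continuous N hη
  refine ⟨p, δ, hδ, fun x hx y hy hxy => ?_⟩
  rw [← hMm x hx, ← hMm y hy]
  exact h x y hxy

lemma pushable_image (f : OpenPartialHomeomorph (ℕ → unitInterval) (ℕ → unitInterval))
    {V : Set (ℕ → unitInterval)} {c : ℕ → unitInterval} {n t : ℕ} {r ρ : ℝ} (hr : 0 < r)
    (hρ : ρ < r) (ht : n ≤ t)
    (hEf : {x : ℕ → unitInterval | ∀ i < n, |(x i : ℝ) - c i| ≤ r} ⊆ f.source)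
    (hEV : f '' {x : ℕ → unitInterval | ∀ i < n, |(x i : ℝ) - c i| ≤ r} ⊆ V) :
    Pushable V (f '' {x : ℕ → unitInterval | (∀ i < n, |(x i : ℝ) - c i| ≤ ρ) ∧ x t = 0}) := by
  set E := {x : ℕ → unitInterval | ∀ i < n, |(x i : ℝ) - c i| ≤ r} with hEdef
  set C := {x : ℕ → unitInterval | (∀ i < n, |(x i : ℝ) - c i| ≤ ρ) ∧ x t = 0} with hCdef
  have hE : IsCompact E := isClosed_closedCoordBox.isCompact
  have hC : IsCompact C := by
    refine IsClosed.isCompact (IsClosed.inter isClosed_closedCoordBox ?_)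
    exact isClosed_eq (continuous_apply t) continuous_const
  have hCV : C ⊆ coordBox c n r := fun x hx i hi => (hx.1 i hi).trans_lt hρ
  have hVE : coordBox c n r ⊆ E := fun x hx i hi => (hx i hi).le
  have hCP : Pushable (coordBox c n r) C :=
    pushable_of_side hC hr hCV ht fun x hx => by rw [hx.2]; rfl
  have hfE : ContinuousOn f E := f.continuousOn.mono hEf
  have hfC : IsCompact (f '' C) := hC.image_of_continuousOn (hfE.mono (hCV.trans hVE))
  intro S N ε hε
  obtain ⟨L, hL⟩ : ∃ L : ℕ, ∀ k ∈ S, k < L := ⟨S.sup id + 1, fun k hk =>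
    Nat.lt_succ_of_le (Finset.le_sup (f := id) hk)⟩
  obtain ⟨N₁, e₀, he₀, hmod₁⟩ := hE.exists_modulus_coord hfE N hε
  -- the points near a point of the image whose preimages are near
  let O : Set ((ℕ → unitInterval) × (ℕ → unitInterval)) := (f.target ×ˢ f.target) ∩
    (fun z => (f.symm z.1, f.symm z.2)) ⁻¹'
      {z | z.2 ∈ coordBox c n r ∧ ∀ i ∈ Finset.range N₁, |(z.1 i : ℝ) - z.2 i| < e₀ / 2}
  have hO : IsOpen O := by
    refine ContinuousOn.isOpen_inter_preimage ?_ (f.open_target.prod f.open_target) ?_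
    · exact (f.continuousOn_symm.comp continuousOn_fst fun z hz => hz.1).prodMk
        (f.continuousOn_symm.comp continuousOn_snd fun z hz => hz.2)
    · have : IsOpen {z : (ℕ → unitInterval) × (ℕ → unitInterval) |
          ∀ i ∈ Finset.range N₁, |(z.1 i : ℝ) - z.2 i| < e₀ / 2} := by
        have : {z : (ℕ → unitInterval) × (ℕ → unitInterval) |
            ∀ i ∈ Finset.range N₁, |(z.1 i : ℝ) - z.2 i| < e₀ / 2} =
            ⋂ i ∈ Finset.range N₁, {z | |(z.1 i : ℝ) - z.2 i| < e₀ / 2} := by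
          ext z
          simp
        rw [this]
        refine isOpen_biInter_finset fun i _ => isOpen_lt ?_ continuous_const
        exact (((continuous_coord i).comp continuous_fst).sub
          ((continuous_coord i).comp continuous_snd)).abs
      exact (isOpen_coordBox.preimage continuous_snd).inter this
  obtain ⟨p, δ, hδ, hmod₂⟩ := exists_modulus (W := O ∪ (f '' C)ᶜ ×ˢ univ)
    (hO.union (hfC.isClosed.isOpen_compl.prod isOpen_univ)) (fun z => by
      by_cases hz : z ∈ f '' C
      · obtain ⟨x, hx, rfl⟩ := hz
        have h1 := f.map_source (hEf (hVE (hCV hx)))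
        refine Or.inl ⟨⟨h1, h1⟩, ?_⟩
        simp only [mem_preimage, mem_ofPred_eq, f.left_inv (hEf (hVE (hCV hx)))]
        exact ⟨hCV hx, fun i _ => by simpa using half_pos he₀⟩
      · exact Or.inr ⟨hz, mem_univ _⟩)
  set τ := min δ (1 / 3) with hτ
  have hτ0 : 0 < τ := by positivity
  have hτ1 : τ ≤ 1 / 3 := min_le_right _ _
  let R : (ℕ → unitInterval) → ℕ → unitInterval := fun z k =>
    if k ∈ S then toI (max τ (min (z k) (1 - τ))) else z k
  have hR : Continuous R := by
    refine continuous_pi fun k => ?_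
    simp only [R]
    split_ifs
    · exact continuous_toI.comp
        (continuous_const.max ((continuous_coord k).min continuous_const))
    · exact continuous_apply k
  have hRS : ∀ z, ∀ k ∈ S, τ ≤ (R z k : ℝ) ∧ (R z k : ℝ) ≤ 1 - τ := by
    intro z k hk
    have h1 : τ ≤ max τ (min (z k : ℝ) (1 - τ)) := le_max_left _ _
    have h2 : max τ (min (z k : ℝ) (1 - τ)) ≤ 1 - τ := max_le (by linarith) (min_le_right _ _)
    simp only [R, if_pos hk]
    rw [coe_toI ⟨by linarith, by linarith⟩]
    exact ⟨h1, h2⟩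
  have hRz : ∀ z k, |(z k : ℝ) - R z k| ≤ δ := by
    intro z k
    by_cases hk : k ∈ S
    · have h1 : τ ≤ max τ (min (z k : ℝ) (1 - τ)) := le_max_left _ _
      have h2 : max τ (min (z k : ℝ) (1 - τ)) ≤ 1 - τ := max_le (by linarith) (min_le_right _ _)
      simp only [R, if_pos hk]
      rw [coe_toI ⟨by linarith, by linarith⟩]
      have h3 : τ ≤ δ := min_le_left _ _
      obtain ⟨q1, q2⟩ := (z k).2
      rw [abs_le]
      constructor
      · have : max τ (min (z k : ℝ) (1 - τ)) ≤ z k + τ :=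
          max_le (by linarith) ((min_le_left _ _).trans (by linarith))
        linarith
      · have : (z k : ℝ) - τ ≤ min (z k : ℝ) (1 - τ) := le_min (by linarith) (by linarith)
        have := le_max_right τ (min (z k : ℝ) (1 - τ))
        linarith
    · simp only [R, if_neg hk, sub_self, abs_zero]
      exact hδ.le
  have hOC : ∀ x ∈ C, (f x, R (f x)) ∈ O := fun x hx =>
    (hmod₂ _ _ fun j _ => hRz (f x) j).resolve_right fun h => h.1 (mem_image_of_mem f hx)
  set m : (ℕ → unitInterval) → ℕ → unitInterval := fun x => f.symm (R (f x)) with hm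
  have hmc : ContinuousOn m C := by
    refine f.continuousOn_symm.comp (hR.comp_continuousOn (hfE.mono (hCV.trans hVE))) ?_
    exact fun x hx => (hOC x hx).1.2
  have hmV : MapsTo m C (coordBox c n r) := fun x hx => (hOC x hx).2.1
  have hfm : ∀ x ∈ C, f (m x) = R (f x) := fun x hx => f.right_inv (hOC x hx).1.2
  obtain ⟨N₂, η, hη, hmod₃⟩ := hE.exists_modulus_coord hfE L (half_pos hτ0)
  obtain ⟨g, hg, hg1, hg2⟩ := exists_approx hr hC hCV hCP hmc hmV
    (e := fun i => if i < N₁ then e₀ / 2 else 1) (fun i => by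
      split_ifs <;> linarith) (fun x hx i => by
      split_ifs with hi
      · have := (hOC x hx).2.2 i (Finset.mem_range.2 hi)
        simp only [f.left_inv (hEf (hVE (hCV hx)))] at this
        exact this.le
      · have h1 := (x i).2
        have h2 := (m x i).2
        rw [abs_le]
        constructor <;> linarith [h1.1, h1.2, h2.1, h2.2]) (max N₁ N₂) (η := min (e₀ / 2) η)
      (by positivity)
  have hgE : SuppIn g E := hg.mono hVE
  obtain ⟨ψ, hψ, hψf⟩ := exists_conj_extend f hE hEf hgE
  refine ⟨ψ, hψ.mono hEV, fun y i hi => ?_, ?_⟩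
  · by_cases hy : y ∈ f '' E
    · obtain ⟨x, hx, rfl⟩ := hy
      rw [hψf x (hEf hx)]
      refine (hmod₁ _ (hgE.apply_mem hx) _ hx (fun j hj => ?_) i hi).le
      have h1 := hg1 x j (hj.trans_le (le_max_left _ _))
      simp only [if_pos hj] at h1
      have : min (e₀ / 2) η ≤ e₀ / 2 := min_le_left _ _
      linarith
    · rw [hψ y hy]
      simpa using hε.le
  · rintro _ ⟨x, hx, rfl⟩ k hk
    have hxE := hVE (hCV hx)
    rw [hψf x (hEf hxE)]
    have h1 := hmod₃ _ (hgE.apply_mem hxE) _ (hVE (hmV hx)) (fun j hj =>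
      (hg2 x hx j (hj.trans_le (le_max_right _ _))).trans (min_le_right _ _)) k (hL k hk)
    rw [hfm x hx] at h1
    obtain ⟨q1, q2⟩ := hRS (f x) k hk
    obtain ⟨q3, q4⟩ := abs_lt.1 h1
    constructor <;> linarith

section Loop

variable {c : ℕ → unitInterval} {n : ℕ} {r : ℝ}

lemma exists_correction (hr : 0 < r) {C : Set (ℕ → unitInterval)} (hC : IsCompact C)
    {f : (ℕ → unitInterval) → ℕ → unitInterval} (hf : ContinuousOn f C)
    (hCV : C ⊆ coordBox c n r) (hfV : MapsTo f C (coordBox c n r))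
    {G G' : (ℕ → unitInterval) ≃ₜ (ℕ → unitInterval)} (hG : SuppIn G (coordBox c n r))
    (hG' : SuppIn G' (coordBox c n r)) (hP : Pushable (coordBox c n r) (G '' C)) {p : ℕ} {δ : ℝ}
    (hδ : 0 < δ) (hclose : ∀ x ∈ C, ∀ i < p, |(G x i : ℝ) - G' (f x) i| ≤ δ) (N : ℕ) {η : ℝ}
    (hη : 0 < η) :
    ∃ g : (ℕ → unitInterval) ≃ₜ (ℕ → unitInterval), SuppIn g (coordBox c n r) ∧
      (∀ x, ∀ i < p, |(g x i : ℝ) - x i| ≤ 2 * δ) ∧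
      ∀ x ∈ C, ∀ i < N, |(g (G x) i : ℝ) - G' (f x) i| ≤ η := by
  obtain ⟨g, hg, hg1, hg2⟩ := exists_approx hr (hC.image G.continuous)
    (by rintro _ ⟨x, hx, rfl⟩; exact hG.apply_mem (hCV hx)) hP
    (m := fun y => G' (f (G.symm y)))
    (G'.continuous.comp_continuousOn (hf.comp G.symm.continuous.continuousOn (by
      rintro _ ⟨x, hx, rfl⟩
      rwa [G.symm_apply_apply])))
    (by
      rintro _ ⟨x, hx, rfl⟩
      simp only [G.symm_apply_apply]
      exact hG'.apply_mem (hfV hx))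
    (e := fun i => if i < p then δ else 1)
    (fun i => by split_ifs <;> linarith)
    (by
      rintro _ ⟨x, hx, rfl⟩ i
      simp only [G.symm_apply_apply]
      split_ifs with hi
      · exact hclose x hx i hi
      · have h1 := (G x i).2
        have h2 := (G' (f x) i).2
        rw [abs_le]
        constructor <;> linarith [h1.1, h1.2, h2.1, h2.2]) (max p N) (η := min δ η) (by positivity)
  refine ⟨g, hg, fun x i hi => ?_, fun x hx i hi => ?_⟩
  · have h1 := hg1 x i (hi.trans_le (le_max_left _ _))
    simp only [if_pos hi] at h1
    have : min δ η ≤ δ := min_le_left _ _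
    linarith
  · have h1 := hg2 _ (mem_image_of_mem G hx) i (hi.trans_le (le_max_right _ _))
    simp only [G.symm_apply_apply] at h1
    exact h1.trans (min_le_right _ _)

/-- Two embeddings of a compact set into a box all of whose ambient copies are pushable differ by a
homeomorphism supported in the box. -/
theorem exists_extension_of_pushable (hr : 0 < r) {C : Set (ℕ → unitInterval)} (hC : IsCompact C)
    {f f' : (ℕ → unitInterval) → ℕ → unitInterval} (hf : ContinuousOn f C)
    (hf' : ContinuousOn f' (f '' C)) (hff' : ∀ x ∈ C, f' (f x) = x)
    (hCV : C ⊆ coordBox c n r) (hfV : MapsTo f C (coordBox c n r))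
    (hP : ∀ G : (ℕ → unitInterval) ≃ₜ (ℕ → unitInterval), SuppIn G (coordBox c n r) →
      Pushable (coordBox c n r) (G '' C))
    (hP' : ∀ G : (ℕ → unitInterval) ≃ₜ (ℕ → unitInterval), SuppIn G (coordBox c n r) →
      Pushable (coordBox c n r) (G '' (f '' C))) :
    ∃ h : (ℕ → unitInterval) ≃ₜ (ℕ → unitInterval), SuppIn h (coordBox c n r) ∧
      ∀ x ∈ C, h x = f x := by
  obtain ⟨D, hDc, hD0, hDeq, hDnn, hDlim⟩ := exists_dist_homeomorph_limit (ℕ → unitInterval)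
  obtain ⟨B, hB0, hB⟩ : ∃ B, 0 < B ∧ ∀ x y, D x y ≤ B := by
    obtain ⟨B, hB⟩ := (isCompact_univ.image hDc).bddAbove
    refine ⟨max B 1, by positivity, fun x y => le_max_of_le_left (hB ⟨(x, y), trivial, rfl⟩)⟩
  have hmod : ∀ (G : (ℕ → unitInterval) ≃ₜ (ℕ → unitInterval)) (κ : ℝ), 0 < κ →
      ∃ (p : ℕ) (δ : ℝ), 0 < δ ∧ ∀ x y : ℕ → unitInterval, (∀ i < p, |(x i : ℝ) - y i| ≤ 2 * δ) →
        D x y ≤ κ ∧ D (G.symm x) (G.symm y) ≤ κ := by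
    intro G κ hκ
    obtain ⟨p, δ, hδ, h⟩ := exists_modulus
      (W := {z | D z.1 z.2 < κ} ∩ {z | D (G.symm z.1) (G.symm z.2) < κ})
      ((isOpen_lt hDc continuous_const).inter (isOpen_lt
        (hDc.comp ((G.symm.continuous.comp continuous_fst).prodMk
          (G.symm.continuous.comp continuous_snd))) continuous_const))
      (fun x => by simp only [mem_inter_iff, mem_ofPred_eq, hD0]; exact ⟨hκ, hκ⟩)
    exact ⟨p, δ / 2, half_pos hδ, fun x y hxy =>
      have := h x y (by simpa [mul_div_cancel₀] using hxy)
      ⟨this.1.le, this.2.le⟩⟩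
  obtain ⟨u, -, hu1, hu2⟩ := exists_seq_of_step
    (S := ((ℕ → unitInterval) ≃ₜ (ℕ → unitInterval)) × ((ℕ → unitInterval) ≃ₜ (ℕ → unitInterval)))
    (P := fun n' s => SuppIn s.1 (coordBox c n r) ∧ SuppIn s.2 (coordBox c n r) ∧
      ∃ (p : ℕ) (δ : ℝ), 0 < δ ∧ (∀ x ∈ C, ∀ i < p, |(s.1 x i : ℝ) - s.2 (f x) i| ≤ δ) ∧
        ∀ x y : ℕ → unitInterval, (∀ i < p, |(x i : ℝ) - y i| ≤ 2 * δ) →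
          D x y ≤ B / 2 ^ n' ∧ D (s.1.symm x) (s.1.symm y) ≤ B / 2 ^ n')
    (R := fun n' s s' => (∀ x, D (s.1 x) (s'.1 x) ≤ B / 2 ^ n') ∧
      (∀ x, D (s.1.symm x) (s'.1.symm x) ≤ B / 2 ^ n') ∧
      (∀ x, D (s.2 x) (s'.2 x) ≤ B / 2 ^ n') ∧
      (∀ x, D (s.2.symm x) (s'.2.symm x) ≤ B / 2 ^ n') ∧
      ∀ x ∈ C, D (s.1 x) (s.2 (f x)) ≤ B / 2 ^ n')
    (s₀ := (Homeomorph.refl _, Homeomorph.refl _))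
    ⟨SuppIn.refl _, SuppIn.refl _, 0, 1, one_pos, by simp, fun x y _ => by simp [hB]⟩ (by
      rintro n' ⟨G, G'⟩ ⟨hG, hG', p, δ, hδ, hcl, hPm⟩
      simp only at hG hG' hcl hPm
      obtain ⟨p', δ', hδ', hPm'⟩ := hmod G' (B / 2 ^ n') (by positivity)
      obtain ⟨g, hg, hg1, hg2⟩ := exists_correction hr hC hf hCV hfV hG hG' (hP G hG) hδ hcl p' hδ'
      obtain ⟨p₂, δ₂, hδ₂, hPm₂⟩ := hmod (G.trans g) (B / 2 ^ (n' + 1)) (by positivity)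
      obtain ⟨g', hg', hg1', hg2'⟩ := exists_correction hr (hC.image_of_continuousOn hf) hf'
        (by rintro _ ⟨x, hx, rfl⟩; exact hfV hx)
        (by rintro _ ⟨x, hx, rfl⟩; rw [hff' x hx]; exact hCV hx) hG' (hG.trans hg) (hP' G' hG') hδ'
        (by
          rintro _ ⟨x, hx, rfl⟩ i hi
          rw [hff' x hx, abs_sub_comm]
          exact hg2 x hx i hi) p₂ hδ₂
      refine ⟨(G.trans g, G'.trans g'), ⟨hG.trans hg, hG'.trans hg', p₂, δ₂, hδ₂, fun x hx i hi => ?_,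
        hPm₂⟩, fun x => ?_, fun x => ?_, fun x => ?_, fun x => ?_, fun x hx => ?_⟩
      · have := hg2' _ (mem_image_of_mem f hx) i hi
        rw [hff' x hx, abs_sub_comm] at this
        exact this
      · refine (hPm _ _ fun i hi => ?_).1
        rw [abs_sub_comm]
        exact hg1 (G x) i hi
      · refine (hPm _ (g.symm x) fun i hi => ?_).2
        have := hg1 (g.symm x) i hi
        rwa [g.apply_symm_apply] at this
      · refine (hPm' _ _ fun i hi => ?_).1
        rw [abs_sub_comm]
        exact hg1' (G' x) i hi
      · refine (hPm' _ (g'.symm x) fun i hi => ?_).2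
        have := hg1' (g'.symm x) i hi
        rwa [g'.apply_symm_apply] at this
      · exact (hPm _ _ fun i hi => (hcl x hx i hi).trans (by linarith)).1)
  obtain ⟨G, hG⟩ := hDlim (fun k => (u k).1) B (fun k => (hu2 k).1) fun k => (hu2 k).2.1
  obtain ⟨G', hG'⟩ := hDlim (fun k => (u k).2) B (fun k => (hu2 k).2.2.1) fun k => (hu2 k).2.2.2.1
  have hGs : SuppIn G (coordBox c n r) := fun x hx => tendsto_nhds_unique (hG x).1
    (by simp only [(hu1 _).1 x hx]; exact tendsto_const_nhds)
  have hGs' : SuppIn G' (coordBox c n r) := fun x hx => tendsto_nhds_unique (hG' x).1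
    (by simp only [(hu1 _).2.1 x hx]; exact tendsto_const_nhds)
  refine ⟨G.trans G'.symm, hGs.trans hGs'.symm, fun x hx => ?_⟩
  have h0 : Filter.Tendsto (fun k : ℕ => B / 2 ^ k) Filter.atTop (𝓝 0) := by
    have := (tendsto_pow_atTop_nhds_zero_of_lt_one (r := (1 / 2 : ℝ)) (by norm_num)
      (by norm_num)).const_mul B
    simpa [div_eq_mul_inv] using this
  have h1 : D (G x) (G' (f x)) = 0 :=
    le_antisymm (le_of_tendsto_of_tendsto
      ((hDc.tendsto (G x, G' (f x))).comp ((hG x).1.prodMk_nhds (hG' (f x)).1)) h0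
      (Filter.Eventually.of_forall fun k => (hu2 k).2.2.2.2 x hx)) (hDnn _ _)
  rw [Homeomorph.trans_apply, hDeq _ _ h1, G'.symm_apply_apply]

/-- A partial homeomorphism of the Hilbert cube agrees on a face of a small box with a
homeomorphism supported in any larger box. -/
theorem exists_extension_face (hr : 0 < r)
    (f : OpenPartialHomeomorph (ℕ → unitInterval) (ℕ → unitInterval))
    {c' : ℕ → unitInterval} {n' t : ℕ} {r' ρ : ℝ} (hr' : 0 < r') (hρ : ρ < r') (ht : n' ≤ t)
    (hEf : {x : ℕ → unitInterval | ∀ i < n', |(x i : ℝ) - c' i| ≤ r'} ⊆ f.source)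
    (hEV : {x : ℕ → unitInterval | ∀ i < n', |(x i : ℝ) - c' i| ≤ r'} ⊆ coordBox c n r)
    (hfEV : MapsTo f {x : ℕ → unitInterval | ∀ i < n', |(x i : ℝ) - c' i| ≤ r'} (coordBox c n r)) :
    ∃ h : (ℕ → unitInterval) ≃ₜ (ℕ → unitInterval), SuppIn h (coordBox c n r) ∧
      ∀ x : ℕ → unitInterval, (∀ i < n', |(x i : ℝ) - c' i| ≤ ρ) → x t = 0 → h x = f x := by
  set E := {x : ℕ → unitInterval | ∀ i < n', |(x i : ℝ) - c' i| ≤ r'} with hE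
  set C := {x : ℕ → unitInterval | (∀ i < n', |(x i : ℝ) - c' i| ≤ ρ) ∧ x t = 0} with hCdef
  have hC : IsCompact C := by
    refine IsClosed.isCompact (IsClosed.inter isClosed_closedCoordBox ?_)
    exact isClosed_eq (continuous_apply t) continuous_const
  have hCE : C ⊆ E := fun x hx i hi => (hx.1 i hi).trans hρ.le
  obtain ⟨h, hh, hhf⟩ := exists_extension_of_pushable hr hC (f := f) (f' := f.symm)
    (f.continuousOn.mono (hCE.trans hEf))
    (f.continuousOn_symm.mono (by rintro _ ⟨x, hx, rfl⟩; exact f.map_source (hEf (hCE hx))))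
    (fun x hx => f.left_inv (hEf (hCE hx))) (hCE.trans hEV) (fun x hx => hfEV (hCE hx))
    (fun G hG => pushable_image G.toOpenPartialHomeomorph hr' hρ ht (subset_univ _) (by
      rintro _ ⟨x, hx, rfl⟩
      exact hG.apply_mem (hEV hx)))
    (fun G hG => by
      have := pushable_image (f.trans G.toOpenPartialHomeomorph) (V := coordBox c n r) hr' hρ ht
        (by simpa using hEf) (by
          rintro _ ⟨x, hx, rfl⟩
          exact hG.apply_mem (hfEV hx))
      rw [image_image]
      exact this)
  exact ⟨h, hh, fun x h1 h2 => hhf x ⟨h1, h2⟩⟩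

end Loop

/-- The map collapsing the slab `x t ≤ τ` to the face `x t = 0`. -/
def pinch (t : ℕ) (τ : ℝ) (x : ℕ → unitInterval) : ℕ → unitInterval :=
  Function.update x t (toI (max 0 (min (x t : ℝ) (2 * (x t : ℝ) - 2 * τ))))

/-- The section of `pinch t τ` with values in the slab `τ ≤ x t`. -/
def unpinch (t : ℕ) (τ : ℝ) (x : ℕ → unitInterval) : ℕ → unitInterval :=
  Function.update x t (toI (max (x t : ℝ) ((x t : ℝ) / 2 + τ)))

section Collar

variable {t : ℕ} {τ : ℝ}

lemma continuous_pinch : Continuous (pinch t τ) :=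
  continuous_id.update t (continuous_toI.comp (continuous_const.max ((continuous_coord t).min
    ((continuous_const.mul (continuous_coord t)).sub continuous_const))))

lemma continuous_unpinch : Continuous (unpinch t τ) :=
  continuous_id.update t (continuous_toI.comp ((continuous_coord t).max
    (((continuous_coord t).div_const _).add continuous_const)))

lemma pinch_of_ne {j : ℕ} (h : j ≠ t) (x : ℕ → unitInterval) : pinch t τ x j = x j :=
  Function.update_of_ne h _ _

lemma unpinch_of_ne {j : ℕ} (h : j ≠ t) (x : ℕ → unitInterval) : unpinch t τ x j = x j :=
  Function.update_of_ne h _ _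

lemma pinch_self (x : ℕ → unitInterval) :
    (pinch t τ x t : ℝ) = max 0 (min (x t : ℝ) (2 * (x t : ℝ) - 2 * τ)) := by
  rw [pinch, Function.update_self, coe_toI]
  exact ⟨le_max_left _ _, max_le zero_le_one ((min_le_left _ _).trans (x t).2.2)⟩

lemma unpinch_self (h2 : τ ≤ 1 / 2) (x : ℕ → unitInterval) :
    (unpinch t τ x t : ℝ) = max (x t : ℝ) ((x t : ℝ) / 2 + τ) := by
  rw [unpinch, Function.update_self, coe_toI]
  obtain ⟨h3, h4⟩ := (x t).2
  exact ⟨h3.trans (le_max_left _ _), max_le h4 (by linarith)⟩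

lemma pinch_self_of_le {x : ℕ → unitInterval}
    (hx : (x t : ℝ) ≤ τ) : pinch t τ x t = 0 := by
  apply Subtype.ext
  rw [pinch_self, max_eq_left]
  · rfl
  · exact (min_le_right _ _).trans (by linarith)

lemma pinch_self_le (x : ℕ → unitInterval) : (pinch t τ x t : ℝ) ≤ x t := by
  rw [pinch_self]
  exact max_le (x t).2.1 (min_le_left _ _)

lemma pinch_eq_self {x : ℕ → unitInterval} (hx : 2 * τ ≤ x t) : pinch t τ x = x := by
  funext j
  by_cases h : j = t
  · subst h
    apply Subtype.ext
    rw [pinch_self, min_eq_left (by linarith), max_eq_right (x j).2.1]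
  · exact pinch_of_ne h x

lemma unpinch_eq_self (h2 : τ ≤ 1 / 2) {x : ℕ → unitInterval} (hx : 2 * τ ≤ x t) :
    unpinch t τ x = x := by
  funext j
  by_cases h : j = t
  · subst h
    apply Subtype.ext
    rw [unpinch_self h2, max_eq_left (by linarith)]
  · exact unpinch_of_ne h x

lemma pinch_unpinch (h2 : τ ≤ 1 / 2) (x : ℕ → unitInterval) :
    pinch t τ (unpinch t τ x) = x := by
  funext j
  by_cases h : j = t
  · subst h
    apply Subtype.ext
    rw [pinch_self, unpinch_self h2]
    have h0 := (x j).2.1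
    rcases le_total (x j : ℝ) (x j / 2 + τ) with h3 | h3
    · rw [max_eq_right h3, min_eq_right (by linarith), max_eq_right (by linarith)]
      ring
    · rw [max_eq_left h3, min_eq_left (by linarith), max_eq_right h0]
  · rw [pinch_of_ne h, unpinch_of_ne h]

lemma unpinch_pinch (h2 : τ ≤ 1 / 2) {x : ℕ → unitInterval} (hx : τ ≤ x t) :
    unpinch t τ (pinch t τ x) = x := by
  funext j
  by_cases h : j = t
  · subst h
    apply Subtype.ext
    rw [unpinch_self h2, pinch_self]
    have h0 := (x j).2.1
    rcases le_total (x j : ℝ) (2 * x j - 2 * τ) with h3 | h3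
    · rw [min_eq_left h3, max_eq_right h0, max_eq_left (by linarith)]
    · rw [min_eq_right h3, max_eq_right (show (0 : ℝ) ≤ 2 * (x j : ℝ) - 2 * τ by linarith),
        max_eq_right (by linarith)]
      ring
  · rw [unpinch_of_ne h, pinch_of_ne h]

lemma le_unpinch (h2 : τ ≤ 1 / 2) (x : ℕ → unitInterval) : τ ≤ (unpinch t τ x t : ℝ) := by
  rw [unpinch_self h2]
  exact le_max_of_le_right (by linarith [(x t).2.1])

/-- The map extending `g` by the identity over a collar of the face `x t = 0`. -/
def collarExt (t : ℕ) (τ : ℝ) (g : (ℕ → unitInterval) → ℕ → unitInterval) (x : ℕ → unitInterval) :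
    ℕ → unitInterval :=
  open Classical in if (x t : ℝ) ≤ τ then x else unpinch t τ (g (pinch t τ x))

variable {g : OpenPartialHomeomorph (ℕ → unitInterval) (ℕ → unitInterval)}

lemma collarExt_of_le {g : (ℕ → unitInterval) → ℕ → unitInterval} {x : ℕ → unitInterval}
    (h : (x t : ℝ) ≤ τ) : collarExt t τ g x = x := if_pos h

lemma collarExt_of_ge (h2 : τ ≤ 1 / 2) (hg : ∀ x ∈ g.source, x t = 0 → g x = x)
    {x : ℕ → unitInterval} (hx : pinch t τ x ∈ g.source)
    (h : τ ≤ x t) : collarExt t τ g x = unpinch t τ (g (pinch t τ x)) := by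
  rcases h.lt_or_eq with h' | h'
  · exact if_neg (not_le.2 h')
  · rw [collarExt_of_le h'.ge, hg _ hx (pinch_self_of_le h'.ge),
      unpinch_pinch h2 h]

lemma pinch_collarExt (h2 : τ ≤ 1 / 2) (hg : ∀ x ∈ g.source, x t = 0 → g x = x)
    {x : ℕ → unitInterval} (hx : pinch t τ x ∈ g.source) :
    pinch t τ (collarExt t τ g x) = g (pinch t τ x) := by
  rcases le_total (x t : ℝ) τ with h | h
  · rw [collarExt_of_le h, hg _ hx (pinch_self_of_le h)]
  · rw [collarExt_of_ge h2 hg hx h, pinch_unpinch h2]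

lemma collarExt_collarExt (h2 : τ ≤ 1 / 2) (hg : ∀ x ∈ g.source, x t = 0 → g x = x)
    (hg' : ∀ x ∈ g.target, x t = 0 → g.symm x = x)
    {x : ℕ → unitInterval} (hx : pinch t τ x ∈ g.source) :
    collarExt t τ g.symm (collarExt t τ g x) = x := by
  rcases le_total (x t : ℝ) τ with h | h
  · rw [collarExt_of_le h, collarExt_of_le h]
  · rw [collarExt_of_ge h2 hg hx h, collarExt_of_ge h2 hg', pinch_unpinch h2,
      g.left_inv hx, unpinch_pinch h2 h]
    · rw [pinch_unpinch h2]
      exact g.map_source hx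
    · exact le_unpinch h2 _

lemma continuousOn_collarExt (h2 : τ ≤ 1 / 2)
    (hg : ∀ x ∈ g.source, x t = 0 → g x = x) :
    ContinuousOn (collarExt t τ g) (pinch t τ ⁻¹' g.source) := by
  have hc : ContinuousOn (fun x => unpinch t τ (g (pinch t τ x))) (pinch t τ ⁻¹' g.source) :=
    continuous_unpinch.comp_continuousOn (g.continuousOn.comp continuous_pinch.continuousOn
      fun x hx => hx)
  rw [continuousOn_iff_continuous_domRestrict] at hc ⊢
  refine Continuous.if_le continuous_subtype_val hc
    ((continuous_coord t).comp continuous_subtype_val) continuous_const ?_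
  rintro ⟨x, hx⟩ h
  exact (collarExt_of_le h.le).symm.trans (collarExt_of_ge h2 hg hx h.ge)

/-- The partial homeomorphism given by `collarExt`. -/
def collarHomeomorph (h2 : τ ≤ 1 / 2) (hg : ∀ x ∈ g.source, x t = 0 → g x = x)
    (hg' : ∀ x ∈ g.target, x t = 0 → g.symm x = x) :
    OpenPartialHomeomorph (ℕ → unitInterval) (ℕ → unitInterval) where
  toFun := collarExt t τ g
  invFun := collarExt t τ g.symm
  source := pinch t τ ⁻¹' g.source
  target := pinch t τ ⁻¹' g.target
  map_source' x hx := by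
    rw [mem_preimage, pinch_collarExt h2 hg hx]
    exact g.map_source hx
  map_target' x hx := by
    rw [mem_preimage, pinch_collarExt (g := g.symm) h2 hg' hx]
    exact g.map_target hx
  left_inv' x hx := collarExt_collarExt h2 hg hg' hx
  right_inv' x hx := collarExt_collarExt (g := g.symm) h2 hg' hg hx
  open_source := g.open_source.preimage continuous_pinch
  open_target := g.open_target.preimage continuous_pinch
  continuousOn_toFun := continuousOn_collarExt h2 hg
  continuousOn_invFun := continuousOn_collarExt (g := g.symm) h2 hg'

end Collar

lemma mem_coordBox_of_eq {c x y : ℕ → unitInterval} {n : ℕ} {r : ℝ} (hx : x ∈ coordBox c n r)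
    (h : ∀ i < n, y i = x i) : y ∈ coordBox c n r := fun i hi => by
  rw [h i hi]
  exact hx i hi

/-- A germ at a suitable point close to a face extends to a homeomorphism supported in a box. -/
lemma exists_collar_germ {c c' : ℕ → unitInterval} {n n' t : ℕ} {r r' : ℝ} (hr : 0 < r)
    (f : OpenPartialHomeomorph (ℕ → unitInterval) (ℕ → unitInterval)) (hr' : 0 < r')
    (hn : n ≤ t) (hn' : n' ≤ t)
    (hEf : {x : ℕ → unitInterval | ∀ i < n', |(x i : ℝ) - c' i| ≤ r'} ⊆ f.source)
    (hEV : {x : ℕ → unitInterval | ∀ i < n', |(x i : ℝ) - c' i| ≤ r'} ⊆ coordBox c n r)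
    (hfEV : MapsTo f {x : ℕ → unitInterval | ∀ i < n', |(x i : ℝ) - c' i| ≤ r'}
      (coordBox c n r)) :
    ∃ v : unitInterval, 0 < (v : ℝ) ∧ (v : ℝ) < 1 ∧
      ∃ h : (ℕ → unitInterval) ≃ₜ (ℕ → unitInterval), SuppIn h (coordBox c n r) ∧
        ∀ᶠ y in 𝓝 (Function.update c' t v), h y = f y := by
  obtain ⟨h, hh, hhf⟩ := exists_extension_face hr f (t := t) (ρ := r' / 2) hr' (by linarith) hn'
    hEf hEV hfEV
  set O := coordBox c' n' (r' / 2) with hO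
  have hOo : IsOpen O := isOpen_coordBox
  have hOE : O ⊆ {x : ℕ → unitInterval | ∀ i < n', |(x i : ℝ) - c' i| ≤ r'} := fun x hx i hi =>
    (hx i hi).le.trans (by linarith)
  let g0 := f.trans h.symm.toOpenPartialHomeomorph
  have hg0 : ∀ x, g0 x = h.symm (f x) := fun _ => rfl
  have hg0s : g0.source = f.source := by simp [g0]
  have hWo : IsOpen (g0.source ∩ g0 ⁻¹' O ∩ O) :=
    (g0.isOpen_inter_preimage hOo).inter hOo
  let g := g0.restrOpen _ hWo
  have hgx : ∀ x, g x = g0 x := fun _ => rfl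
  have hgs : g.source = g0.source ∩ g0 ⁻¹' O ∩ O := by
    change g0.source ∩ (g0.source ∩ g0 ⁻¹' O ∩ O) = _
    rw [inter_eq_right]
    exact fun x hx => hx.1.1
  have hfix : ∀ x ∈ O, x t = 0 → g0 x = x := fun x hx hxt => by
    rw [hg0, ← hhf x (fun i hi => (hx i hi).le) hxt, h.symm_apply_apply]
  have hg : ∀ x ∈ g.source, x t = 0 → g x = x := fun x hx hxt => by
    rw [hgs] at hx
    exact hfix x hx.2 hxt
  have hg' : ∀ x ∈ g.target, x t = 0 → g.symm x = x := fun y hy hyt => by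
    have hx := g.map_target hy
    have hxy := g.right_inv hy
    rw [hgs] at hx
    have hyO : y ∈ O := by
      rw [← hxy]
      exact hx.1.2
    refine g0.injOn hx.1.1 ?_ ?_
    · rw [hg0s]
      exact hEf (hOE hyO)
    · rw [hfix y hyO hyt]
      exact hxy
  set c0 := Function.update c' t 0 with hc0
  have hc0t : c0 t = 0 := Function.update_self _ _ _
  have hc0O : c0 ∈ O := mem_coordBox_of_eq (mem_coordBox_self (by linarith)) fun i hi =>
    Function.update_of_ne (by omega) _ _
  have hc0g : c0 ∈ g.source := by
    rw [hgs]
    refine ⟨⟨?_, ?_⟩, hc0O⟩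
    · rw [hg0s]
      exact hEf (hOE hc0O)
    · rw [mem_preimage, hfix c0 hc0O hc0t]
      exact hc0O
  obtain ⟨N, hN, R, hR, hD⟩ := exists_coordBox_subset (g.open_source.mem_nhds hc0g) (t + 1)
  set D := {x : ℕ → unitInterval | ∀ i < N, |(x i : ℝ) - c0 i| ≤ R} with hDdef
  have hDcomp : IsCompact D := isClosed_closedCoordBox.isCompact
  have hDD : coordBox c0 N R ⊆ D := fun x hx i hi => (hx i hi).le
  have hm1 : 0 < min R 1 := lt_min hR one_pos
  have hm2 := min_le_left R 1
  have hm3 := min_le_right R 1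
  let v : unitInterval := ⟨min R 1 / 2, by linarith, by linarith⟩
  have hv : (v : ℝ) = min R 1 / 2 := rfl
  have hv0 : 0 < (v : ℝ) := by linarith
  have hv1 : (v : ℝ) < 1 := by linarith
  refine ⟨v, hv0, hv1, ?_⟩
  set x1 := Function.update c' t v with hx1
  have hx1t : x1 t = v := Function.update_self _ _ _
  have hx1D : x1 ∈ coordBox c0 N R := fun i hi => by
    by_cases hit : i = t
    · subst hit
      rw [hx1t, hc0t]
      simp only [Icc.coe_zero, sub_zero, abs_of_pos hv0]
      linarith
    · rw [hx1, hc0, Function.update_of_ne hit, Function.update_of_ne hit, sub_self, abs_zero]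
      exact hR
  have hx1g : x1 ∈ g.source := hD (hDD hx1D)
  have hgx1 : 0 < (g x1 t : ℝ) := by
    refine lt_of_le_of_ne (g x1 t).2.1 fun h0 => ?_
    have h1 : g x1 t = 0 := Subtype.ext h0.symm
    have h2 := hg' _ (g.map_source hx1g) h1
    rw [g.left_inv hx1g] at h2
    rw [← h2, hx1t] at h1
    exact hv0.ne' (congrArg Subtype.val h1)
  have hs : 0 < min (v : ℝ) (g x1 t) := lt_min hv0 hgx1
  obtain ⟨τ, hτ0, hτ1, hτ2, hτ3⟩ : ∃ τ : ℝ, 0 < τ ∧ τ ≤ 1 / 2 ∧ 2 * τ < v ∧ 2 * τ < g x1 t := by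
    have h1 := min_le_left (v : ℝ) (g x1 t)
    have h2 := min_le_right (v : ℝ) (g x1 t)
    exact ⟨min (v : ℝ) (g x1 t) / 4, by linarith, by linarith, by linarith, by linarith⟩
  let ψ := collarHomeomorph hτ1 hg hg'
  have hψ : ∀ x, ψ x = collarExt t τ g x := fun _ => rfl
  have hDpinch : ∀ x ∈ D, pinch t τ x ∈ D := fun x hx i hi => by
    by_cases hit : i = t
    · subst hit
      have h1 := hx i hi
      have h2 := pinch_self_le (t := i) (τ := τ) x
      have h3 := (pinch i τ x i).2.1
      have h4 := (x i).2.1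
      rw [hc0t] at h1 ⊢
      simp only [Icc.coe_zero, sub_zero] at h1 ⊢
      rw [abs_of_nonneg h4] at h1
      rw [abs_of_nonneg h3]
      linarith
    · rw [pinch_of_ne hit]
      exact hx i hi
  have hDψ : D ⊆ ψ.source := fun x hx => hD (hDpinch x hx)
  have hDO : D ⊆ O := fun x hx => by
    have := hD hx
    rw [hgs] at this
    exact this.2
  obtain ⟨φ, hφ, -, hφx⟩ := exists_slide_point (v := τ / 2) hR hx1D (i := t)
    (by rw [hx1t]; exact hv0) (by rw [hx1t]; exact hv1) (by linarith) (by linarith) (fun _ => by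
      rw [hc0t]
      simp only [Icc.coe_zero, sub_zero]
      rw [abs_of_pos (by linarith)]
      linarith)
  obtain ⟨θ, hθ, hθψ⟩ := exists_conj_extend ψ hDcomp hDψ (hφ.mono hDD).symm
  have hψD : ψ '' D ⊆ coordBox c n r := by
    rintro _ ⟨x, hx, rfl⟩
    rw [hψ]
    rcases le_total (x t : ℝ) τ with h1 | h1
    · rw [collarExt_of_le h1]
      exact hEV (hOE (hDO hx))
    · rw [collarExt_of_ge hτ1 hg (hDψ hx) h1]
      have h2 := hD (hDpinch x hx)
      rw [hgs] at h2
      exact mem_coordBox_of_eq (hEV (hOE h2.1.2)) fun i hi => unpinch_of_ne (by omega) _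
  refine ⟨(φ.trans θ).trans h, ((hφ.mono ?_).trans (hθ.mono hψD)).trans hh, ?_⟩
  · exact fun x hx => hEV (hOE (hDO (hDD hx)))
  have e1 : ∀ᶠ y in 𝓝 x1, (φ y t : ℝ) < τ :=
    ((continuous_coord t).comp φ.continuous).continuousAt.eventually_lt continuousAt_const
      (by simp only [Function.comp_apply]; rw [hφx]; linarith)
  have e2 : ∀ᶠ y in 𝓝 x1, 2 * τ < y t :=
    continuousAt_const.eventually_lt (continuous_coord t).continuousAt (by rw [hx1t]; exact hτ2)
  have e3 : ∀ᶠ y in 𝓝 x1, 2 * τ < g y t :=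
    continuousAt_const.eventually_lt
      ((continuous_coord t).continuousAt.comp (g.continuousAt hx1g)) hτ3
  filter_upwards [e1, e2, e3, isOpen_coordBox.mem_nhds hx1D] with y h1 h2 h3 h4
  have h5 : θ (φ y) = g y := by
    have h6 := hθψ (φ y) (hDψ (hDD (hφ.apply_mem h4)))
    rw [hψ, collarExt_of_le h1.le, φ.symm_apply_apply] at h6
    rw [h6, hψ, collarExt_of_ge hτ1 hg (hDψ (hDD h4)) (by linarith), pinch_eq_self h2.le,
      unpinch_eq_self hτ1 h3.le]
  change h (θ (φ y)) = f y
  rw [h5, hgx, hg0, h.apply_symm_apply]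

/-- Every germ of a homeomorphism between points of a box extends to a homeomorphism of the
Hilbert cube supported in the box. -/
theorem exists_extension_germ {c x : ℕ → unitInterval} {n : ℕ} {r : ℝ} (hr : 0 < r)
    (f : OpenPartialHomeomorph (ℕ → unitInterval) (ℕ → unitInterval)) (hxf : x ∈ f.source)
    (hx : x ∈ coordBox c n r) (hfx : f x ∈ coordBox c n r) :
    ∃ h : (ℕ → unitInterval) ≃ₜ (ℕ → unitInterval), SuppIn h (coordBox c n r) ∧
      ∀ᶠ y in 𝓝 x, h y = f y := by
  obtain ⟨n', -, r', hr', hE⟩ := exists_coordBox_subset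
    (((f.isOpen_inter_preimage isOpen_coordBox).inter isOpen_coordBox).mem_nhds
      ⟨⟨hxf, hfx⟩, hx⟩) 0
  set E := {y : ℕ → unitInterval | ∀ i < n', |(y i : ℝ) - x i| ≤ r'} with hEdef
  have hbE : coordBox x n' r' ⊆ E := fun y hy i hi => (hy i hi).le
  have hEc : IsCompact E := isClosed_closedCoordBox.isCompact
  obtain ⟨t, ht, ht'⟩ : ∃ t, n ≤ t ∧ n' ≤ t := ⟨max n n', le_max_left _ _, le_max_right _ _⟩
  have hxb : x ∈ coordBox x n' r' := mem_coordBox_self hr'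
  obtain ⟨γ, hγ, hγx, hγ0, hγ1⟩ := exists_interiorize hr' hxb t n'
  have hco : ∀ i < n', γ x i = x i := fun i hi => hγx x i hi (by omega)
  have hEE : {y : ℕ → unitInterval | ∀ i < n', |(y i : ℝ) - γ x i| ≤ r'} = E := by
    ext y
    exact forall₂_congr fun i hi => by rw [hco i hi]
  obtain ⟨v, hv0, hv1, h', hh', hf'⟩ := exists_collar_germ (c := c) (c' := γ x) (n' := n') hr f hr'
    ht ht' (by rw [hEE]; exact fun y hy => (hE hy).1.1) (by rw [hEE]; exact fun y hy => (hE hy).2)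
    (by rw [hEE]; exact fun y hy => (hE hy).1.2)
  obtain ⟨ζ, hζ, hζx, hζv⟩ := exists_slide_point hr' (hγ.apply_mem hxb) (i := t) hγ0 hγ1 hv0 hv1
    (fun h => by omega)
  have hω : SuppIn (γ.trans ζ) E := (hγ.trans hζ).mono hbE
  have hωx : (γ.trans ζ) x = Function.update (γ x) t v := by
    funext j
    by_cases hj : j = t
    · subst hj
      rw [Function.update_self]
      exact Subtype.ext hζv
    · rw [Function.update_of_ne hj]
      exact hζx _ _ hj
  obtain ⟨θ, hθ, hθf⟩ := exists_conj_extend f hEc (fun y hy => (hE hy).1.1) hω.symm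
  refine ⟨((γ.trans ζ).trans h').trans θ, ((hω.mono fun y hy => (hE hy).2).trans hh').trans
    (hθ.mono ?_), ?_⟩
  · rintro _ ⟨y, hy, rfl⟩
    exact (hE hy).1.2
  rw [← hωx] at hf'
  filter_upwards [(γ.trans ζ).continuous.continuousAt.eventually hf',
    isOpen_coordBox.mem_nhds hxb] with y hy hyE
  change θ (h' ((γ.trans ζ) y)) = f y
  rw [hy, hθf _ (hE (hω.apply_mem (hbE hyE))).1.1, Homeomorph.symm_apply_apply]

section LocalCube

lemma isPreconnected_coordBox {c : ℕ → unitInterval} {n : ℕ} {r : ℝ} :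
    IsPreconnected (coordBox c n r) := by
  have h : coordBox c n r = univ.pi fun i => {s : unitInterval | i < n → |(s : ℝ) - c i| < r} := by
    ext x
    simp [coordBox, mem_pi]
  rw [h]
  refine isPreconnected_univ_pi fun i => OrdConnected.isPreconnected ⟨?_⟩
  intro a ha b hb s hs hi
  have h1 := abs_lt.1 (ha hi)
  have h2 := abs_lt.1 (hb hi)
  have h3 : (a : ℝ) ≤ s := hs.1
  have h4 : (s : ℝ) ≤ b := hs.2
  exact abs_lt.2 ⟨by linarith, by linarith⟩

variable {Y : Type*} [TopologicalSpace Y]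

/-- Open sets in which points can be moved densely, and germs can be extended, by homeomorphisms
supported in the set. -/
structure Flexible (U : Set Y) : Prop where
  isOpen : IsOpen U
  isPreconnected : IsPreconnected U
  move : ∀ y ∈ U, ∀ G : Set Y, IsOpen G → (G ∩ U).Nonempty → ∃ h : Y ≃ₜ Y, SuppIn h U ∧ h y ∈ G
  germ : ∀ (f : OpenPartialHomeomorph Y Y), ∀ y ∈ f.source, y ∈ U → f y ∈ U →
    ∃ h : Y ≃ₜ Y, SuppIn h U ∧ ∀ᶠ z in 𝓝 y, h z = f z

/-- Every point of `M` has a chart into the Hilbert cube. -/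
def LocallyCube (M : Set Y) : Prop :=
  ∀ x ∈ M, ∃ e : OpenPartialHomeomorph Y (ℕ → unitInterval), x ∈ e.source

variable [T2Space Y]

lemma LocallyCube.exists_flexible {M : Set Y} (hM : LocallyCube M) {x : Y} (hx : x ∈ M)
    {W : Set Y} (hW : W ∈ 𝓝 x) : ∃ U, Flexible U ∧ x ∈ U ∧ U ⊆ W := by
  obtain ⟨e, hxe⟩ := hM x hx
  have h1 : e.target ∩ e.symm ⁻¹' W ∈ 𝓝 (e x) := by
    refine Filter.inter_mem (e.open_target.mem_nhds (e.map_source hxe)) ?_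
    refine (e.symm.continuousAt (e.map_source hxe)).preimage_mem_nhds ?_
    rwa [e.left_inv hxe]
  obtain ⟨n, -, r, hr, hE⟩ := exists_coordBox_subset h1 0
  set E := {y : ℕ → unitInterval | ∀ i < n, |(y i : ℝ) - e x i| ≤ r} with hEdef
  have hVE : coordBox (e x) n r ⊆ E := fun y hy i hi => (hy i hi).le
  have hEc : IsCompact E := isClosed_closedCoordBox.isCompact
  have hVt : coordBox (e x) n r ⊆ e.target := fun y hy => (hE (hVE hy)).1
  have hlift : ∀ h : (ℕ → unitInterval) ≃ₜ (ℕ → unitInterval), SuppIn h (coordBox (e x) n r) →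
      ∃ ψ : Y ≃ₜ Y, SuppIn ψ (e.symm '' coordBox (e x) n r) ∧
        ∀ z ∈ e.source, ψ z = e.symm (h (e z)) := by
    intro h hh
    obtain ⟨ψ, hψ, hψh⟩ := exists_conj_extend e.symm hEc (fun y hy => (hE hy).1) (hh.mono hVE)
    refine ⟨ψ, fun z hz => ?_, fun z hz => ?_⟩
    · by_cases hzE : z ∈ e.symm '' E
      · obtain ⟨q, hq, rfl⟩ := hzE
        rw [hψh q (hE hq).1, hh q fun hqV => hz ⟨q, hqV, rfl⟩]
      · exact hψ z hzE
    · rw [← hψh _ (e.map_source hz), e.left_inv hz]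
  refine ⟨e.symm '' coordBox (e x) n r, ⟨?_, ?_, ?_, ?_⟩, ?_, ?_⟩
  · exact e.symm.isOpen_image_of_subset_source isOpen_coordBox hVt
  · exact isPreconnected_coordBox.image _ (e.symm.continuousOn.mono hVt)
  · rintro _ ⟨q, hq, rfl⟩ G hG ⟨_, hz, ⟨q', hq', rfl⟩⟩
    obtain ⟨h, hh, hhq⟩ := exists_transport_coordBox hr hq
      (e.symm.isOpen_inter_preimage hG) ⟨q', ⟨hVt hq', hz⟩, hq'⟩
    obtain ⟨ψ, hψ, hψh⟩ := hlift h hh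
    refine ⟨ψ, hψ, ?_⟩
    rw [hψh _ (e.map_target (hVt hq)), e.right_inv (hVt hq)]
    exact hhq.2
  · rintro f _ hfy ⟨q, hq, rfl⟩ ⟨q', hq', hqq'⟩
    obtain ⟨h, hh, hhF⟩ := exists_extension_germ hr (e.symm.trans (f.trans e)) (x := q)
      (by
        simp only [OpenPartialHomeomorph.trans_source, OpenPartialHomeomorph.symm_source,
          mem_inter_iff, mem_preimage]
        refine ⟨hVt hq, hfy, ?_⟩
        rw [← hqq']
        exact e.map_target (hVt hq')) hq
      (by
        change e (f (e.symm q)) ∈ _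
        rw [← hqq', e.right_inv (hVt hq')]
        exact hq')
    obtain ⟨ψ, hψ, hψh⟩ := hlift h hh
    refine ⟨ψ, hψ, ?_⟩
    have hys : e.symm q ∈ e.source := e.map_target (hVt hq)
    have h2 : ∀ᶠ z in 𝓝 (e.symm q), h (e z) = e (f (e.symm (e z))) := by
      have h2 := e.continuousAt hys
      rw [ContinuousAt, e.right_inv (hVt hq)] at h2
      exact h2.eventually hhF
    have h3 : ∀ᶠ z in 𝓝 (e.symm q), f z ∈ e.source :=
      (f.continuousAt hfy).preimage_mem_nhds (e.open_source.mem_nhds (by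
        rw [← hqq']
        exact e.map_target (hVt hq')))
    filter_upwards [h2, h3, e.open_source.mem_nhds hys] with z hz hz' hz''
    rw [hψh z hz'', hz, e.left_inv hz'', e.left_inv hz']
  · exact ⟨e x, mem_coordBox_self hr, e.left_inv hxe⟩
  · rintro _ ⟨q, hq, rfl⟩
    exact (hE (hVE hq)).2

namespace LocallyCube

variable {M : Set Y} (hM : LocallyCube M)

include hM

lemma isOpen_connectedComponentIn {O : Set Y} (hO : IsOpen O) (hOM : O ⊆ M) (x : Y) :
    IsOpen (connectedComponentIn O x) := by
  rw [isOpen_iff_mem_nhds]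
  intro y hy
  have hyO := connectedComponentIn_subset _ _ hy
  obtain ⟨U, hU, hyU, hUO⟩ := hM.exists_flexible (hOM hyO) (hO.mem_nhds hyO)
  rw [connectedComponentIn_eq hy]
  exact Filter.mem_of_superset (hU.isOpen.mem_nhds hyU)
    (hU.isPreconnected.subset_connectedComponentIn hyU hUO)

lemma exists_move {O : Set Y} (hO : IsOpen O) (hOM : O ⊆ M) (hOc : IsPreconnected O) {y z : Y}
    (hy : y ∈ O) (hz : z ∈ O) {G : Set Y} (hG : IsOpen G) (hzG : z ∈ G) :
    ∃ h : Y ≃ₜ Y, SuppIn h O ∧ h y ∈ G := by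
  let S : Set Y := {z | z ∈ O ∧ ∀ G, IsOpen G → z ∈ G → ∃ h : Y ≃ₜ Y, SuppIn h O ∧ h y ∈ G}
  have key : ∀ U, Flexible U → U ⊆ O → (U ∩ S).Nonempty → U ⊆ S := by
    rintro U hU hUO ⟨w, hwU, hwO, hw⟩ z hzU
    refine ⟨hUO hzU, fun G hG hzG => ?_⟩
    obtain ⟨h, hh, hhy⟩ := hw U hU.isOpen hwU
    obtain ⟨h', hh', hhy'⟩ := hU.move _ hhy G hG ⟨z, hzG, hzU⟩
    exact ⟨h.trans h', hh.trans (hh'.mono hUO), hhy'⟩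
  have hSo : IsOpen S := by
    rw [isOpen_iff_mem_nhds]
    intro z hz
    obtain ⟨U, hU, hzU, hUO⟩ := hM.exists_flexible (hOM hz.1) (hO.mem_nhds hz.1)
    exact Filter.mem_of_superset (hU.isOpen.mem_nhds hzU) (key U hU hUO ⟨z, hzU, hz⟩)
  have hsub : O ⊆ S := by
    refine hOc.subset_of_closure_inter_subset hSo
      ⟨y, hy, hy, fun G _ hyG => ⟨Homeomorph.refl Y, SuppIn.refl O, hyG⟩⟩ ?_
    rintro z ⟨hzS, hzO⟩
    obtain ⟨U, hU, hzU, hUO⟩ := hM.exists_flexible (hOM hzO) (hO.mem_nhds hzO)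
    exact key U hU hUO (mem_closure_iff.1 hzS U hU.isOpen hzU) hzU
  exact (hsub hz).2 G hG hzG

lemma exists_germ {O : Set Y} (hO : IsOpen O) (hOM : O ⊆ M) (hOc : IsPreconnected O)
    (f : OpenPartialHomeomorph Y Y) {x : Y} (hxf : x ∈ f.source) (hx : x ∈ O) (hfx : f x ∈ O) :
    ∃ h : Y ≃ₜ Y, SuppIn h O ∧ ∀ᶠ z in 𝓝 x, h z = f z := by
  obtain ⟨U, hU, hxU, hUO⟩ := hM.exists_flexible (hOM hfx) (hO.mem_nhds hfx)
  obtain ⟨h1, hh1, hx1⟩ := hM.exists_move hO hOM hOc hx hfx hU.isOpen hxU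
  obtain ⟨h2, hh2, hf2⟩ := hU.germ (h1.symm.toOpenPartialHomeomorph.trans f) (h1 x)
    (by simpa using hxf) hx1 (by simpa using hxU)
  refine ⟨h1.trans h2, hh1.trans (hh2.mono hUO), ?_⟩
  filter_upwards [h1.continuous.continuousAt.eventually hf2] with z hz
  change h2 (h1 z) = f z
  rw [hz]
  simp

/-- A compact set that shrinks to points can be moved, inside a connected open set, onto its image
under any local homeomorphism. -/
lemma exists_match [CompactSpace Y] {O : Set Y} (hO : IsOpen O) (hOM : O ⊆ M)
    (hOc : IsPreconnected O) (f : OpenPartialHomeomorph Y Y) {P : Set Y} (hP : IsCompact P)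
    (hPf : P ⊆ f.source) (hPO : P ⊆ O) (hfP : MapsTo f P O)
    (hsh : ∀ N : Set Y, IsOpen N → P ⊆ N → ∀ 𝒱 : Set (Set Y), (∀ v ∈ 𝒱, IsOpen v) → N ⊆ ⋃₀ 𝒱 →
      ∃ s : Y ≃ₜ Y, SuppIn s N ∧ ∃ v ∈ 𝒱, s '' P ⊆ v) :
    ∃ g : Y ≃ₜ Y, SuppIn g O ∧ ∀ x ∈ P, g x = f x := by
  have hN : IsOpen (f.source ∩ f ⁻¹' O ∩ O) := (f.isOpen_inter_preimage hO).inter hO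
  obtain ⟨N, hNo, hPN, hNN⟩ := normal_exists_closure_subset hP.isClosed hN
    fun x hx => ⟨⟨hPf hx, hfP hx⟩, hPO hx⟩
  obtain ⟨s, hs, v, ⟨hvo, h, hh, hhv⟩, hsv⟩ := hsh N hNo hPN
    {v | IsOpen v ∧ ∃ h : Y ≃ₜ Y, SuppIn h O ∧ ∀ z ∈ v, h z = f z} (fun v hv => hv.1) (by
      intro x hx
      have hx' := hNN (subset_closure hx)
      obtain ⟨h, hh, hhf⟩ := hM.exists_germ hO hOM hOc f hx'.1.1 hx'.2 hx'.1.2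
      obtain ⟨v, hv, hvo, hxv⟩ := eventually_nhds_iff.1 hhf
      exact ⟨v, ⟨hvo, h, hh, hv⟩, hxv⟩)
  obtain ⟨θ, hθ, hθf⟩ := exists_conj_extend f isClosed_closure.isCompact
    (fun x hx => (hNN hx).1.1) (hs.mono subset_closure).symm
  refine ⟨(s.trans h).trans θ, ((hs.mono fun x hx => (hNN (subset_closure hx)).2).trans hh).trans
    (hθ.mono ?_), fun x hx => ?_⟩
  · rintro _ ⟨x, hx, rfl⟩
    exact (hNN hx).1.2
  · change θ (h (s x)) = f x
    rw [hhv _ (hsv ⟨x, hx, rfl⟩), hθf _ (hNN (subset_closure (hs.apply_mem (hPN hx)))).1.1,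
      Homeomorph.symm_apply_apply]

end LocallyCube

end LocalCube

section PieceFamilies

variable {Y : Type*}

/-- All distances between points of `A` are less than `ε`. -/
def DistLT [MetricSpace Y] (A : Set Y) (ε : ℝ) : Prop := ∀ x ∈ A, ∀ y ∈ A, dist x y < ε

lemma DistLT.mono [MetricSpace Y] {A B : Set Y} {ε ε' : ℝ} (h : DistLT A ε) (hBA : B ⊆ A)
    (hε : ε ≤ ε') : DistLT B ε' := fun x hx y hy => (h x (hBA hx) y (hBA hy)).trans_le hε

/-- `U` contains every member of `𝒜` that it meets. -/
def SatFor (𝒜 : Set (Set Y)) (U : Set Y) : Prop := ∀ A ∈ 𝒜, (A ∩ U).Nonempty → A ⊆ U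

/-- The nondegenerate pieces, lying in `M`, of a dense vanishing strongly shrinkable
decomposition. -/
structure PieceFamily [MetricSpace Y] (M : Set Y) (𝒜 : Set (Set Y)) : Prop where
  subset : ∀ A ∈ 𝒜, A ⊆ M
  isCompact : ∀ A ∈ 𝒜, IsCompact A
  isPreconnected : ∀ A ∈ 𝒜, IsPreconnected A
  nontrivial : ∀ A ∈ 𝒜, A.Nontrivial
  disjoint : ∀ A ∈ 𝒜, ∀ B ∈ 𝒜, (A ∩ B).Nonempty → A = B
  null : ∀ ε, 0 < ε → {A ∈ 𝒜 | ¬ DistLT A ε}.Finite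
  shrink : ∀ U, IsOpen U → U ⊆ M → SatFor 𝒜 U → ∀ 𝒰 : Set (Set Y),
    (∀ u ∈ 𝒰, IsOpen u ∧ u ⊆ U ∧ SatFor 𝒜 u) → U ⊆ ⋃₀ 𝒰 → ∀ 𝒱 : Set (Set Y),
    (∀ v ∈ 𝒱, IsOpen v ∧ v ⊆ U) → U ⊆ ⋃₀ 𝒱 →
    ∃ h : OpenPartialHomeomorph Y Y, h.source = U ∧ h.target = U ∧
      (∀ x ∈ U, ∃ u ∈ 𝒰, x ∈ u ∧ h x ∈ u) ∧ ∀ A ∈ 𝒜, A ⊆ U → ∃ v ∈ 𝒱, h '' A ⊆ v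
  dense : ∀ U, IsOpen U → U ⊆ M → SatFor 𝒜 U → U.Nonempty → ∃ A ∈ 𝒜, A ⊆ U

/-- A self-homeomorphism of an open set that is close to the identity near the frontier extends
by the identity. -/
lemma exists_extend_id [MetricSpace Y] {U : Set Y} (hU : IsOpen U) {d : Y → ℝ} (hd : Continuous d)
    (hdU : ∀ x ∉ U, d x = 0) (h : OpenPartialHomeomorph Y Y) (hs : h.source = U)
    (ht : h.target = U)
    (hh : ∀ ε, 0 < ε → ∃ δ, 0 < δ ∧ ∀ x ∈ U, d x < δ → dist (h x) x < ε ∧ dist (h.symm x) x < ε) :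
    ∃ g : Y ≃ₜ Y, SuppIn g U ∧ ∀ x ∈ U, g x = h x := by
  classical
  have hc : ∀ k : OpenPartialHomeomorph Y Y, k.source = U →
      (∀ ε, 0 < ε → ∃ δ, 0 < δ ∧ ∀ x ∈ U, d x < δ → dist (k x) x < ε) →
      Continuous fun x => if x ∈ U then k x else x := by
    intro k hk hkε
    rw [continuous_iff_continuousAt]
    intro z
    by_cases hz : z ∈ U
    · have h1 : k =ᶠ[𝓝 z] fun x => if x ∈ U then k x else x := by
        filter_upwards [hU.mem_nhds hz] with x hx
        exact (if_pos hx).symm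
      exact (k.continuousAt (by rwa [hk])).congr h1
    · rw [Metric.continuousAt_iff]
      intro ε hε
      obtain ⟨δ, hδ, hδk⟩ := hkε (ε / 2) (by linarith)
      have h1 : ∀ᶠ x in 𝓝 z, d x < δ :=
        hd.continuousAt.eventually_lt continuousAt_const (by rw [hdU z hz]; exact hδ)
      obtain ⟨δ', hδ', h2⟩ := Metric.eventually_nhds_iff.1 h1
      refine ⟨min δ' (ε / 2), lt_min hδ' (by linarith), fun {x} hx => ?_⟩
      have h3 := hx.trans_le (min_le_left _ _)
      have h4 := hx.trans_le (min_le_right _ _)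
      rw [if_neg hz]
      split_ifs with hxU
      · have h5 := hδk x hxU (h2 h3)
        have h6 := dist_triangle (k x) x z
        linarith
      · linarith
  have hinv : ∀ k : OpenPartialHomeomorph Y Y, k.source = U → k.target = U → ∀ x,
      (if (if x ∈ U then k x else x) ∈ U then k.symm (if x ∈ U then k x else x)
        else (if x ∈ U then k x else x)) = x := by
    intro k hk hk' x
    by_cases hx : x ∈ U
    · have h1 : k x ∈ U := by
        rw [← hk'] 
        exact k.map_source (by rwa [hk])
      rw [if_pos hx, if_pos h1, k.left_inv (by rwa [hk])]
    · rw [if_neg hx, if_neg hx]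
  refine ⟨⟨⟨fun x => if x ∈ U then h x else x, fun x => if x ∈ U then h.symm x else x,
    hinv h hs ht, fun x => ?_⟩, hc h hs fun ε hε => ?_, hc h.symm ht fun ε hε => ?_⟩,
    fun x hx => if_neg hx, fun x hx => if_pos hx⟩
  · exact hinv h.symm ht hs x
  · obtain ⟨δ, hδ, H⟩ := hh ε hε
    exact ⟨δ, hδ, fun x hx hxd => (H x hx hxd).1⟩
  · obtain ⟨δ, hδ, H⟩ := hh ε hε
    exact ⟨δ, hδ, fun x hx hxd => (H x hx hxd).2⟩

lemma exists_dist_compl [MetricSpace Y] (U : Set Y) (hU : IsOpen U) :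
    ∃ d : Y → ℝ, LipschitzWith 1 d ∧ (∀ x ∉ U, d x = 0) ∧ ∀ x ∈ U, 0 < d x := by
  rcases (Uᶜ).eq_empty_or_nonempty with h | h
  · rw [compl_empty_iff] at h
    exact ⟨fun _ => 1, LipschitzWith.const' 1, fun x hx => (hx (h ▸ mem_univ x)).elim,
      fun _ _ => one_pos⟩
  · refine ⟨fun x => Metric.infDist x Uᶜ, Metric.lipschitz_infDist_pt _,
      fun x hx => Metric.infDist_zero_of_mem hx, fun x hx => ?_⟩
    exact (hU.isClosed_compl.notMem_iff_infDist_pos h).1 (not_not_intro hx)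

/-- Compact squares inside open relations have square neighbourhoods. -/
lemma exists_open_square [TopologicalSpace Y] {K : Set Y} (hK : IsCompact K) {R : Set (Y × Y)}
    (hR : IsOpen R) (h : K ×ˢ K ⊆ R) : ∃ W, IsOpen W ∧ K ⊆ W ∧ W ×ˢ W ⊆ R := by
  obtain ⟨u, v, hu, hv, hKu, hKv, huv⟩ := generalized_tube_lemma hK hK hR h
  exact ⟨u ∩ v, hu.inter hv, subset_inter hKu hKv,
    (prod_mono inter_subset_left inter_subset_right).trans huv⟩

namespace PieceFamily

variable [MetricSpace Y] {M : Set Y} {𝒜 : Set (Set Y)} (h𝒜 : PieceFamily M 𝒜)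

include h𝒜

lemma finite_inter {F W : Set Y} (hF : IsCompact F) (hW : IsOpen W) (hFW : F ⊆ W) :
    {A ∈ 𝒜 | (A ∩ F).Nonempty ∧ ¬ A ⊆ W}.Finite := by
  obtain ⟨δ, hδ, hδW⟩ := hF.exists_thickening_subset_open hW hFW
  refine (h𝒜.null δ hδ).subset ?_
  rintro A ⟨hA, ⟨a, haA, haF⟩, hAW⟩
  refine ⟨hA, fun hs => hAW fun x hx => hδW ?_⟩
  exact Metric.mem_thickening_iff.2 ⟨a, haF, hs x hx a haA⟩

variable [CompactSpace Y]

/-- Saturations of closed sets are closed. -/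
lemma isClosed_saturation {F : Set Y} (hF : IsClosed F) :
    IsClosed (F ∪ ⋃₀ {A ∈ 𝒜 | (A ∩ F).Nonempty}) := by
  rw [← isOpen_compl_iff, isOpen_iff_mem_nhds]
  intro z hz
  rw [compl_union, mem_inter_iff] at hz
  obtain ⟨W, hW, hFW, hzW⟩ : ∃ W, IsOpen W ∧ F ⊆ W ∧ z ∉ closure W := by
    obtain ⟨u, v, hu, hv, hzu, hFv, huv⟩ := SeparatedNhds.of_isCompact_isClosed
      (isCompact_singleton (x := z)) hF (disjoint_singleton_left.2 hz.1)
    refine ⟨v, hv, hFv, fun h => ?_⟩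
    obtain ⟨w, hw, hw'⟩ := mem_closure_iff.1 h u hu (hzu rfl)
    exact huv.le_bot ⟨hw, hw'⟩
  have hfin := h𝒜.finite_inter hF.isCompact hW hFW
  have hcl : IsClosed (⋃₀ {A ∈ 𝒜 | (A ∩ F).Nonempty ∧ ¬ A ⊆ W}) :=
    sUnion_eq_biUnion ▸ hfin.isClosed_biUnion fun A hA => (h𝒜.isCompact A hA.1).isClosed
  have h1 : z ∉ ⋃₀ {A ∈ 𝒜 | (A ∩ F).Nonempty ∧ ¬ A ⊆ W} := fun ⟨A, hA, hzA⟩ =>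
    hz.2 ⟨A, ⟨hA.1, hA.2.1⟩, hzA⟩
  filter_upwards [hcl.isOpen_compl.mem_nhds h1, isClosed_closure.isOpen_compl.mem_nhds hzW]
    with x hx hxW
  rintro (hxF | ⟨A, ⟨hA, hAF⟩, hxA⟩)
  · exact hxW (subset_closure (hFW hxF))
  · by_cases hAW : A ⊆ W
    · exact hxW (subset_closure (hAW hxA))
    · exact hx ⟨A, ⟨hA, hAF, hAW⟩, hxA⟩

/-- The largest saturated subset of an open set is open. -/
lemma exists_saturated {W : Set Y} (hW : IsOpen W) :
    ∃ u, IsOpen u ∧ u ⊆ W ∧ SatFor 𝒜 u ∧ (∀ A ∈ 𝒜, A ⊆ W → A ⊆ u) ∧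
      ∀ x ∈ W, (∀ A ∈ 𝒜, x ∉ A) → x ∈ u := by
  refine ⟨_, (h𝒜.isClosed_saturation hW.isClosed_compl).isOpen_compl, ?_, ?_, ?_, ?_⟩
  · intro x hx
    by_contra hxW
    exact hx (Or.inl hxW)
  · rintro A hA ⟨a, haA, ha⟩ x hx
    have hAW : A ⊆ W := fun y hy => by
      by_contra hyW
      exact ha (Or.inr ⟨A, ⟨hA, y, hy, hyW⟩, haA⟩)
    rintro (h | ⟨B, ⟨hB, hBW⟩, hxB⟩)
    · exact h (hAW hx)
    · obtain rfl := h𝒜.disjoint A hA B hB ⟨x, hx, hxB⟩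
      obtain ⟨y, hy, hyW⟩ := hBW
      exact hyW (hAW hy)
  · intro A hA hAW x hx
    rintro (h | ⟨B, ⟨hB, hBW⟩, hxB⟩)
    · exact h (hAW hx)
    · obtain rfl := h𝒜.disjoint A hA B hB ⟨x, hx, hxB⟩
      obtain ⟨y, hy, hyW⟩ := hBW
      exact hyW (hAW hy)
  · intro x hxW hx
    rintro (h | ⟨B, ⟨hB, hBW⟩, hxB⟩)
    · exact h hxW
    · exact hx B hB hxB

/-- Controlled shrinking by homeomorphisms of the whole space. -/
lemma exists_shrink {U : Set Y} (hU : IsOpen U) (hUM : U ⊆ M) (hUs : SatFor 𝒜 U)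
    {R : Set (Y × Y)} (hR : IsOpen R) (hdiag : ∀ x, (x, x) ∈ R)
    (hAR : ∀ A ∈ 𝒜, A ⊆ U → A ×ˢ A ⊆ R) {𝒱 : Set (Set Y)} (h𝒱 : ∀ v ∈ 𝒱, IsOpen v)
    (h𝒱U : U ⊆ ⋃₀ 𝒱) :
    ∃ g : Y ≃ₜ Y, SuppIn g U ∧ (∀ x, (x, g x) ∈ R) ∧ ∀ A ∈ 𝒜, A ⊆ U → ∃ v ∈ 𝒱, g '' A ⊆ v := by
  obtain ⟨d, hd, hd0, hdpos⟩ := exists_dist_compl U hU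
  have hdl : ∀ x y, d x ≤ d y + dist x y := fun x y => by
    have := hd.dist_le_mul x y
    rw [NNReal.coe_one, one_mul, Real.dist_eq] at this
    linarith [le_abs_self (d x - d y)]
  let IsPiece : Set Y → Prop := fun P => (P ∈ 𝒜 ∧ P ⊆ U) ∨ ∃ x, P = {x}
  let 𝒰 : Set (Set Y) := {u | IsOpen u ∧ u ⊆ U ∧ SatFor 𝒜 u ∧ u ×ˢ u ⊆ R ∧
    ∃ P, IsPiece P ∧ ∀ x ∈ u, ∃ a ∈ P, dist x a < d a / 2}
  have hcov : U ⊆ ⋃₀ 𝒰 := by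
    intro x hx
    obtain ⟨P, hP, hxP, hPU, hPc, hPR, hPu⟩ : ∃ P, IsPiece P ∧ x ∈ P ∧ P ⊆ U ∧ IsCompact P ∧
        P ×ˢ P ⊆ R ∧ ∀ W, IsOpen W → P ⊆ W → ∃ u, IsOpen u ∧ u ⊆ W ∧ SatFor 𝒜 u ∧ x ∈ u := by
      by_cases hxA : ∃ A ∈ 𝒜, x ∈ A
      · obtain ⟨A, hA, hxA⟩ := hxA
        have hAU := hUs A hA ⟨x, hxA, hx⟩
        refine ⟨A, Or.inl ⟨hA, hAU⟩, hxA, hAU, h𝒜.isCompact A hA, hAR A hA hAU,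
          fun W hW hAW => ?_⟩
        obtain ⟨u, hu, huW, hus, h1, -⟩ := h𝒜.exists_saturated hW
        exact ⟨u, hu, huW, hus, h1 A hA hAW hxA⟩
      · push Not at hxA
        refine ⟨{x}, Or.inr ⟨x, rfl⟩, rfl, singleton_subset_iff.2 hx, isCompact_singleton, ?_,
          fun W hW hAW => ?_⟩
        · rintro ⟨y, z⟩ ⟨hy, hz⟩
          obtain rfl : y = x := hy
          obtain rfl : z = y := hz
          exact hdiag z
        · obtain ⟨u, hu, huW, hus, -, h1⟩ := h𝒜.exists_saturated hW
          exact ⟨u, hu, huW, hus, h1 x (hAW rfl) hxA⟩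
    obtain ⟨W, hW, hPW, hWR⟩ := exists_open_square hPc hR hPR
    have hW' : IsOpen (⋃ a ∈ P, Metric.ball a (d a / 2)) :=
      isOpen_biUnion fun _ _ => Metric.isOpen_ball
    obtain ⟨u, hu, huW, hus, hxu⟩ := hPu (W ∩ U ∩ ⋃ a ∈ P, Metric.ball a (d a / 2))
      ((hW.inter hU).inter hW') (fun a ha => ⟨⟨hPW ha, hPU ha⟩, mem_biUnion ha
        (Metric.mem_ball_self (half_pos (hdpos a (hPU ha))))⟩)
    refine ⟨u, ⟨hu, fun y hy => (huW hy).1.2, hus, ?_, P, hP, fun y hy => ?_⟩, hxu⟩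
    · exact (prod_mono (fun y hy => (huW hy).1.1) fun y hy => (huW hy).1.1).trans hWR
    · obtain ⟨a, ha, hya⟩ := mem_iUnion₂.1 (huW hy).2
      exact ⟨a, ha, hya⟩
  have hmod : ∀ ε, 0 < ε → ∃ δ, 0 < δ ∧ ∀ u ∈ 𝒰, ∀ x ∈ u, ∀ y ∈ u, d x < δ → dist y x < ε := by
    intro ε hε
    have hfin : {A ∈ 𝒜 | ¬ DistLT A (ε / 3) ∧ A ⊆ U}.Finite :=
      (h𝒜.null (ε / 3) (by linarith)).subset fun A hA => ⟨hA.1, hA.2.1⟩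
    have hK : IsCompact (⋃₀ {A ∈ 𝒜 | ¬ DistLT A (ε / 3) ∧ A ⊆ U}) :=
      hfin.isCompact_sUnion fun A hA => h𝒜.isCompact A hA.1
    obtain ⟨ρ, hρ, hρK⟩ := hK.exists_pos_le hd.continuous.continuousOn fun x ⟨A, hA, hx⟩ =>
      hdpos x (hA.2.2 hx)
    refine ⟨min (ρ / 2) (ε / 6), lt_min (by linarith) (by linarith), ?_⟩
    rintro u ⟨-, -, -, -, P, hP, hPu⟩ x hx y hy hxd
    have h1 := hxd.trans_le (min_le_left _ _)
    have h2 := hxd.trans_le (min_le_right _ _)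
    obtain ⟨a, ha, hxa⟩ := hPu x hx
    obtain ⟨b, hb, hyb⟩ := hPu y hy
    have h3 := hdl a x
    have h4 := hdl b a
    rw [dist_comm] at h3
    have hab : dist b a < ε / 3 := by
      rcases hP with ⟨hP, hPU⟩ | ⟨z, rfl⟩
      · by_contra h
        have h5 : ¬ DistLT P (ε / 3) := fun hs => h (hs b hb a ha)
        have h6 := hρK a ⟨P, ⟨hP, h5, hPU⟩, ha⟩
        linarith
      · rw [mem_singleton_iff.1 ha, mem_singleton_iff.1 hb, dist_self]
        linarith
    have h5 := dist_triangle y b x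
    have h6 := dist_triangle b a x
    rw [dist_comm a x] at h6
    linarith
  obtain ⟨h, hs, ht, hh, hhv⟩ := h𝒜.shrink U hU hUM hUs 𝒰 (fun u hu => ⟨hu.1, hu.2.1, hu.2.2.1⟩)
    hcov ((fun v => v ∩ U) '' 𝒱) (by
      rintro _ ⟨v, hv, rfl⟩
      exact ⟨(h𝒱 v hv).inter hU, inter_subset_right⟩) (fun x hx => by
      obtain ⟨v, hv, hxv⟩ := h𝒱U hx
      exact ⟨_, ⟨v, hv, rfl⟩, hxv, hx⟩)
  obtain ⟨g, hg, hgh⟩ := exists_extend_id hU hd.continuous hd0 h hs ht (by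
    intro ε hε
    obtain ⟨δ, hδ, hδu⟩ := hmod ε hε
    refine ⟨δ, hδ, fun x hx hxd => ⟨?_, ?_⟩⟩
    · obtain ⟨u, hu, hxu, hhu⟩ := hh x hx
      exact hδu u hu x hxu _ hhu hxd
    · have hx' : h.symm x ∈ U := by
        rw [← hs]
        exact h.map_target (by rwa [ht])
      obtain ⟨u, hu, hxu, hhu⟩ := hh _ hx'
      rw [h.right_inv (by rwa [ht])] at hhu
      exact hδu u hu x hhu _ hxu hxd)
  refine ⟨g, hg, fun x => ?_, fun A hA hAU => ?_⟩
  · by_cases hx : x ∈ U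
    · obtain ⟨u, hu, hxu, hhu⟩ := hh x hx
      rw [hgh x hx]
      exact hu.2.2.2.1 ⟨hxu, hhu⟩
    · rw [hg x hx]
      exact hdiag x
  · obtain ⟨_, ⟨v, hv, rfl⟩, hvA⟩ := hhv A hA hAU
    refine ⟨v, hv, ?_⟩
    rintro _ ⟨a, ha, rfl⟩
    rw [hgh a (hAU ha)]
    exact (hvA ⟨a, ha, rfl⟩).1

/-- Every member of a piece family shrinks to points. -/
lemma exists_local_shrink (hM : IsOpen M) {A : Set Y} (hA : A ∈ 𝒜) {N : Set Y} (hN : IsOpen N)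
    (hAN : A ⊆ N) {𝒱 : Set (Set Y)} (h𝒱 : ∀ v ∈ 𝒱, IsOpen v) (h𝒱N : N ⊆ ⋃₀ 𝒱) :
    ∃ s : Y ≃ₜ Y, SuppIn s N ∧ ∃ v ∈ 𝒱, s '' A ⊆ v := by
  obtain ⟨u, hu, huN, hus, hAu, -⟩ := h𝒜.exists_saturated (hN.inter hM)
  have hAu := hAu A hA (subset_inter hAN (h𝒜.subset A hA))
  obtain ⟨s, hs, -, hsv⟩ := h𝒜.exists_shrink hu (fun x hx => (huN hx).2) hus isOpen_univ
    (fun _ => mem_univ _) (fun _ _ _ => subset_univ _) h𝒱 (fun x hx => h𝒱N (huN hx).1)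
  exact ⟨s, hs.mono fun x hx => (huN hx).1, hsv A hA hAu⟩

end PieceFamily

end PieceFamilies

section Matchings

variable {Y : Type*}

/-- Homeomorphisms with pairwise disjoint supports can be combined. -/
lemma exists_combine [TopologicalSpace Y] {ι : Type*} (s : Finset ι) (O : ι → Set Y)
    (g : ι → Y ≃ₜ Y) (hg : ∀ i ∈ s, SuppIn (g i) (O i))
    (hO : ∀ i ∈ s, ∀ j ∈ s, (O i ∩ O j).Nonempty → i = j) :
    ∃ G : Y ≃ₜ Y, SuppIn G (⋃ i ∈ s, O i) ∧ ∀ i ∈ s, ∀ x ∈ O i, G x = g i x := by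
  classical
  induction s using Finset.induction_on with
  | empty => exact ⟨Homeomorph.refl Y, SuppIn.refl _, by simp⟩
  | insert i s hi ih =>
    obtain ⟨G, hG, hGg⟩ := ih (fun j hj => hg j (Finset.mem_insert_of_mem hj))
      fun j hj k hk => hO j (Finset.mem_insert_of_mem hj) k (Finset.mem_insert_of_mem hk)
    have hi' := Finset.mem_insert_self i s
    refine ⟨G.trans (g i), fun x hx => ?_, fun j hj x hx => ?_⟩
    · rw [Finset.set_biUnion_insert] at hx
      change g i (G x) = x
      rw [hG x fun h => hx (Or.inr h), hg i hi' x fun h => hx (Or.inl h)]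
    · change g i (G x) = g j x
      rcases Finset.mem_insert.1 hj with rfl | hjs
      · rw [hG x]
        intro h
        obtain ⟨k, hk, hxk⟩ := mem_iUnion₂.1 h
        exact hi (hO j hj k (Finset.mem_insert_of_mem hk) ⟨x, hx, hxk⟩ ▸ hk)
      · rw [hGg j hjs x hx]
        refine hg i hi' _ fun h => hi ?_
        exact hO i hi' j hj ⟨_, h, (hg j hj).apply_mem hx⟩ ▸ hjs

section Metric

variable [MetricSpace Y] {M : Set Y} {𝒜 ℬ : Set (Set Y)}

lemma DistLT.image {A : Set Y} {ε c : ℝ} (h : DistLT A ε) {g : Y → Y}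
    (hg : ∀ x, dist (g x) x ≤ c) : DistLT (g '' A) (ε + 2 * c) := by
  rintro _ ⟨x, hx, rfl⟩ _ ⟨y, hy, rfl⟩
  have h1 := h x hx y hy
  have h2 := hg x
  have h3 := hg y
  have h4 := dist_triangle (g x) x (g y)
  have h5 := dist_triangle x y (g y)
  rw [dist_comm y] at h5
  linarith

/-- A stage of the back-and-forth construction: the members of `𝓕` are already matched by `Φ`, and
the sizes of the others are bounded. -/
structure Matching (M : Set Y) (𝒜 ℬ : Set (Set Y)) (Φ : Y ≃ₜ Y) (𝓕 : Set (Set Y))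
    (a₁ a₂ b₁ b₂ : ℝ) : Prop where
  supp : SuppIn Φ M
  finite : 𝓕.Finite
  sub : 𝓕 ⊆ 𝒜
  maps : ∀ A ∈ 𝓕, Φ '' A ∈ ℬ
  left : ∀ A ∈ 𝒜, A ∉ 𝓕 → DistLT A a₁ ∧ DistLT (Φ '' A) a₂
  right : ∀ B ∈ ℬ, B ∉ (fun A => Φ '' A) '' 𝓕 → DistLT B b₁ ∧ DistLT (Φ.symm '' B) b₂

/-- Uniform closeness, also of the inverses, and agreement on the members of `𝓕`. -/
structure CloseOn (Φ Φ' : Y ≃ₜ Y) (𝓕 : Set (Set Y)) (c : ℝ) : Prop where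
  dist_le : ∀ x, dist (Φ x) (Φ' x) ≤ c
  dist_symm_le : ∀ x, dist (Φ.symm x) (Φ'.symm x) ≤ c
  eqOn : ∀ A ∈ 𝓕, ∀ x ∈ A, Φ' x = Φ x

lemma CloseOn.trans {Φ Φ' Φ'' : Y ≃ₜ Y} {𝓕 𝓕' : Set (Set Y)} {c c' : ℝ} (h : CloseOn Φ Φ' 𝓕 c)
    (h' : CloseOn Φ' Φ'' 𝓕' c') (h𝓕 : 𝓕 ⊆ 𝓕') : CloseOn Φ Φ'' 𝓕 (c + c') where
  dist_le x := (dist_triangle _ _ _).trans (add_le_add (h.dist_le x) (h'.dist_le x))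
  dist_symm_le x := (dist_triangle _ _ _).trans (add_le_add (h.dist_symm_le x) (h'.dist_symm_le x))
  eqOn A hA x hx := (h'.eqOn A (h𝓕 hA) x hx).trans (h.eqOn A hA x hx)

lemma CloseOn.mono {Φ Φ' : Y ≃ₜ Y} {𝓕 : Set (Set Y)} {c c' : ℝ} (h : CloseOn Φ Φ' 𝓕 c)
    (hc : c ≤ c') : CloseOn Φ Φ' 𝓕 c' where
  dist_le x := (h.dist_le x).trans hc
  dist_symm_le x := (h.dist_symm_le x).trans hc
  eqOn := h.eqOn

lemma CloseOn.image_eq {Φ Ψ : Y ≃ₜ Y} {𝓕 : Set (Set Y)} {c : ℝ} (h : CloseOn Φ Ψ 𝓕 c) {A : Set Y}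
    (hA : A ∈ 𝓕) : Ψ '' A = Φ '' A := image_congr (h.eqOn A hA)

lemma CloseOn.swap {Φ Φ' : Y ≃ₜ Y} {𝓕 : Set (Set Y)} {c : ℝ} (h : CloseOn Φ Φ' 𝓕 c) :
    CloseOn Φ.symm Φ'.symm ((fun A => Φ '' A) '' 𝓕) c where
  dist_le := h.dist_symm_le
  dist_symm_le := h.dist_le
  eqOn := by
    rintro _ ⟨A, hA, rfl⟩ _ ⟨x, hx, rfl⟩
    rw [Φ.symm_apply_apply, ← h.eqOn A hA x hx, Φ'.symm_apply_apply]

namespace Matching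

variable {Φ : Y ≃ₜ Y} {𝓕 : Set (Set Y)} {a a' b b' : ℝ}

lemma image_symm_image (Φ : Y ≃ₜ Y) (𝓕 : Set (Set Y)) :
    (fun A => Φ.symm '' A) '' ((fun A => Φ '' A) '' 𝓕) = 𝓕 := by
  rw [image_image]
  simp [image_image]

lemma swap (h : Matching M 𝒜 ℬ Φ 𝓕 a a' b b') :
    Matching M ℬ 𝒜 Φ.symm ((fun A => Φ '' A) '' 𝓕) b b' a a' where
  supp := h.supp.symm
  finite := h.finite.image _
  sub := image_subset_iff.2 h.maps
  maps := by
    rintro _ ⟨A, hA, rfl⟩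
    simpa [image_image] using h.sub hA
  left := h.right
  right A hA hA' := by
    rw [image_symm_image] at hA'
    exact h.left A hA hA'

lemma mono (h : Matching M 𝒜 ℬ Φ 𝓕 a a' b b') {c c' d d' : ℝ} (h1 : a ≤ c) (h2 : a' ≤ c')
    (h3 : b ≤ d) (h4 : b' ≤ d') : Matching M 𝒜 ℬ Φ 𝓕 c c' d d' :=
  { h with
    left := fun A hA hA' => ⟨(h.left A hA hA').1.mono subset_rfl h1,
      (h.left A hA hA').2.mono subset_rfl h2⟩
    right := fun A hA hA' => ⟨(h.right A hA hA').1.mono subset_rfl h3,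
      (h.right A hA hA').2.mono subset_rfl h4⟩ }

variable (hM : IsOpen M) (h𝒜 : PieceFamily M 𝒜) (hℬ : PieceFamily M ℬ)

include hM h𝒜

lemma isOpen_rest (h𝓕 : 𝓕 ⊆ 𝒜) (hf : 𝓕.Finite) : IsOpen (M \ ⋃₀ 𝓕) :=
  hM.sdiff (sUnion_eq_biUnion ▸ hf.isClosed_biUnion fun A hA => (h𝒜.isCompact A (h𝓕 hA)).isClosed)

omit hM in
lemma subset_rest (h𝓕 : 𝓕 ⊆ 𝒜) {A : Set Y} (hA : A ∈ 𝒜) (hA' : A ∉ 𝓕) : A ⊆ M \ ⋃₀ 𝓕 := by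
  refine fun x hx => ⟨h𝒜.subset A hA hx, fun ⟨B, hB, hxB⟩ => hA' ?_⟩
  rwa [h𝒜.disjoint A hA B (h𝓕 hB) ⟨x, hx, hxB⟩]

omit hM in
lemma notMem_of_subset_rest {A : Set Y} (hA : A ∈ 𝒜) (h : A ⊆ M \ ⋃₀ 𝓕) : A ∉ 𝓕 := fun hA' => by
  obtain ⟨x, hx⟩ := (h𝒜.nontrivial A hA).nonempty
  exact (h hx).2 ⟨A, hA', hx⟩

lemma exists_shrink_left [CompactSpace Y] (h : Matching M 𝒜 ℬ Φ 𝓕 a a' b b') (ha : 0 < a)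
    (ha' : 0 < a') {κ : ℝ} (hκ : 0 < κ) :
    ∃ Φ' : Y ≃ₜ Y, Matching M 𝒜 ℬ Φ' 𝓕 a κ b (b' + 2 * a) ∧ CloseOn Φ Φ' 𝓕 (max a a') := by
  have hsat : SatFor 𝒜 (M \ ⋃₀ 𝓕) := fun A hA ⟨x, hxA, hx⟩ =>
    subset_rest h𝒜 h.sub hA fun hA' => hx.2 ⟨A, hA', hxA⟩
  obtain ⟨g, hg, hgR, hgV⟩ := h𝒜.exists_shrink (isOpen_rest hM h𝒜 h.sub h.finite) sdiff_subset hsat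
    (R := {p | dist p.1 p.2 < a} ∩ {p | dist (Φ p.1) (Φ p.2) < a'})
    ((isOpen_lt (continuous_fst.dist continuous_snd) continuous_const).inter
      (isOpen_lt ((Φ.continuous.comp continuous_fst).dist (Φ.continuous.comp continuous_snd))
        continuous_const))
    (fun x => ⟨by simpa using ha, by simpa using ha'⟩)
    (fun A hA hA' ⟨x, y⟩ hxy => by
      have h1 := h.left A hA (notMem_of_subset_rest h𝒜 hA hA')
      exact ⟨h1.1 x hxy.1 y hxy.2, h1.2 _ ⟨x, hxy.1, rfl⟩ _ ⟨y, hxy.2, rfl⟩⟩)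
    (𝒱 := {v | IsOpen v ∧ DistLT (Φ '' v) κ}) (fun v hv => hv.1) (fun x _ => by
      refine ⟨Φ ⁻¹' Metric.ball (Φ x) (κ / 2), ⟨Metric.isOpen_ball.preimage Φ.continuous, ?_⟩,
        Metric.mem_ball_self (half_pos hκ)⟩
      rintro _ ⟨y, hy, rfl⟩ _ ⟨z, hz, rfl⟩
      have h1 := dist_triangle_right (Φ y) (Φ z) (Φ x)
      have h2 : dist (Φ y) (Φ x) < κ / 2 := hy
      have h3 : dist (Φ z) (Φ x) < κ / 2 := hz
      linarith)
  have hfix : ∀ A ∈ 𝓕, ∀ x ∈ A, (g.trans Φ) x = Φ x := fun A hA x hx => by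
    change Φ (g x) = Φ x
    rw [hg x fun h' => h'.2 ⟨A, hA, hx⟩]
  have him : ∀ A ∈ 𝓕, (g.trans Φ) '' A = Φ '' A := fun A hA => image_congr (hfix A hA)
  have hs1 : ∀ y, dist (g.symm y) y < a := fun y => by
    simpa using (hgR (g.symm y)).1
  refine ⟨g.trans Φ, ⟨(hg.mono sdiff_subset).trans h.supp, h.finite, h.sub, fun A hA => ?_,
    fun A hA hA' => ⟨(h.left A hA hA').1, ?_⟩, fun B hB hB' => ?_⟩, ⟨fun x => ?_, fun x => ?_,
    hfix⟩⟩
  · rw [him A hA]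
    exact h.maps A hA
  · obtain ⟨v, hv, hvA⟩ := hgV A hA (subset_rest h𝒜 h.sub hA hA')
    refine hv.2.mono ?_ le_rfl
    rintro _ ⟨x, hx, rfl⟩
    exact ⟨g x, hvA ⟨x, hx, rfl⟩, rfl⟩
  · rw [image_congr him] at hB'
    refine ⟨(h.right B hB hB').1, ?_⟩
    have h1 := (h.right B hB hB').2.image fun y => (hs1 y).le
    rw [← image_comp] at h1
    exact h1
  · exact (hgR x).2.le.trans (le_max_right _ _)
  · rw [dist_comm]
    exact (hs1 (Φ.symm x)).le.trans (le_max_left _ _)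

omit h𝒜 in
include hℬ in
lemma exists_shrink_right [CompactSpace Y] (h : Matching M 𝒜 ℬ Φ 𝓕 a a' b b') (hb : 0 < b)
    (hb' : 0 < b') {κ : ℝ} (hκ : 0 < κ) :
    ∃ Φ' : Y ≃ₜ Y, Matching M 𝒜 ℬ Φ' 𝓕 a (a' + 2 * b) b κ ∧ CloseOn Φ Φ' 𝓕 (max b b') := by
  obtain ⟨Ψ, hΨ, hc⟩ := h.swap.exists_shrink_left hM hℬ hb hb' hκ
  have h1 := hΨ.swap
  have h2 := hc.swap
  rw [image_symm_image] at h2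
  rw [image_congr fun A hA => hc.image_eq hA, image_symm_image] at h1
  exact ⟨Ψ.symm, h1, h2⟩

include hℬ

lemma exists_match_one [CompactSpace Y] (hMc : LocallyCube M)
    (hgerm : ∀ A ∈ 𝒜, ∀ B ∈ ℬ, ∃ e : OpenPartialHomeomorph Y Y, A ⊆ e.source ∧ e '' A = B)
    (h : Matching M 𝒜 ℬ Φ 𝓕 a a' b b') (ha' : 0 < a') (hb : 0 < b) {κ : ℝ} (hκ : 0 < κ)
    (hbκ : b' ≤ κ) {A : Set Y} (hA : A ∈ 𝒜) (hA' : A ∉ 𝓕) :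
    ∃ (O : Set Y) (g : Y ≃ₜ Y), SuppIn g O ∧ O ⊆ M \ ⋃₀ ((fun A => Φ '' A) '' 𝓕) ∧ Φ '' A ⊆ O ∧
      (∀ x ∈ O, ∃ y ∈ A, dist (Φ.symm x) y < κ) ∧ DistLT O (3 * a' + b) ∧ g '' (Φ '' A) ∈ ℬ := by
  have hs := h.swap
  have hrest := isOpen_rest hM hℬ hs.sub hs.finite
  have hΦA : Φ '' A ⊆ M \ ⋃₀ ((fun A => Φ '' A) '' 𝓕) := by
    rintro _ ⟨x, hx, rfl⟩
    refine ⟨h.supp.apply_mem (h𝒜.subset A hA hx), ?_⟩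
    rintro ⟨_, ⟨A', hA'', rfl⟩, y, hy, hyx⟩
    obtain rfl := Φ.injective hyx
    exact hA' (h𝒜.disjoint A hA A' (h.sub hA'') ⟨y, hx, hy⟩ ▸ hA'')
  obtain ⟨x, hx⟩ := (h𝒜.nontrivial A hA).nonempty
  obtain ⟨P, hxP, hPc, hPM, hPb, hPb', hPu⟩ : ∃ P : Set Y, Φ x ∈ P ∧ IsPreconnected P ∧
      P ⊆ M \ ⋃₀ ((fun A => Φ '' A) '' 𝓕) ∧ DistLT P b ∧ DistLT (Φ.symm '' P) κ ∧
      ∀ W, IsOpen W → P ⊆ W → ∃ u, IsOpen u ∧ u ⊆ W ∧ SatFor ℬ u ∧ Φ x ∈ u := by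
    by_cases hxB : ∃ B ∈ ℬ, Φ x ∈ B
    · obtain ⟨B, hB, hxB⟩ := hxB
      have hB' : B ∉ (fun A => Φ '' A) '' 𝓕 := fun hB' => (hΦA ⟨x, hx, rfl⟩).2 ⟨B, hB', hxB⟩
      refine ⟨B, hxB, hℬ.isPreconnected B hB, subset_rest hℬ hs.sub hB hB', (h.right B hB hB').1,
        (h.right B hB hB').2.mono subset_rfl hbκ, fun W hW hBW => ?_⟩
      obtain ⟨u, hu, huW, hus, h1, -⟩ := hℬ.exists_saturated hW
      exact ⟨u, hu, huW, hus, h1 B hB hBW hxB⟩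
    · push Not at hxB
      refine ⟨{Φ x}, rfl, isPreconnected_singleton, singleton_subset_iff.2 (hΦA ⟨x, hx, rfl⟩), ?_,
        ?_, fun W hW hBW => ?_⟩
      · rintro y rfl z rfl
        rwa [dist_self]
      · rw [image_singleton]
        rintro y rfl z rfl
        rwa [dist_self]
      · obtain ⟨u, hu, huW, hus, -, h1⟩ := hℬ.exists_saturated hW
        exact ⟨u, hu, huW, hus, h1 _ (hBW rfl) hxB⟩
  have hdist : ∀ y ∈ Φ '' A, ∀ z ∈ P, dist y z < a' + b := fun y hy z hz => by
    have h1 := (h.left A hA hA').2 y hy _ ⟨x, hx, rfl⟩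
    have h2 := hPb _ hxP z hz
    linarith [dist_triangle y (Φ x) z]
  have hC : DistLT (Φ '' A ∪ P) (a' + b) := by
    rintro y (hy | hy) z (hz | hz)
    · linarith [(h.left A hA hA').2 y hy z hz]
    · exact hdist y hy z hz
    · rw [dist_comm]
      exact hdist z hz y hy
    · linarith [hPb y hy z hz]
  set N := (M \ ⋃₀ ((fun A => Φ '' A) '' 𝓕)) ∩ Metric.thickening a' (Φ '' A ∪ P) ∩
    Φ.symm ⁻¹' Metric.thickening κ A with hNdef
  have hNo : IsOpen N := (hrest.inter Metric.isOpen_thickening).inter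
    (Metric.isOpen_thickening.preimage Φ.symm.continuous)
  have hNM : N ⊆ M := fun y hy => hy.1.1.1
  have hCN : Φ '' A ∪ P ⊆ N := by
    rintro y hy
    refine ⟨⟨union_subset hΦA hPM hy, Metric.self_subset_thickening ha' _ hy⟩, ?_⟩
    rcases hy with ⟨z, hz, rfl⟩ | hy
    · rw [mem_preimage, Φ.symm_apply_apply]
      exact Metric.self_subset_thickening hκ _ hz
    · refine Metric.mem_thickening_iff.2 ⟨x, hx, ?_⟩
      have := hPb' _ ⟨y, hy, rfl⟩ _ ⟨_, hxP, rfl⟩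
      rwa [Φ.symm_apply_apply] at this
  have hCc : IsPreconnected (Φ '' A ∪ P) :=
    ((h𝒜.isPreconnected A hA).image Φ Φ.continuous.continuousOn).union (Φ x) ⟨x, hx, rfl⟩ hxP hPc
  set O := connectedComponentIn N (Φ x) with hO
  have hON : O ⊆ N := connectedComponentIn_subset _ _
  have hOo : IsOpen O := hMc.isOpen_connectedComponentIn hNo hNM _
  have hCO : Φ '' A ∪ P ⊆ O := hCc.subset_connectedComponentIn (Or.inr hxP) hCN
  have hOM := hON.trans hNM
  obtain ⟨u, hu, huO, hus, hxu⟩ := hPu O hOo fun y hy => hCO (Or.inr hy)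
  obtain ⟨B, hB, hBu⟩ := hℬ.dense u hu (huO.trans hOM) hus ⟨_, hxu⟩
  obtain ⟨e, heA, heB⟩ := hgerm A hA B hB
  let f := e.symm.trans Φ.toOpenPartialHomeomorph
  have hfs : f.source = e.target := by simp [f]
  have hfx : ∀ y, f y = Φ (e.symm y) := fun _ => rfl
  have hfB : ∀ y ∈ A, f (e y) = Φ y := fun y hy => by rw [hfx, e.left_inv (heA hy)]
  obtain ⟨g, hg, hgf⟩ := hMc.exists_match hOo hOM isPreconnected_connectedComponentIn f
    (hℬ.isCompact B hB) (by
      rw [hfs, ← heB]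
      rintro _ ⟨y, hy, rfl⟩
      exact e.map_source (heA hy)) (hBu.trans huO) (by
      rw [← heB]
      rintro _ ⟨y, hy, rfl⟩
      rw [hfB y hy]
      exact hCO (Or.inl ⟨y, hy, rfl⟩))
    fun W hW hBW 𝒱 h𝒱 hW𝒱 => hℬ.exists_local_shrink hM hB hW hBW h𝒱 hW𝒱
  refine ⟨O, g.symm, hg.symm, fun y hy => (hON hy).1.1, subset_union_left.trans hCO, fun y hy => ?_,
    ?_, ?_⟩
  · exact Metric.mem_thickening_iff.1 (hON hy).2
  · intro y hy z hz
    obtain ⟨y', hy', hyy'⟩ := Metric.mem_thickening_iff.1 (hON hy).1.2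
    obtain ⟨z', hz', hzz'⟩ := Metric.mem_thickening_iff.1 (hON hz).1.2
    have h1 := hC y' hy' z' hz'
    have h2 := dist_triangle4_right y z y' z'
    linarith
  · have h1 : Φ '' A = g '' B := by
      rw [← heB, image_image]
      exact image_congr fun y hy => by rw [hgf _ (heB ▸ ⟨y, hy, rfl⟩), hfB y hy]
    rw [h1, image_image]
    simpa using hB

end Matching

end Metric

end Matchings

section BackAndForth

variable {Y : Type*} [MetricSpace Y] {M : Set Y} {𝒜 ℬ : Set (Set Y)}

/-- Any two members are related by a germ of a homeomorphism. -/
def GermRelated (𝒜 ℬ : Set (Set Y)) : Prop :=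
  ∀ A ∈ 𝒜, ∀ B ∈ ℬ, ∃ e : OpenPartialHomeomorph Y Y, A ⊆ e.source ∧ e '' A = B

lemma GermRelated.swap (h : GermRelated 𝒜 ℬ) : GermRelated ℬ 𝒜 := fun B hB A hA => by
  obtain ⟨e, he, rfl⟩ := h A hA B hB
  refine ⟨e.symm, ?_, ?_⟩
  · rintro _ ⟨x, hx, rfl⟩
    exact e.map_source (he hx)
  · rw [image_image, image_congr fun x hx => e.left_inv (he hx)]
    exact image_id' A

/-- Finitely many pairwise disjoint compact sets have positive distance from each other. -/
lemma exists_separation {𝒢 : Set (Set Y)} (hf : 𝒢.Finite) (hc : ∀ A ∈ 𝒢, IsCompact A)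
    (hd : ∀ A ∈ 𝒢, ∀ B ∈ 𝒢, (A ∩ B).Nonempty → A = B) :
    ∃ κ : ℝ, 0 < κ ∧ ∀ A ∈ 𝒢, ∀ B ∈ 𝒢, ∀ x ∈ A, ∀ y ∈ B, dist x y < κ → A = B := by
  have h1 : IsCompact (⋃ p ∈ {p ∈ 𝒢 ×ˢ 𝒢 | p.1 ≠ p.2}, p.1 ×ˢ p.2) :=
    ((hf.prod hf).subset fun p hp => hp.1).isCompact_biUnion
      fun p hp => (hc p.1 hp.1.1).prod (hc p.2 hp.1.2)
  obtain ⟨κ, hκ, H⟩ := h1.exists_pos_le (f := fun p => dist p.1 p.2)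
    (continuous_fst.dist continuous_snd).continuousOn (by
      rintro ⟨x, y⟩ hxy
      obtain ⟨p, hp, hx, hy⟩ := mem_iUnion₂.1 hxy
      refine dist_pos.2 ?_
      intro (hxy' : x = y)
      subst hxy'
      exact hp.2 (hd p.1 hp.1.1 p.2 hp.1.2 ⟨x, hx, hy⟩))
  refine ⟨κ, hκ, fun A hA B hB x hx y hy hxy => ?_⟩
  by_contra hAB
  exact absurd (H (x, y) (mem_biUnion (x := (A, B)) ⟨⟨hA, hB⟩, hAB⟩ ⟨hx, hy⟩)) (not_le.2 hxy)

namespace Matching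

variable {Φ : Y ≃ₜ Y} {𝓕 : Set (Set Y)} {a a' b b' : ℝ} [CompactSpace Y]
  (hM : IsOpen M) (hMc : LocallyCube M) (h𝒜 : PieceFamily M 𝒜) (hℬ : PieceFamily M ℬ)

include hM hMc h𝒜 hℬ

lemma exists_match_large (hgerm : GermRelated 𝒜 ℬ) (h : Matching M 𝒜 ℬ Φ 𝓕 a a' b b')
    (ha' : 0 < a') (hb : 0 < b) {δ κ : ℝ} (hκ : 0 < κ) (hbκ : b' ≤ κ)
    (hsep : ∀ A ∈ {A ∈ 𝒜 | ¬ DistLT A δ}, ∀ B ∈ {A ∈ 𝒜 | ¬ DistLT A δ}, ∀ x ∈ A, ∀ y ∈ B,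
      dist x y < 2 * κ → A = B) (hδ : 0 < δ) (ha : 0 ≤ a) :
    ∃ (Φ' : Y ≃ₜ Y) (𝓕' : Set (Set Y)), 𝓕 ⊆ 𝓕' ∧
      Matching M 𝒜 ℬ Φ' 𝓕' δ (a' + 2 * (3 * a' + b)) b (b' + 2 * (a + 2 * κ)) ∧
      CloseOn Φ Φ' 𝓕 (max (3 * a' + b) (a + 2 * κ)) := by
  classical
  set 𝒢 := {A ∈ 𝒜 | ¬ DistLT A δ ∧ A ∉ 𝓕} with h𝒢
  have h𝒢f : 𝒢.Finite := (h𝒜.null δ hδ).subset fun A hA => ⟨hA.1, hA.2.1⟩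
  choose! O g hgO hOM hAO hOκ hOs hgB using fun A (hA : A ∈ 𝒢) =>
    h.exists_match_one hM h𝒜 hℬ hMc hgerm ha' hb hκ hbκ hA.1 hA.2.2
  obtain ⟨G, hG, hGg⟩ := exists_combine h𝒢f.toFinset O g
    (fun A hA => hgO A (h𝒢f.mem_toFinset.1 hA)) (by
      rintro A hA B hB ⟨x, hxA, hxB⟩
      rw [h𝒢f.mem_toFinset] at hA hB
      obtain ⟨y, hy, hxy⟩ := hOκ A hA x hxA
      obtain ⟨z, hz, hxz⟩ := hOκ B hB x hxB
      exact hsep A ⟨hA.1, hA.2.1⟩ B ⟨hB.1, hB.2.1⟩ y hy z hz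
        (by linarith [dist_triangle_left y z (Φ.symm x)]))
  simp only [h𝒢f.mem_toFinset] at hG hGg
  have hmove : ∀ x, G x ≠ x → ∃ A ∈ 𝒢, x ∈ O A ∧ G x ∈ O A := fun x hx => by
    have hx' : x ∈ ⋃ i ∈ 𝒢, O i := by
      by_contra h'
      exact hx (hG x h')
    obtain ⟨A, hA, hxA⟩ := mem_iUnion₂.1 hx'
    refine ⟨A, hA, hxA, ?_⟩
    rw [hGg A hA x hxA]
    exact (hgO A hA).apply_mem hxA
  have hd1 : ∀ x, dist (G x) x ≤ 3 * a' + b := fun x => by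
    by_cases hx : G x = x
    · rw [hx, dist_self]
      positivity
    · obtain ⟨A, hA, h1, h2⟩ := hmove x hx
      exact (hOs A hA _ h2 _ h1).le
  have hd2 : ∀ x, dist (Φ.symm (G x)) (Φ.symm x) ≤ a + 2 * κ := fun x => by
    by_cases hx : G x = x
    · rw [hx, dist_self]
      positivity
    · obtain ⟨A, hA, h1, h2⟩ := hmove x hx
      obtain ⟨y, hy, hxy⟩ := hOκ A hA _ h1
      obtain ⟨z, hz, hxz⟩ := hOκ A hA _ h2
      have h3 := (h.left A hA.1 hA.2.2).1 z hz y hy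
      have h4 := dist_triangle4_right (Φ.symm (G x)) (Φ.symm x) z y
      linarith
  have hGfix : ∀ A ∈ 𝓕, ∀ x ∈ A, (Φ.trans G) x = Φ x := fun A hA x hx => by
    refine hG _ fun h' => ?_
    obtain ⟨B, hB, hxB⟩ := mem_iUnion₂.1 h'
    exact (hOM B hB hxB).2 ⟨_, ⟨A, hA, rfl⟩, x, hx, rfl⟩
  have hGB : ∀ A ∈ 𝒢, (Φ.trans G) '' A ∈ ℬ := fun A hA => by
    have h1 : (Φ.trans G) '' A = g A '' (Φ '' A) := by
      rw [image_image]
      exact image_congr fun x hx => hGg A hA _ (hAO A hA ⟨x, hx, rfl⟩)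
    rw [h1]
    exact hgB A hA
  refine ⟨Φ.trans G, 𝓕 ∪ 𝒢, subset_union_left, ⟨h.supp.trans (hG.mono ?_), h.finite.union h𝒢f,
    union_subset h.sub fun A hA => hA.1, ?_, fun A hA hA' => ⟨?_, ?_⟩, fun B hB hB' => ?_⟩,
    ⟨fun x => ?_, fun x => ?_, hGfix⟩⟩
  · exact iUnion₂_subset fun A hA => (hOM A hA).trans sdiff_subset
  · rintro A (hA | hA)
    · rw [image_congr (hGfix A hA)]
      exact h.maps A hA
    · exact hGB A hA
  · by_contra hAs
    exact hA' (Or.inr ⟨hA, hAs, fun h' => hA' (Or.inl h')⟩)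
  · have h1 := (h.left A hA fun h' => hA' (Or.inl h')).2.image hd1
    rw [image_image] at h1
    exact h1
  · have hB'' : B ∉ (fun A => Φ '' A) '' 𝓕 := by
      rintro ⟨A, hA, rfl⟩
      exact hB' ⟨A, Or.inl hA, image_congr (hGfix A hA)⟩
    refine ⟨(h.right B hB hB'').1, ?_⟩
    have h1 := (h.right B hB hB'').2.image (g := fun x => Φ.symm (G.symm (Φ x)))
      (c := a + 2 * κ) fun x => by
        have := hd2 (G.symm (Φ x))
        rw [G.apply_symm_apply, Φ.symm_apply_apply, dist_comm] at this
        exact this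
    rw [image_image] at h1
    simp only [Homeomorph.apply_symm_apply] at h1
    exact h1
  · rw [dist_comm]
    exact (hd1 _).trans (le_max_left _ _)
  · have := hd2 (G.symm x)
    rw [G.apply_symm_apply] at this
    exact this.trans (le_max_right _ _)

lemma exists_match_left (hgerm : GermRelated 𝒜 ℬ) {ε : ℝ} (h : Matching M 𝒜 ℬ Φ 𝓕 ε ε ε ε)
    (hε : 0 < ε) {δ : ℝ} (hδ : 0 < δ) :
    ∃ (Φ' : Y ≃ₜ Y) (𝓕' : Set (Set Y)), 𝓕 ⊆ 𝓕' ∧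
      Matching M 𝒜 ℬ Φ' 𝓕' δ (23 * ε) (23 * ε) (23 * ε) ∧ CloseOn Φ Φ' 𝓕 (11 * ε) := by
  obtain ⟨κ, hκ, hsep⟩ := exists_separation (h𝒜.null δ hδ) (fun A hA => h𝒜.isCompact A hA.1)
    fun A hA B hB => h𝒜.disjoint A hA.1 B hB.1
  have hm : 0 < min (κ / 2) ε := lt_min (by linarith) hε
  have hm1 := min_le_left (κ / 2) ε
  have hm2 := min_le_right (κ / 2) ε
  obtain ⟨Φ₁, h₁, hc₁⟩ := h.exists_shrink_right hM hℬ hε hε hm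
  obtain ⟨Φ₂, 𝓕₂, hs, h₂, hc₂⟩ := h₁.exists_match_large hM hMc h𝒜 hℬ hgerm (by linarith) hε hm
    le_rfl (δ := δ) (fun A hA B hB x hx y hy hxy => hsep A hA B hB x hx y hy (by linarith)) hδ hε.le
  refine ⟨Φ₂, 𝓕₂, hs, h₂.mono le_rfl (by linarith) (by linarith) (by linarith),
    (hc₁.trans hc₂ subset_rfl).mono ?_⟩
  have h3 : max (3 * (ε + 2 * ε) + ε) (ε + 2 * min (κ / 2) ε) ≤ 10 * ε :=
    max_le (by linarith) (by linarith)
  rw [max_self]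
  linarith

lemma exists_match_right (hgerm : GermRelated 𝒜 ℬ) {ε : ℝ} (h : Matching M 𝒜 ℬ Φ 𝓕 ε ε ε ε)
    (hε : 0 < ε) {δ : ℝ} (hδ : 0 < δ) :
    ∃ (Φ' : Y ≃ₜ Y) (𝓕' : Set (Set Y)), 𝓕 ⊆ 𝓕' ∧
      Matching M 𝒜 ℬ Φ' 𝓕' (23 * ε) (23 * ε) δ (23 * ε) ∧ CloseOn Φ Φ' 𝓕 (11 * ε) := by
  obtain ⟨Ψ, 𝓕', hs, hΨ, hc⟩ := h.swap.exists_match_left hM hMc hℬ h𝒜 hgerm.swap hε hδ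
  have h2 := hc.swap
  rw [image_symm_image] at h2
  refine ⟨Ψ.symm, _, ?_, hΨ.swap, h2⟩
  intro A hA
  refine ⟨_, hs ⟨A, hA, rfl⟩, ?_⟩
  change Ψ '' _ = A
  rw [hc.image_eq ⟨A, hA, rfl⟩]
  simp [image_image]

/-- The inductive step of the back-and-forth construction. -/
lemma exists_step (hgerm : GermRelated 𝒜 ℬ) {ε : ℝ} (h : Matching M 𝒜 ℬ Φ 𝓕 ε ε ε ε)
    (hε : 0 < ε) :
    ∃ (Φ' : Y ≃ₜ Y) (𝓕' : Set (Set Y)), 𝓕 ⊆ 𝓕' ∧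
      Matching M 𝒜 ℬ Φ' 𝓕' (ε / 2) (ε / 2) (ε / 2) (ε / 2) ∧ CloseOn Φ Φ' 𝓕 (1400 * ε) := by
  have hδ : 0 < ε / 6 := by linarith
  obtain ⟨Φ₁, 𝓕₁, hs₁, h₁, hc₁⟩ := h.exists_match_left hM hMc h𝒜 hℬ hgerm hε hδ
  obtain ⟨Φ₂, 𝓕₂, hs₂, h₂, hc₂⟩ := (h₁.mono (c := 23 * ε) (by linarith) le_rfl le_rfl
    le_rfl).exists_match_right hM hMc h𝒜 hℬ hgerm (by linarith) hδ
  have h₂' : Matching M 𝒜 ℬ Φ₂ 𝓕₂ (ε / 6) (23 * (23 * ε)) (ε / 6) (23 * (23 * ε)) :=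
    { h₂ with
      left := fun A hA hA' => ⟨(h₁.left A hA fun h' => hA' (hs₂ h')).1, (h₂.left A hA hA').2⟩ }
  obtain ⟨Φ₃, h₃, hc₃⟩ := h₂'.exists_shrink_left hM h𝒜 hδ (by linarith) hδ
  obtain ⟨Φ₄, h₄, hc₄⟩ := h₃.exists_shrink_right hM hℬ hδ (by linarith) hδ
  refine ⟨Φ₄, 𝓕₂, hs₁.trans hs₂, h₄.mono (by linarith) (by linarith) (by linarith) (by linarith),
    (hc₁.trans (hc₂.trans (hc₃.trans hc₄ subset_rfl) hs₂) hs₁).mono ?_⟩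
  rw [max_eq_right (by linarith), max_eq_right (by linarith)]
  linarith

end Matching

/-- Two dense piece families related by germs are equivalent under a homeomorphism. -/
theorem exists_homeomorph_of_pieceFamily [CompactSpace Y] (hM : IsOpen M) (hMc : LocallyCube M)
    (h𝒜 : PieceFamily M 𝒜) (hℬ : PieceFamily M ℬ) (hgerm : GermRelated 𝒜 ℬ) :
    ∃ Φ : Y ≃ₜ Y, SuppIn Φ M ∧ (fun A => Φ '' A) '' 𝒜 = ℬ := by
  set E := Metric.diam (univ : Set Y) + 1 with hE
  have hE0 : 0 < E := by positivity
  have hEs : ∀ A : Set Y, DistLT A E := fun A x _ y _ =>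
    (Metric.dist_le_diam_of_mem isCompact_univ.isBounded (mem_univ x) (mem_univ y)).trans_lt
      (lt_add_one _)
  have hpos : ∀ n : ℕ, 0 < E / 2 ^ n := fun n => by positivity
  obtain ⟨u, hu0, hu, hstep⟩ := exists_seq_of_step
    (P := fun n (s : (Y ≃ₜ Y) × Set (Set Y)) =>
      Matching M 𝒜 ℬ s.1 s.2 (E / 2 ^ n) (E / 2 ^ n) (E / 2 ^ n) (E / 2 ^ n))
    (R := fun n s s' => s.2 ⊆ s'.2 ∧ CloseOn s.1 s'.1 s.2 (1400 * (E / 2 ^ n)))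
    (s₀ := (Homeomorph.refl Y, ∅))
    ⟨SuppIn.refl M, finite_empty, empty_subset _, fun A hA => hA.elim,
      fun A _ _ => by rw [pow_zero, div_one]; exact ⟨hEs A, hEs _⟩,
      fun B _ _ => by rw [pow_zero, div_one]; exact ⟨hEs B, hEs _⟩⟩
    (fun n s hs => by
      obtain ⟨Φ', 𝓕', hs', h, hc⟩ := hs.exists_step hM hMc h𝒜 hℬ hgerm (hpos n)
      refine ⟨(Φ', 𝓕'), ?_, hs', hc⟩
      have h2 : E / 2 ^ n / 2 = E / 2 ^ (n + 1) := by
        rw [pow_succ, div_div]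
      rwa [h2] at h)
  obtain ⟨Ψ, hΨ⟩ := exists_homeomorph_limit (fun n => (u n).1) (B := 1400 * E)
    (fun n x => by
      have := (hstep n).2.dist_le x
      rwa [← mul_div_assoc] at this)
    (fun n x => by
      have := (hstep n).2.dist_symm_le x
      rwa [← mul_div_assoc] at this)
  have hstab : ∀ n, ∀ A ∈ (u n).2, ∀ k, A ∈ (u (n + k)).2 ∧
      ∀ x ∈ A, (u (n + k)).1 x = (u n).1 x := by
    intro n A hA k
    induction k with
    | zero => exact ⟨hA, fun _ _ => rfl⟩
    | succ k ih =>
      exact ⟨(hstep (n + k)).1 ih.1, fun x hx =>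
        ((hstep (n + k)).2.eqOn A ih.1 x hx).trans (ih.2 x hx)⟩
  have hΨA : ∀ n, ∀ A ∈ (u n).2, Ψ '' A = (u n).1 '' A := fun n A hA => by
    refine image_congr fun x hx => tendsto_nhds_unique (hΨ x).1 (tendsto_const_nhds.congr' ?_)
    filter_upwards [Filter.eventually_ge_atTop n] with m hm
    obtain ⟨k, rfl⟩ := Nat.exists_eq_add_of_le hm
    exact ((hstab n A hA k).2 x hx).symm
  have hsmall : ∀ A : Set Y, A.Nontrivial → ∃ n, ¬ DistLT A (E / 2 ^ n) := by
    rintro A ⟨x, hx, y, hy, hxy⟩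
    obtain ⟨n, hn⟩ := exists_pow_lt_of_lt_one (div_pos (dist_pos.2 hxy) hE0) one_half_lt_one
    refine ⟨n, fun h => ?_⟩
    have h1 := h x hx y hy
    rw [lt_div_iff₀ hE0] at hn
    rw [one_div, inv_pow, inv_mul_eq_div] at hn
    linarith
  refine ⟨Ψ, fun x hx => ?_, Subset.antisymm ?_ ?_⟩
  · refine tendsto_nhds_unique (hΨ x).1 (tendsto_const_nhds.congr fun n => ?_)
    exact ((hu n).supp x hx).symm
  · rintro _ ⟨A, hA, rfl⟩
    obtain ⟨n, hn⟩ := hsmall A (h𝒜.nontrivial A hA)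
    have hAn : A ∈ (u n).2 := by
      by_contra h
      exact hn ((hu n).left A hA h).1
    change Ψ '' A ∈ ℬ
    rw [hΨA n A hAn]
    exact (hu n).maps A hAn
  · intro B hB
    obtain ⟨n, hn⟩ := hsmall B (hℬ.nontrivial B hB)
    have hBn : B ∈ (fun A => (u n).1 '' A) '' (u n).2 := by
      by_contra h
      exact hn ((hu n).right B hB h).1
    obtain ⟨A, hA, rfl⟩ := hBn
    exact ⟨A, (hu n).sub hA, hΨA n A hA⟩

end BackAndForth

section HausdorffPart

variable {X : Type*} [TopologicalSpace X]

/-- The interior of the set of points that can be separated from every other point. -/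
def hausdorffPart (X : Type*) [TopologicalSpace X] : Set X :=
  interior {x | ∀ y, y ≠ x → Disjoint (𝓝 x) (𝓝 y)}

lemma isOpen_hausdorffPart : IsOpen (hausdorffPart X) := isOpen_interior

lemma disjoint_nhds_of_mem_hausdorffPart {x y : X} (hx : x ∈ hausdorffPart X) (h : y ≠ x) :
    Disjoint (𝓝 x) (𝓝 y) := interior_subset hx y h

lemma Homeomorph.mem_hausdorffPart {Y : Type*} [TopologicalSpace Y] (h : X ≃ₜ Y) {x : X}
    (hx : x ∈ hausdorffPart X) : h x ∈ hausdorffPart Y := by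
  have h1 : h '' hausdorffPart X ⊆ {x | ∀ y, y ≠ x → Disjoint (𝓝 x) (𝓝 y)} := by
    rintro _ ⟨x, hx, rfl⟩ y hy
    have h2 := disjoint_nhds_of_mem_hausdorffPart hx (y := h.symm y) fun h' =>
      hy (by rw [← h', h.apply_symm_apply])
    rw [← h.map_nhds_eq, ← h.apply_symm_apply y, ← h.map_nhds_eq (h.symm y)]
    exact (Filter.disjoint_map h.injective).2 h2
  exact interior_maximal h1 (h.isOpenMap _ isOpen_hausdorffPart) ⟨x, hx, rfl⟩

lemma compl_mem_nhds_of_isCompact {K : Set X} (hK : IsCompact K) {x : X}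
    (h : ∀ y ∈ K, Disjoint (𝓝 y) (𝓝 x)) : Kᶜ ∈ 𝓝 x := by
  have h1 := hK.disjoint_nhdsSet_left.2 h
  obtain ⟨s, hs, t, ht, hst⟩ := Filter.disjoint_iff.1 h1
  exact Filter.mem_of_superset ht fun y hy hyK =>
    hst.le_bot ⟨subset_of_mem_nhdsSet hs hyK, hy⟩

lemma isClosed_of_isCompact_of_subset_hausdorffPart {K : Set X} (hK : IsCompact K)
    (hKX : K ⊆ hausdorffPart X) : IsClosed K := by
  rw [← isOpen_compl_iff, isOpen_iff_mem_nhds]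
  exact fun x hx => compl_mem_nhds_of_isCompact hK fun y hy =>
    disjoint_nhds_of_mem_hausdorffPart (hKX hy) fun h => hx (h ▸ hy)

lemma separatedNhds_of_isCompact {K L : Set X} (hK : IsCompact K) (hL : IsCompact L)
    (hKX : K ⊆ hausdorffPart X) (hKL : Disjoint K L) : SeparatedNhds K L := by
  rw [separatedNhds_iff_disjoint, hK.disjoint_nhdsSet_left]
  exact fun x hx => hL.disjoint_nhdsSet_right.2 fun y hy =>
    disjoint_nhds_of_mem_hausdorffPart (hKX hx) fun h => hKL.le_bot ⟨hx, h ▸ hy⟩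

/-- A locally finite cover by open separable metrizable sets. -/
lemma exists_locallyFinite_cover [ParacompactSpace X] (hX : LocallyCube (univ : Set X)) :
    ∃ W : X → Set X, (∀ i, IsOpen (W i)) ∧ ⋃ i, W i = univ ∧ LocallyFinite W ∧
      ∀ i, ∃ e : OpenPartialHomeomorph X (ℕ → unitInterval), W i ⊆ e.source := by
  choose e he using fun x => hX x (mem_univ x)
  obtain ⟨W, hW, hWu, hWl, hWe⟩ := precise_refinement (fun x => (e x).source)
    (fun x => (e x).open_source) (eq_univ_of_forall fun x => mem_iUnion.2 ⟨x, he x⟩)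
  exact ⟨W, hW, hWu, hWl, fun i => ⟨e i, hWe i⟩⟩

lemma disjoint_nhds_of_mem_source {Y : Type*} [TopologicalSpace Y] [T2Space Y]
    (e : OpenPartialHomeomorph X Y) {x y : X}
    (hx : x ∈ e.source) (hy : y ∈ e.source) (hxy : x ≠ y) : Disjoint (𝓝 x) (𝓝 y) := by
  have h1 : Disjoint (𝓝 (e x)) (𝓝 (e y)) :=
    disjoint_nhds_nhds.2 fun h => hxy (e.injOn hx hy h)
  exact (e.continuousAt hx).disjoint h1 (e.continuousAt hy)

end HausdorffPart

section SecondCountable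

variable {X : Type*} [TopologicalSpace X]

lemma hausdorffPart_nonempty [ParacompactSpace X] [Nonempty X]
    (hX : LocallyCube (univ : Set X)) : (hausdorffPart X).Nonempty := by
  obtain ⟨W, hW, hWu, hWl, hWe⟩ := exists_locallyFinite_cover hX
  have hF : IsClosed (⋃ i, frontier (W i)) :=
    (hWl.closure.subset fun i => frontier_subset_closure).isClosed_iUnion
      fun i => isClosed_frontier
  have h1 : (⋃ i, frontier (W i))ᶜ ⊆ hausdorffPart X := by
    refine interior_maximal (fun x hx y hy => ?_) hF.isOpen_compl
    obtain ⟨i, hi⟩ := mem_iUnion.1 (hWu ▸ mem_univ y)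
    by_cases hxi : x ∈ W i
    · obtain ⟨e, he⟩ := hWe i
      exact disjoint_nhds_of_mem_source e (he hxi) (he hi) hy.symm
    · have h2 : x ∉ closure (W i) := fun h =>
        hx (mem_iUnion.2 ⟨i, h, by rwa [(hW i).interior_eq]⟩)
      exact Filter.disjoint_iff.2 ⟨_, isClosed_closure.isOpen_compl.mem_nhds h2, _,
        (hW i).mem_nhds hi, disjoint_compl_left.mono_right subset_closure⟩
  have h3 : ∀ J : Set X, J.Finite → interior (⋃ i ∈ J, frontier (W i)) = ∅ := by
    intro J hJ
    induction J, hJ using Set.Finite.induction_on with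
    | empty => simp
    | insert _ _ ih =>
      rw [biUnion_insert, interior_union_isClosed_of_interior_empty isClosed_frontier ih]
      rw [← frontier_compl]
      exact interior_frontier (hW _).isClosed_compl
  obtain ⟨x⟩ := ‹Nonempty X›
  obtain ⟨N, hN, hNf⟩ := hWl x
  by_contra hne
  have h4 : interior N ⊆ ⋃ i ∈ {i | (W i ∩ N).Nonempty}, frontier (W i) := by
    intro y hy
    by_contra hyF
    refine hne ⟨y, h1 fun hy' => hyF ?_⟩
    obtain ⟨i, hi⟩ := mem_iUnion.1 hy'
    obtain ⟨z, hz, hz'⟩ := mem_closure_iff_nhds.1 hi.1 N (mem_interior_iff_mem_nhds.1 hy)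
    exact mem_biUnion (x := i) ⟨z, hz', hz⟩ hi
  have h5 := interior_maximal h4 isOpen_interior
  rw [h3 _ hNf] at h5
  exact h5 (mem_interior_iff_mem_nhds.2 hN)

/-- Components of a paracompact locally cubical space are second countable. -/
lemma exists_countable_basis_connectedComponent [ParacompactSpace X]
    (hX : LocallyCube (univ : Set X)) (x : X) :
    ∃ 𝒪 : Set (Set X), 𝒪.Countable ∧ (∀ O ∈ 𝒪, IsOpen O) ∧
      ∀ y ∈ connectedComponent x, ∀ N ∈ 𝓝 y, ∃ O ∈ 𝒪, y ∈ O ∧ O ⊆ N := by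
  obtain ⟨W, hW, hWu, hWl, hWe⟩ := exists_locallyFinite_cover hX
  choose e he using hWe
  let ℬ := TopologicalSpace.countableBasis (ℕ → unitInterval)
  have hopen : ∀ i, ∀ b ∈ ℬ, IsOpen (W i ∩ e i ⁻¹' b) := fun i b hb =>
    ((e i).continuousOn.mono (he i)).isOpen_inter_preimage (hW i)
      (TopologicalSpace.isOpen_of_mem_countableBasis hb)
  have hbasis : ∀ i, ∀ y ∈ W i, ∀ N ∈ 𝓝 y, ∃ b ∈ ℬ, y ∈ W i ∩ e i ⁻¹' b ∧ W i ∩ e i ⁻¹' b ⊆ N := by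
    intro i y hy N hN
    have h1 : (e i).target ∩ (e i).symm ⁻¹' N ∈ 𝓝 (e i y) := by
      refine Filter.inter_mem ((e i).open_target.mem_nhds ((e i).map_source (he i hy))) ?_
      refine ((e i).symm.continuousAt ((e i).map_source (he i hy))).preimage_mem_nhds ?_
      rwa [(e i).left_inv (he i hy)]
    obtain ⟨b, hb, hyb, hbN⟩ :=
      (TopologicalSpace.isBasis_countableBasis _).mem_nhds_iff.1 h1
    refine ⟨b, hb, ⟨hy, hyb⟩, fun z hz => ?_⟩
    have := (hbN hz.2).2
    rwa [mem_preimage, (e i).left_inv (he i hz.1)] at this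
  have hadj : ∀ i, {j | (W j ∩ W i).Nonempty}.Countable := by
    intro i
    have h1 : {j | (W j ∩ W i).Nonempty} ⊆
        ⋃ b ∈ {b ∈ ℬ | {j | (W j ∩ (W i ∩ e i ⁻¹' b)).Nonempty}.Finite},
          {j | (W j ∩ (W i ∩ e i ⁻¹' b)).Nonempty} := by
      rintro j ⟨y, hyj, hyi⟩
      obtain ⟨N, hN, hNf⟩ := hWl y
      obtain ⟨b, hb, hyb, hbN⟩ := hbasis i y hyi N hN
      exact mem_biUnion (x := b)
        ⟨hb, hNf.subset fun k hk => hk.mono (inter_subset_inter_right _ hbN)⟩ ⟨y, hyj, hyb⟩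
    refine Countable.mono h1 (Countable.biUnion ?_ fun b hb => hb.2.countable)
    exact (TopologicalSpace.countable_countableBasis _).mono (sep_subset _ _)
  obtain ⟨i₀, hi₀⟩ := mem_iUnion.1 (hWu ▸ mem_univ x)
  let S : ℕ → Set X := fun n => Nat.rec {i₀} (fun _ s => ⋃ i ∈ s, {j | (W j ∩ W i).Nonempty}) n
  have hS : ∀ n, (S n).Countable := by
    intro n
    induction n with
    | zero => exact countable_singleton i₀
    | succ n ih => exact ih.biUnion fun i _ => hadj i
  have hSs : ∀ n, ∀ i ∈ S n, ∀ j, (W j ∩ W i).Nonempty → j ∈ S (n + 1) := fun n i hi j hj =>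
    mem_biUnion (x := i) hi hj
  have hT : IsClopen (⋃ j ∈ ⋃ n, S n, W j) := by
    refine ⟨⟨?_⟩, isOpen_biUnion fun j _ => hW j⟩
    rw [isOpen_iff_mem_nhds]
    intro y hy
    obtain ⟨j, hj⟩ := mem_iUnion.1 (hWu ▸ mem_univ y)
    refine Filter.mem_of_superset ((hW j).mem_nhds hj) fun z hz hz' => hy ?_
    obtain ⟨i, hi, hzi⟩ := mem_iUnion₂.1 hz'
    obtain ⟨n, hn⟩ := mem_iUnion.1 hi
    exact mem_biUnion (x := j) (mem_iUnion.2 ⟨n + 1, hSs n i hn j ⟨z, hz, hzi⟩⟩) hj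
  have hxT : connectedComponent x ⊆ ⋃ j ∈ ⋃ n, S n, W j :=
    hT.connectedComponent_subset
      (mem_biUnion (x := i₀) (mem_iUnion.2 ⟨0, mem_singleton i₀⟩) hi₀)
  refine ⟨⋃ j ∈ ⋃ n, S n, (fun b => W j ∩ e j ⁻¹' b) '' ℬ, ?_, ?_, ?_⟩
  · exact (countable_iUnion hS).biUnion fun j _ =>
      (TopologicalSpace.countable_countableBasis _).image _
  · intro O hO
    obtain ⟨j, hj, b, hb, rfl⟩ := mem_iUnion₂.1 hO
    exact hopen j b hb
  · intro y hy N hN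
    obtain ⟨j, hj, hyj⟩ := mem_iUnion₂.1 (hxT hy)
    obtain ⟨b, hb, h1, h2⟩ := hbasis j y hyj N hN
    exact ⟨_, mem_biUnion (x := j) hj ⟨b, hb, rfl⟩, h1, h2⟩

/-- Every neighborhood contains a connected open neighborhood. -/
lemma LocallyCube.exists_isPreconnected {M : Set X} (hX : LocallyCube M) {x : X} (hx : x ∈ M)
    {N : Set X} (hN : N ∈ 𝓝 x) :
    ∃ G, IsOpen G ∧ IsPreconnected G ∧ x ∈ G ∧ G ⊆ N := by
  obtain ⟨e, hxe⟩ := hX x hx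
  have h1 : e.target ∩ e.symm ⁻¹' N ∈ 𝓝 (e x) := by
    refine Filter.inter_mem (e.open_target.mem_nhds (e.map_source hxe)) ?_
    refine (e.symm.continuousAt (e.map_source hxe)).preimage_mem_nhds ?_
    rwa [e.left_inv hxe]
  obtain ⟨n, -, r, hr, hE⟩ := exists_coordBox_subset h1 0
  have hV : coordBox (e x) n r ⊆ e.target ∩ e.symm ⁻¹' N := fun y hy =>
    hE fun i hi => (hy i hi).le
  refine ⟨e.symm '' coordBox (e x) n r,
    e.symm.isOpen_image_of_subset_source isOpen_coordBox (hV.trans inter_subset_left),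
    isPreconnected_coordBox.image _ (e.symm.continuousOn.mono (hV.trans inter_subset_left)),
    ⟨e x, mem_coordBox_self hr, e.left_inv hxe⟩, ?_⟩
  rintro _ ⟨q, hq, rfl⟩
  exact (hV hq).2

lemma LocallyCube.isOpen_connectedComponent (hX : LocallyCube (univ : Set X)) (x : X) :
    IsOpen (connectedComponent x) := by
  rw [isOpen_iff_mem_nhds]
  intro y hy
  obtain ⟨G, hG, hGc, hyG, -⟩ := hX.exists_isPreconnected (mem_univ y) Filter.univ_mem
  rw [connectedComponent_eq hy]
  exact Filter.mem_of_superset (hG.mem_nhds hyG) (hGc.subset_connectedComponent hyG)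

lemma LocallyCube.isClosed_singleton (hX : LocallyCube (univ : Set X)) (x : X) :
    IsClosed {x} := by
  rw [← isOpen_compl_iff, isOpen_iff_mem_nhds]
  intro y hy
  obtain ⟨e, hye⟩ := hX y (mem_univ y)
  by_cases hx : x ∈ e.source
  · obtain ⟨s, hs, t, ht, hst⟩ :=
      Filter.disjoint_iff.1 (disjoint_nhds_of_mem_source e hye hx hy)
    exact Filter.mem_of_superset hs fun z hz (hzx : z = x) =>
      hst.le_bot ⟨hz, hzx ▸ mem_of_mem_nhds ht⟩
  · exact Filter.mem_of_superset (e.open_source.mem_nhds hye)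
      fun z hz (hzx : z = x) => hx (hzx ▸ hz)

lemma LocallyCube.nontrivial_of_mem_nhds {M : Set X} (hX : LocallyCube M) {x : X} (hx : x ∈ M)
    {N : Set X} (hN : N ∈ 𝓝 x) : N.Nontrivial := by
  obtain ⟨e, hxe⟩ := hX x hx
  have h1 : e.target ∩ e.symm ⁻¹' N ∈ 𝓝 (e x) := by
    refine Filter.inter_mem (e.open_target.mem_nhds (e.map_source hxe)) ?_
    refine (e.symm.continuousAt (e.map_source hxe)).preimage_mem_nhds ?_
    rwa [e.left_inv hxe]
  have h2 : ∀ᶠ t in 𝓝 (e x 0), Function.update (e x) 0 t ∈ e.target ∩ e.symm ⁻¹' N := by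
    have h3 : Continuous fun t : unitInterval => Function.update (e x) 0 t :=
      continuous_const.update 0 continuous_id
    have h4 := h3.continuousAt (x := e x 0)
    rw [ContinuousAt, Function.update_eq_self] at h4
    exact h4 h1
  obtain ⟨t, ht, htx⟩ := ((h2.filter_mono nhdsWithin_le_nhds).and
    (self_mem_nhdsWithin (s := {e x 0}ᶜ))).exists
  refine ⟨_, ht.2, x, mem_of_mem_nhds hN, fun h => htx ?_⟩
  have h5 := e.right_inv ht.1
  rw [h] at h5
  rw [h5]
  simp

end SecondCountable

section Bump

variable {X : Type*} [TopologicalSpace X]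

/-- A function with compact support inside an open Hausdorff set, continuous on that set. -/
structure Bump (X : Type*) [TopologicalSpace X] where
  toFun : X → unitInterval
  dom : Set X
  supp : Set X
  isOpen_dom : IsOpen dom
  disjoint_nhds : ∀ x ∈ dom, ∀ y ∈ dom, x ≠ y → Disjoint (𝓝 x) (𝓝 y)
  isCompact_supp : IsCompact supp
  supp_subset : supp ⊆ dom
  continuousAt_of_mem : ∀ x ∈ dom, ContinuousAt toFun x
  eq_zero : ∀ x ∉ supp, toFun x = 0

lemma LocallyCube.exists_bump {M : Set X} (hX : LocallyCube M) {x : X} (hx : x ∈ M)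
    {N : Set X} (hN : N ∈ 𝓝 x) : ∃ b : Bump X, b.dom ⊆ N ∧ ∀ᶠ y in 𝓝 x, b.toFun y = 1 := by
  classical
  let _ : MetricSpace (ℕ → unitInterval) := TopologicalSpace.metrizableSpaceMetric _
  obtain ⟨e, hxe⟩ := hX x hx
  have h1 : e.target ∩ e.symm ⁻¹' (interior N) ∈ 𝓝 (e x) := by
    refine Filter.inter_mem (e.open_target.mem_nhds (e.map_source hxe)) ?_
    refine (e.symm.continuousAt (e.map_source hxe)).preimage_mem_nhds ?_
    rw [e.left_inv hxe]
    exact interior_mem_nhds.2 hN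
  obtain ⟨r, hr, hrE⟩ := Metric.nhds_basis_closedBall.mem_iff.1 h1
  let g : (ℕ → unitInterval) → unitInterval := fun y =>
    projIcc 0 1 zero_le_one (2 - 2 * dist y (e x) / r)
  have hg : Continuous g := by
    refine continuous_projIcc.comp ?_
    fun_prop
  have hg0 : ∀ y ∉ Metric.closedBall (e x) r, g y = 0 := fun y hy => by
    have h2 : r < dist y (e x) := not_le.1 hy
    refine projIcc_of_le_left _ ?_
    have : 2 ≤ 2 * dist y (e x) / r := (le_div_iff₀ hr).2 (by linarith)
    linarith
  refine ⟨⟨fun y => if y ∈ e.source then g (e y) else 0, e.source ∩ interior N,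
    e.symm '' Metric.closedBall (e x) r, e.open_source.inter isOpen_interior, ?_, ?_, ?_, ?_, ?_⟩,
    inter_subset_right.trans interior_subset, ?_⟩
  · exact fun y hy z hz => disjoint_nhds_of_mem_source e hy.1 hz.1
  · exact Metric.isClosed_closedBall.isCompact.image_of_continuousOn
      (e.symm.continuousOn.mono fun y hy => (hrE hy).1)
  · rintro _ ⟨y, hy, rfl⟩
    exact ⟨e.map_target (hrE hy).1, (hrE hy).2⟩
  · intro y hy
    have h2 : ContinuousAt (fun y => g (e y)) y := hg.continuousAt.comp (e.continuousAt hy.1)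
    refine h2.congr ?_
    filter_upwards [e.open_source.mem_nhds hy.1] with z hz
    exact (if_pos hz).symm
  · intro y hy
    by_cases hye : y ∈ e.source
    · rw [if_pos hye]
      exact hg0 _ fun h => hy ⟨e y, h, e.left_inv hye⟩
    · exact if_neg hye
  · have h2 : ∀ᶠ y in 𝓝 x, dist (e y) (e x) < r / 2 :=
      (e.continuousAt hxe).eventually (Metric.ball_mem_nhds _ (by linarith))
    filter_upwards [h2, e.open_source.mem_nhds hxe] with y hy hye
    rw [if_pos hye]
    refine projIcc_of_right_le _ ?_
    have : 2 * dist (e y) (e x) / r ≤ 1 := (div_le_iff₀ hr).2 (by linarith)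
    linarith

namespace Bump

variable (b : Bump X)

lemma one_mem_supp {x : X} (h : b.toFun x = 1) : x ∈ b.supp := by
  by_contra hx
  rw [b.eq_zero x hx] at h
  exact zero_ne_one h

lemma continuousAt {x : X} (hx : x ∈ hausdorffPart X ∪ b.dom) : ContinuousAt b.toFun x := by
  by_cases h : x ∈ b.dom
  · exact b.continuousAt_of_mem x h
  · have hx' : x ∈ hausdorffPart X := hx.resolve_right h
    have h1 : b.suppᶜ ∈ 𝓝 x := compl_mem_nhds_of_isCompact b.isCompact_supp fun y hy =>
      (disjoint_nhds_of_mem_hausdorffPart hx' fun h' => h (h' ▸ b.supp_subset hy)).symm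
    refine (continuousAt_const (y := (0 : unitInterval))).congr ?_
    filter_upwards [h1] with z hz
    exact (b.eq_zero z hz).symm

lemma disjoint_nhds_union {x y : X} (hx : x ∈ hausdorffPart X ∪ b.dom)
    (hy : y ∈ hausdorffPart X ∪ b.dom) (hxy : x ≠ y) : Disjoint (𝓝 x) (𝓝 y) := by
  rcases hx with hx | hx
  · exact disjoint_nhds_of_mem_hausdorffPart hx hxy.symm
  rcases hy with hy | hy
  · exact (disjoint_nhds_of_mem_hausdorffPart hy hxy).symm
  · exact b.disjoint_nhds x hx y hy hxy

end Bump

lemma LocallyCube.exists_isCompact_mem_nhds {M : Set X} (hX : LocallyCube M) {x : X} (hx : x ∈ M)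
    {N : Set X} (hN : N ∈ 𝓝 x) : ∃ K ∈ 𝓝 x, IsCompact K ∧ K ⊆ N := by
  obtain ⟨b, hbN, hb⟩ := hX.exists_bump hx hN
  exact ⟨b.supp, Filter.mem_of_superset hb fun y hy => b.one_mem_supp hy, b.isCompact_supp,
    b.supp_subset.trans hbN⟩

/-- Countably many bumps suffice to describe the topology of a component. -/
lemma exists_countable_bumps [ParacompactSpace X] (hX : LocallyCube (univ : Set X)) (x : X) :
    ∃ S : Set (Bump X), S.Countable ∧ ∀ y ∈ connectedComponent x, ∀ N ∈ 𝓝 y,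
      ∃ b ∈ S, b.dom ⊆ N ∧ ∀ᶠ z in 𝓝 y, b.toFun z = 1 := by
  classical
  obtain ⟨𝒪, h𝒪c, h𝒪, h𝒪b⟩ := exists_countable_basis_connectedComponent hX x
  let R : Set (Set X × Set X) := {p ∈ 𝒪 ×ˢ 𝒪 |
    ∃ b : Bump X, b.dom ⊆ p.2 ∧ ∀ z ∈ p.1, b.toFun z = 1}
  have hR : R.Countable := (h𝒪c.prod h𝒪c).mono (sep_subset _ _)
  have : Nonempty (Bump X) := ⟨(hX.exists_bump (mem_univ x) Filter.univ_mem).choose⟩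
  choose! B hB1 hB2 using fun p (hp : p ∈ R) => hp.2
  refine ⟨B '' R, hR.image _, fun y hy N hN => ?_⟩
  obtain ⟨O, hO, hyO, hON⟩ := h𝒪b y hy N hN
  obtain ⟨b, hbO, hb⟩ := hX.exists_bump (mem_univ y) ((h𝒪 O hO).mem_nhds hyO)
  obtain ⟨O', hO', hyO', hO'b⟩ := h𝒪b y hy _ hb
  have hp : (O', O) ∈ R := ⟨⟨hO', hO⟩, b, hbO, hO'b⟩
  refine ⟨_, mem_image_of_mem B hp, (hB1 _ hp).trans hON, ?_⟩
  filter_upwards [(h𝒪 O' hO').mem_nhds hyO'] with z hz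
  exact hB2 _ hp z hz

end Bump

namespace Decomposition

variable {X : Type*} [TopologicalSpace X] (D : Decomposition X)

/-- The non-degenerate pieces. -/
def nondegPieces : Set (Set X) := {P ∈ D.pieces | ¬ P.Subsingleton}

variable {D}

lemma eq_of_mem_of_mem {P Q : Set X} (hP : P ∈ D.pieces) (hQ : Q ∈ D.pieces) {x : X}
    (hxP : x ∈ P) (hxQ : x ∈ Q) : P = Q := by
  by_contra h
  exact (D.disjoint' P hP Q hQ h).le_bot ⟨hxP, hxQ⟩

lemma saturated_of_nondegPieces {U : Set X}
    (h : ∀ P ∈ D.nondegPieces, (P ∩ U).Nonempty → P ⊆ U) : D.Saturated U := by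
  intro P hP hPU
  by_cases hs : P.Subsingleton
  · obtain ⟨x, hxP, hxU⟩ := hPU
    exact fun y hy => hs hxP hy ▸ hxU
  · exact h P ⟨hP, hs⟩ hPU

lemma exists_subset_of_saturated (hd : D.IsDenseDecomp) {U : Set X} (hU : IsOpen U)
    (hUs : D.Saturated U) (hne : U.Nonempty) : ∃ P ∈ D.nondegPieces, P ⊆ U := by
  have hq : ∀ x, x ∈ (D.q x).1 := fun x => (D.covers x).choose_spec.2
  let W : Set D.Space := {P | P.1 ⊆ U}
  have hW : D.q ⁻¹' W = U := by
    ext x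
    exact ⟨fun h => h (hq x), fun h => hUs _ (D.q x).2 ⟨x, hq x, h⟩⟩
  have hWo : IsOpen W := isOpen_coinduced.2 (hW.symm ▸ hU)
  obtain ⟨x, hx⟩ := hne
  obtain ⟨P, hPW, hP⟩ := Dense.inter_open_nonempty hd W hWo ⟨D.q x, by rwa [← hW] at hx⟩
  exact ⟨P.1, ⟨P.2, hP⟩, hPW⟩

lemma isPreconnected_of_cellular {P : Set X} (hP : IsCompact P) (hc : CellularIn HilbertHalfOpen P)
    (hPX : P ⊆ hausdorffPart X) : IsPreconnected P := by
  rw [isPreconnected_closed_iff]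
  intro s t hs ht hst hPs hPt
  by_contra hne
  have hd : Disjoint (P ∩ s) (P ∩ t) := by
    rw [Set.disjoint_left]
    exact fun x hx hx' => hne ⟨x, hx.1, hx.2, hx'.2⟩
  obtain ⟨u, v, hu, hv, hsu, htv, huv⟩ := separatedNhds_of_isCompact (hP.inter_right hs)
    (hP.inter_right ht) (inter_subset_left.trans hPX) hd
  obtain ⟨V, hV, hVuv, ⟨e⟩⟩ := hc (u ∪ v) (hu.union hv) fun x hx =>
    (hst hx).imp (fun h => hsu ⟨hx, h⟩) fun h => htv ⟨hx, h⟩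
  have hPV : P ⊆ V := subset_of_mem_nhdsSet hV
  have hVc : IsPreconnected V := by
    have : PreconnectedSpace (Ico (0 : ℝ) 1) := Subtype.preconnectedSpace isPreconnected_Ico
    have h1 : IsPreconnected (range fun y => (e.symm y : X)) :=
      isPreconnected_range (continuous_subtype_val.comp e.symm.continuous)
    have h2 : range (fun y => (e.symm y : X)) = V := by
      ext x
      exact ⟨fun ⟨y, hy⟩ => hy ▸ (e.symm y).2, fun hx => ⟨e ⟨x, hx⟩, by simp⟩⟩
    rwa [h2] at h1
  obtain ⟨x, hxP, hxs⟩ := hPs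
  obtain ⟨y, hyP, hyt⟩ := hPt
  obtain ⟨z, -, hzu, hzv⟩ := hVc u v hu hv hVuv ⟨x, hPV hxP, hsu ⟨hxP, hxs⟩⟩
    ⟨y, hPV hyP, htv ⟨hyP, hyt⟩⟩
  exact huv.le_bot ⟨hzu, hzv⟩

/-- Some non-degenerate piece of a dense vanishing shrinkable decomposition lies entirely in the
Hausdorff part. -/
lemma exists_subset_hausdorffPart [ParacompactSpace X] [Nonempty X]
    (hX : LocallyCube (univ : Set X)) (hd : D.IsDenseDecomp)
    (hv : D.Vanishing) (hs : D.StronglyShrinkable) :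
    ∃ P ∈ D.nondegPieces, P ⊆ hausdorffPart X := by
  by_contra hne
  have hP : ∀ P ∈ D.nondegPieces, ¬ P ⊆ hausdorffPart X := fun P hP h => hne ⟨P, hP, h⟩
  have hclosed : ∀ P ∈ D.pieces, IsOpen (hausdorffPart X \ P) := by
    intro P hP
    rw [isOpen_iff_mem_nhds]
    rintro x ⟨hx, hxP⟩
    refine Filter.inter_mem (isOpen_hausdorffPart.mem_nhds hx) ?_
    exact compl_mem_nhds_of_isCompact (D.isCompact' P hP) fun y hy =>
      (disjoint_nhds_of_mem_hausdorffPart hx fun h => hxP (h ▸ hy)).symm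
  have hnhds : ∀ x ∈ hausdorffPart X, ∃ P ∈ D.nondegPieces, P ∈ 𝓝 x := by
    intro x hx
    obtain ⟨K, hK, hKc, hKX⟩ := hX.exists_isCompact_mem_nhds (mem_univ x)
      (isOpen_hausdorffPart.mem_nhds hx)
    have hKcl := isClosed_of_isCompact_of_subset_hausdorffPart hKc hKX
    obtain ⟨V, hV, hVP⟩ := hv {hausdorffPart X, Kᶜ} (by
      rintro u (rfl | rfl)
      · exact isOpen_hausdorffPart
      · exact hKcl.isOpen_compl) (by
      rw [sUnion_pair, eq_univ_iff_forall]
      intro y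
      by_cases hy : y ∈ K
      · exact Or.inl (hKX hy)
      · exact Or.inr hy) x
    have hG : IsOpen (interior (V ∩ K)) := isOpen_interior
    have hxG : x ∈ interior (V ∩ K) := mem_interior_iff_mem_nhds.2 (Filter.inter_mem hV hK)
    have hGX : interior (V ∩ K) ⊆ hausdorffPart X :=
      interior_subset.trans (inter_subset_right.trans hKX)
    have hone : ∀ P ∈ D.nondegPieces, ∀ Q ∈ D.nondegPieces, (P ∩ interior (V ∩ K)).Nonempty →
        (Q ∩ interior (V ∩ K)).Nonempty → P = Q := by
      have h1 : ∀ P ∈ D.nondegPieces, (P ∩ interior (V ∩ K)).Nonempty →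
          (∀ u ∈ ({hausdorffPart X, Kᶜ} : Set (Set X)), ¬ P ⊆ u) ∧ (V ∩ P).Nonempty := by
        rintro P hPD ⟨y, hyP, hy⟩
        have hy' := interior_subset hy
        refine ⟨?_, y, hy'.1, hyP⟩
        rintro u (rfl | rfl) hPu
        · exact hP P hPD hPu
        · exact hPu hyP hy'.2
      intro P hPD Q hQD hPG hQG
      exact hVP P hPD.1 (h1 P hPD hPG).1 Q hQD.1 (h1 Q hQD hQG).1 (h1 P hPD hPG).2 (h1 Q hQD hQG).2
    obtain ⟨P, hPD, hPG⟩ : ∃ P ∈ D.nondegPieces, (P ∩ interior (V ∩ K)).Nonempty := by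
      by_contra h
      obtain ⟨P, hPD, hPG⟩ := exists_subset_of_saturated hd hG
        (saturated_of_nondegPieces fun P hPD hPG => (h ⟨P, hPD, hPG⟩).elim) ⟨x, hxG⟩
      obtain ⟨y, hy⟩ := D.nonempty' P hPD.1
      exact h ⟨P, hPD, y, hy, hPG hy⟩
    refine ⟨P, hPD, ?_⟩
    refine Filter.mem_of_superset (hG.mem_nhds hxG) ?_
    by_contra hGP
    obtain ⟨y, hyG, hyP⟩ := not_subset.1 hGP
    have hO : IsOpen (interior (V ∩ K) ∩ (hausdorffPart X \ P)) := hG.inter (hclosed P hPD.1)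
    have hno : ∀ Q ∈ D.nondegPieces,
        ¬ (Q ∩ (interior (V ∩ K) ∩ (hausdorffPart X \ P))).Nonempty := by
      rintro Q hQ ⟨z, hzQ, hzG, hzX, hzP⟩
      exact hzP (hone Q hQ P hPD ⟨z, hzQ, hzG⟩ hPG ▸ hzQ)
    obtain ⟨Q, hQD, hQ⟩ := exists_subset_of_saturated hd hO
      (saturated_of_nondegPieces fun Q hQ h => (hno Q hQ h).elim) ⟨y, hyG, hGX hyG, hyP⟩
    obtain ⟨z, hz⟩ := D.nonempty' Q hQD.1
    exact hno Q hQD ⟨z, hz, hQ hz⟩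
  obtain ⟨x, hx⟩ := hausdorffPart_nonempty hX
  obtain ⟨G, hG, hGc, hxG, hGX⟩ := hX.exists_isPreconnected (mem_univ x)
    (isOpen_hausdorffPart.mem_nhds hx)
  obtain ⟨p, hp, q, hq, hpq⟩ := hX.nontrivial_of_mem_nhds (mem_univ x) (hG.mem_nhds hxG)
  obtain ⟨h, -, hh⟩ := hs univ isOpen_univ (fun _ _ _ => subset_univ _) {univ}
    (by rintro _ rfl; exact ⟨isOpen_univ, subset_univ _, fun _ _ _ _ => subset_univ _⟩)
    (by simp) {{p}ᶜ, {q}ᶜ} (by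
      rintro v (rfl | rfl)
      · exact ⟨(hX.isClosed_singleton p).isOpen_compl, subset_univ _⟩
      · exact ⟨(hX.isClosed_singleton q).isOpen_compl, subset_univ _⟩) (by
      rw [sUnion_pair]
      intro y _
      by_cases hy : y = p
      · exact Or.inr fun h => hpq (hy.symm.trans h)
      · exact Or.inl hy)
  let g : X ≃ₜ X := (Homeomorph.Set.univ X).symm.trans (h.trans (Homeomorph.Set.univ X))
  have hg : ∀ y, g y = (h ⟨y, mem_univ y⟩ : X) := fun y => rfl
  have hGX' : g.symm '' G ⊆ hausdorffPart X := by
    rintro _ ⟨y, hy, rfl⟩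
    exact g.symm.mem_hausdorffPart (hGX hy)
  obtain ⟨P, hPD, hPx⟩ := hnhds (g.symm p) (hGX' ⟨p, hp, rfl⟩)
  have hGP : g.symm '' G ⊆ P := by
    have h1 : IsPreconnected (g.symm '' G) := hGc.image _ g.symm.continuous.continuousOn
    by_contra hGP
    obtain ⟨y, hyG, hyP⟩ := not_subset.1 hGP
    obtain ⟨z, -, hz, hz'⟩ := h1 (interior P) (hausdorffPart X \ P) isOpen_interior
      (hclosed P hPD.1) (fun z hz => by
        by_cases hzP : z ∈ P
        · obtain ⟨Q, hQD, hQ⟩ := hnhds z (hGX' hz)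
          rw [eq_of_mem_of_mem hPD.1 hQD.1 hzP (mem_of_mem_nhds hQ)]
          exact Or.inl (mem_interior_iff_mem_nhds.2 hQ)
        · exact Or.inr ⟨hGX' hz, hzP⟩)
      ⟨_, ⟨p, hp, rfl⟩, mem_interior_iff_mem_nhds.2 hPx⟩ ⟨y, hyG, hGX' hyG, hyP⟩
    exact hz'.2 (interior_subset hz)
  obtain ⟨v, hv, hPv⟩ := hh P hPD.1 (subset_univ P)
  have hmem : ∀ y ∈ G, y ∈ v := fun y hy => hPv ⟨⟨y, mem_univ y⟩, ⟨⟨g.symm y, mem_univ _⟩,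
    hGP ⟨y, hy, rfl⟩, Subtype.ext ((hg _).symm.trans (g.apply_symm_apply y))⟩, rfl⟩
  rcases hv with rfl | rfl
  · exact hmem p hp rfl
  · exact hmem q hq rfl

end Decomposition

section Compactification

universe u
variable {X : Type u} [TopologicalSpace X]

/-- A metrizable compactification of `M` to which all functions of a countable family of bumps
extend. -/
lemma exists_compactification {M : Set X} (hM : IsOpen M) (hMX : M ⊆ hausdorffPart X)
    (hne : M.Nonempty) {S : Set (Bump X)} (hS : S.Countable)
    (hSM : ∀ y ∈ M, ∀ N ∈ 𝓝 y, ∃ b ∈ S, b.dom ⊆ N ∧ ∀ᶠ z in 𝓝 y, b.toFun z = 1) :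
    ∃ (Y : Type u) (_ : MetricSpace Y) (_ : CompactSpace Y) (J : OpenPartialHomeomorph X Y)
      (c : S → Y → unitInterval), J.source = M ∧ (∀ b, Continuous (c b)) ∧
      (∀ b, ∀ x ∈ M, c b (J x) = b.1.toFun x) ∧ ∀ y y', (∀ b, c b y = c b y') → y = y' := by
  have : Countable S := hS.to_subtype
  let ι : X → (S → unitInterval) := fun x b => b.1.toFun x
  have hι : ∀ x ∈ M, ContinuousAt ι x := fun x hx =>
    continuousAt_pi.2 fun b => b.1.continuousAt (Or.inl (hMX hx))
  let K : Set (S → unitInterval) := closure (ι '' M)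
  let _ : MetricSpace (S → unitInterval) := TopologicalSpace.metrizableSpaceMetric _
  let j : M → K := fun x => ⟨ι x, subset_closure ⟨x, x.2, rfl⟩⟩
  have hjc : Continuous j := by
    refine Continuous.subtype_mk ?_ _
    rw [continuous_iff_continuousAt]
    exact fun x => (hι x x.2).comp continuous_subtype_val.continuousAt
  have hji : Function.Injective j := by
    intro x y hxy
    by_contra hne
    have hne' : (y : X) ≠ x := fun h => hne (Subtype.ext h.symm)
    obtain ⟨s, hs, t, ht, hst⟩ :=
      Filter.disjoint_iff.1 (disjoint_nhds_of_mem_hausdorffPart (hMX x.2) hne')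
    obtain ⟨b, hbS, hb, hb1⟩ := hSM x x.2 s hs
    have h1 : b.toFun x = b.toFun y := congrFun (congrArg Subtype.val hxy) ⟨b, hbS⟩
    rw [hb1.self_of_nhds] at h1
    exact hst.le_bot ⟨hb (b.supp_subset (b.one_mem_supp h1.symm)), mem_of_mem_nhds ht⟩
  have hjo : IsOpenMap j := by
    rw [isOpenMap_iff_nhds_le]
    intro x
    rw [Filter.le_map_iff]
    intro U hU
    obtain ⟨N, hN, hNU⟩ := mem_nhds_subtype _ _ _ |>.1 hU
    obtain ⟨b, hbS, hb, hb1⟩ := hSM x x.2 (N ∩ M) (Filter.inter_mem hN (hM.mem_nhds x.2))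
    have h1 : {y : K | 0 < y.1 ⟨b, hbS⟩} ∈ 𝓝 (j x) := by
      have h2 : Continuous fun y : K => y.1 ⟨b, hbS⟩ :=
        (continuous_apply _).comp continuous_subtype_val
      refine (isOpen_lt continuous_const h2).mem_nhds ?_
      change 0 < b.toFun x
      rw [hb1.self_of_nhds]
      exact zero_lt_one
    refine Filter.mem_of_superset h1 ?_
    rintro ⟨y, hyK⟩ (hy : 0 < y ⟨b, hbS⟩)
    have hbM : b.supp ⊆ N ∩ M := b.supp_subset.trans hb
    have h3 : IsCompact (ι '' b.supp) := b.isCompact_supp.image_of_continuousOn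
      fun z hz => (hι z (hbM hz).2).continuousWithinAt
    have h4 : y ∈ closure (ι '' b.supp) := by
      rw [mem_closure_iff_nhds]
      intro V hV
      obtain ⟨_, ⟨hzV, hz0⟩, z, hz, rfl⟩ := mem_closure_iff_nhds.1 hyK
        (V ∩ {w | 0 < w ⟨b, hbS⟩}) (Filter.inter_mem hV
          ((isOpen_lt continuous_const (continuous_apply _)).mem_nhds hy))
      refine ⟨_, hzV, z, ?_, rfl⟩
      by_contra hzb
      have h5 : 0 < b.toFun z := hz0
      rw [b.eq_zero z hzb] at h5
      exact lt_irrefl _ h5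
    rw [h3.isClosed.closure_eq] at h4
    obtain ⟨z, hz, rfl⟩ := h4
    exact ⟨⟨z, (hbM hz).2⟩, hNU (hbM hz).1, rfl⟩
  have hj : IsOpenEmbedding j := .of_continuous_injective_isOpenMap hjc hji hjo
  have hMn : Nonempty (⟨M, hM⟩ : TopologicalSpace.Opens X) := hne.to_subtype
  have : Nonempty M := hne.to_subtype
  let E := TopologicalSpace.Opens.openPartialHomeomorphSubtypeCoe
    (⟨M, hM⟩ : TopologicalSpace.Opens X) hMn
  let j' : OpenPartialHomeomorph M K := hj.toOpenPartialHomeomorph j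
  have hEt : E.target = M := by simp [E]
  have hEs : ∀ x : M, E.symm x = x := fun x => E.left_inv (x := x) (by simp [E])
  refine ⟨K, inferInstance, isCompact_iff_compactSpace.1 isClosed_closure.isCompact,
    E.symm.trans j', fun b y => y.1 b, ?_, fun b => ?_, fun b x hx => ?_, fun y y' h => ?_⟩
  · rw [OpenPartialHomeomorph.trans_source]
    change E.target ∩ _ ⁻¹' univ = M
    rw [preimage_univ, inter_univ, hEt]
  · exact (continuous_apply b).comp continuous_subtype_val
  · change (j (E.symm x)).1 b = _
    rw [hEs ⟨x, hx⟩]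
  · exact Subtype.ext (funext h)

end Compactification

section Null

variable {X : Type*} [TopologicalSpace X]

/-- An infinite family of sets meeting a compact set accumulates at a point of it. -/
lemma exists_accumulation {K : Set X} (hK : IsCompact K) {𝒮 : Set (Set X)} (h𝒮 : 𝒮.Infinite)
    (h : ∀ P ∈ 𝒮, (P ∩ K).Nonempty) :
    ∃ z ∈ K, ∀ N ∈ 𝓝 z, {P ∈ 𝒮 | (P ∩ N).Nonempty}.Infinite := by
  by_contra! hne
  have h1 : {P ∈ 𝒮 | (P ∩ K).Nonempty}.Finite := by
    refine hK.induction_on (p := fun s => {P ∈ 𝒮 | (P ∩ s).Nonempty}.Finite) ?_ ?_ ?_ ?_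
    · simp
    · exact fun s t hst ht => ht.subset fun P hP =>
        ⟨hP.1, hP.2.mono (inter_subset_inter_right _ hst)⟩
    · intro s t hs ht
      refine (hs.union ht).subset ?_
      rintro P ⟨hP, x, hxP, hx | hx⟩
      · exact Or.inl ⟨hP, x, hxP, hx⟩
      · exact Or.inr ⟨hP, x, hxP, hx⟩
    · intro x hx
      obtain ⟨N, hN, hNf⟩ := hne x hx
      exact ⟨N, mem_nhdsWithin_of_mem_nhds hN, hNf⟩
  exact h𝒮 (h1.subset fun P hP => ⟨hP, h P hP⟩)

lemma t2Space_of_disjoint_nhds {U : Set X}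
    (hUs : ∀ x ∈ U, ∀ y ∈ U, x ≠ y → Disjoint (𝓝 x) (𝓝 y)) : T2Space U := by
  refine t2Space_iff_disjoint_nhds.2 fun x y hxy => ?_
  change Disjoint (𝓝 x) (𝓝 y)
  rw [nhds_subtype_eq_comap, nhds_subtype_eq_comap]
  exact Filter.disjoint_comap (hUs x x.2 y y.2 fun h => hxy (Subtype.ext h))

/-- An open set inside a component all of whose points are separated is exhausted by compact
sets. -/
lemma exists_compactExhaustion [ParacompactSpace X] (hX : LocallyCube (univ : Set X)) {x₀ : X}
    {U : Set X} (hU : IsOpen U) (hUT : U ⊆ connectedComponent x₀)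
    (hUs : ∀ x ∈ U, ∀ y ∈ U, x ≠ y → Disjoint (𝓝 x) (𝓝 y)) :
    Nonempty (CompactExhaustion U) := by
  have h1 : T2Space U := t2Space_of_disjoint_nhds hUs
  have h2 : WeaklyLocallyCompactSpace U := by
    refine ⟨fun x => ?_⟩
    obtain ⟨K, hK, hKc, hKU⟩ := hX.exists_isCompact_mem_nhds (mem_univ (x : X))
      (hU.mem_nhds x.2)
    exact ⟨Subtype.val ⁻¹' K, (IsInducing.subtypeVal.isCompact_preimage_iff
      (by rwa [Subtype.range_coe])).2 hKc, continuous_subtype_val.continuousAt.preimage_mem_nhds hK⟩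
  have h3 : SecondCountableTopology U := by
    obtain ⟨𝒪, h𝒪c, h𝒪, h𝒪b⟩ := exists_countable_basis_connectedComponent hX x₀
    refine TopologicalSpace.IsTopologicalBasis.secondCountableTopology
      (b := (fun O => Subtype.val ⁻¹' O) '' 𝒪)
      (TopologicalSpace.isTopologicalBasis_of_isOpen_of_nhds ?_ ?_) (h𝒪c.image _)
    · rintro _ ⟨O, hO, rfl⟩
      exact (h𝒪 O hO).preimage continuous_subtype_val
    · intro x V hxV hV
      obtain ⟨W, hW, rfl⟩ := isOpen_induced_iff.1 hV
      obtain ⟨O, hO, hxO, hOW⟩ := h𝒪b x (hUT x.2) W (hW.mem_nhds hxV)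
      exact ⟨_, ⟨O, hO, rfl⟩, hxO, preimage_mono hOW⟩
  exact ⟨CompactExhaustion.choice U⟩

lemma exists_cover_of_compactExhaustion {U : Set X} (E : CompactExhaustion U)
    (hE : ∀ n, IsClosed (E n)) (x : U) : ∃ v : Set U, IsOpen v ∧ x ∈ v ∧
      ∀ n, (v ∩ E n).Nonempty → v ⊆ E (n + 2) := by
  rcases Nat.eq_zero_or_pos (E.find x) with h | h
  · refine ⟨interior (E 1), isOpen_interior, ?_, fun n _ => interior_subset.trans
      (E.subset (by lia))⟩
    exact E.subset_interior_succ 0 (E.mem_iff_find_le.2 h.le)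
  · obtain ⟨k, hk⟩ := Nat.exists_eq_succ_of_ne_zero h.ne'
    refine ⟨interior (E (k + 2)) \ E k, isOpen_interior.sdiff (hE k), ⟨?_, ?_⟩, ?_⟩
    · exact E.subset_interior_succ (k + 1) (E.mem_iff_find_le.2 hk.le)
    · rw [E.mem_iff_find_le]
      lia
    · rintro n ⟨y, hy, hyn⟩
      have h1 : k ≤ n := by
        by_contra hkn
        exact hy.2 (E.subset (by lia) hyn)
      exact sdiff_subset.trans (interior_subset.trans (E.subset (by lia)))

namespace Decomposition

variable {D : Decomposition X}

/-- The oscillation of a bump is small on all but finitely many pieces of a component. -/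
lemma finite_oscillation [ParacompactSpace X] (hX : LocallyCube (univ : Set X))
    (hv : D.Vanishing) (hs : D.StronglyShrinkable)
    (hDX : ∀ P ∈ D.nondegPieces, P ⊆ hausdorffPart X)
    (hDc : ∀ P ∈ D.nondegPieces, IsPreconnected P) (x₀ : X) (b : Bump X) {δ : ℝ} (hδ : 0 < δ) :
    {P ∈ D.nondegPieces | P ⊆ connectedComponent x₀ ∧
      ∃ x ∈ P, ∃ y ∈ P, δ ≤ dist (b.toFun x) (b.toFun y)}.Finite := by
  set 𝒮 := {P ∈ D.nondegPieces | P ⊆ connectedComponent x₀ ∧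
      ∃ x ∈ P, ∃ y ∈ P, δ ≤ dist (b.toFun x) (b.toFun y)} with h𝒮
  by_contra hinf
  obtain ⟨z, hz, hzN⟩ := exists_accumulation b.isCompact_supp (𝒮 := 𝒮) hinf (by
    rintro P ⟨-, -, x, hx, y, hy, hxy⟩
    by_contra hne
    have h1 : ∀ w ∈ P, b.toFun w = 0 := fun w hw => b.eq_zero w fun hw' => hne ⟨w, hw, hw'⟩
    rw [h1 x hx, h1 y hy, dist_self] at hxy
    exact absurd hδ (not_lt.2 hxy))
  have hzd : z ∈ b.dom := b.supp_subset hz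
  have hball : b.toFun ⁻¹' Metric.ball (b.toFun z) (δ / 2) ∈ 𝓝 z :=
    (b.continuousAt_of_mem z hzd).preimage_mem_nhds (Metric.ball_mem_nhds _ (by linarith))
  have hosc : ∀ p ∈ b.toFun ⁻¹' Metric.ball (b.toFun z) (δ / 2),
      ∀ q ∈ b.toFun ⁻¹' Metric.ball (b.toFun z) (δ / 2), dist (b.toFun p) (b.toFun q) < δ := by
    intro p hp q hq
    have h1 : dist (b.toFun p) (b.toFun z) < δ / 2 := hp
    have h2 : dist (b.toFun q) (b.toFun z) < δ / 2 := hq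
    have h3 := dist_triangle_right (b.toFun p) (b.toFun q) (b.toFun z)
    linarith
  by_cases hzX : z ∈ hausdorffPart X
  · obtain ⟨C, hC, hCc, hCX⟩ := hX.exists_isCompact_mem_nhds (mem_univ z)
      (isOpen_hausdorffPart.mem_nhds hzX)
    have hCcl := isClosed_of_isCompact_of_subset_hausdorffPart hCc hCX
    obtain ⟨V, hV, hVP⟩ := hv ({u | IsOpen u ∧ ∀ p ∈ u, ∀ q ∈ u,
        dist (b.toFun p) (b.toFun q) < δ} ∪ {Cᶜ}) (by
      rintro u (hu | rfl)
      · exact hu.1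
      · exact hCcl.isOpen_compl) (by
      rw [eq_univ_iff_forall]
      intro y
      by_cases hy : y ∈ C
      · have h1 : b.toFun ⁻¹' Metric.ball (b.toFun y) (δ / 2) ∈ 𝓝 y :=
          (b.continuousAt (Or.inl (hCX hy))).preimage_mem_nhds
            (Metric.ball_mem_nhds _ (by linarith))
        refine ⟨interior _, Or.inl ⟨isOpen_interior, ?_⟩, mem_interior_iff_mem_nhds.2 h1⟩
        intro p hp q hq
        have hp' := interior_subset hp
        have hq' := interior_subset hq
        have h2 : dist (b.toFun p) (b.toFun y) < δ / 2 := hp'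
        have h3 : dist (b.toFun q) (b.toFun y) < δ / 2 := hq'
        have h4 := dist_triangle_right (b.toFun p) (b.toFun q) (b.toFun y)
        linarith
      · exact ⟨Cᶜ, Or.inr rfl, hy⟩) z
    refine hzN (V ∩ C) (Filter.inter_mem hV hC) (Set.Subsingleton.finite ?_)
    have h1 : ∀ P ∈ {P ∈ 𝒮 | (P ∩ (V ∩ C)).Nonempty}, P ∈ D.pieces ∧
        (∀ u ∈ ({u | IsOpen u ∧ ∀ p ∈ u, ∀ q ∈ u,
        dist (b.toFun p) (b.toFun q) < δ} ∪ {Cᶜ} : Set (Set X)), ¬ P ⊆ u) ∧ (V ∩ P).Nonempty := by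
      rintro P ⟨⟨hPD, -, x, hx, y, hy, hxy⟩, w, hwP, hwV, hwC⟩
      refine ⟨hPD.1, ?_, w, hwV, hwP⟩
      rintro u (hu | rfl) hPu
      · exact absurd (hu.2 x (hPu hx) y (hPu hy)) (not_lt.2 hxy)
      · exact hPu hwP hwC
    intro P hP Q hQ
    exact hVP P (h1 P hP).1 (h1 P hP).2.1 Q (h1 Q hQ).1 (h1 Q hQ).2.1 (h1 P hP).2.2 (h1 Q hQ).2.2
  · have hzT : z ∈ connectedComponent x₀ := by
      rw [← isClosed_connectedComponent.closure_eq, mem_closure_iff_nhds]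
      intro N hN
      obtain ⟨P, hP, y, hyP, hyN⟩ := (hzN N hN).nonempty
      exact ⟨y, hyN, hP.2.1 hyP⟩
    set H := hausdorffPart X ∪ b.dom with hH
    have hHo : IsOpen H := isOpen_hausdorffPart.union b.isOpen_dom
    set U := (H ∩ connectedComponent x₀) \ {z} with hUdef
    have hU : IsOpen U := (hHo.inter (hX.isOpen_connectedComponent x₀)).sdiff
      (hX.isClosed_singleton z)
    have hUH : U ⊆ H := sdiff_subset.trans inter_subset_left
    have hsep : ∀ x ∈ H, ∀ y ∈ H, x ≠ y → Disjoint (𝓝 x) (𝓝 y) := fun x hx y hy =>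
      b.disjoint_nhds_union hx hy
    have hDU : ∀ P ∈ D.nondegPieces, P ⊆ connectedComponent x₀ → P ⊆ U := fun P hP hPT x hx =>
      ⟨⟨Or.inl (hDX P hP hx), hPT hx⟩, fun h => hzX (h ▸ hDX P hP hx)⟩
    have hUs : D.Saturated U := saturated_of_nondegPieces fun P hP ⟨x, hxP, hxU⟩ =>
      hDU P hP (by
        rw [connectedComponent_eq hxU.1.2]
        exact (hDc P hP).subset_connectedComponent hxP)
    obtain ⟨E⟩ := exists_compactExhaustion hX hU (sdiff_subset.trans inter_subset_right)
      fun x hx y hy => hsep x (hUH hx) y (hUH hy)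
    have hT2 : T2Space U := t2Space_of_disjoint_nhds fun x hx y hy => hsep x (hUH hx) y (hUH hy)
    obtain ⟨h, -, hh⟩ := hs U hU hUs {U}
      (by rintro _ rfl; exact ⟨hU, subset_rfl, fun _ _ h _ => h⟩) (by simp)
      {v | ∃ w : Set U, IsOpen w ∧ v = Subtype.val '' w ∧
        ∀ n, (w ∩ E n).Nonempty → w ⊆ E (n + 2)} (by
        rintro _ ⟨w, hw, rfl, -⟩
        exact ⟨hU.isOpenMap_subtype_val _ hw, Subtype.coe_image_subset _ _⟩) (by
        intro x hx
        obtain ⟨w, hw, hxw, hwE⟩ := exists_cover_of_compactExhaustion E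
          (fun n => (E.isCompact n).isClosed) ⟨x, hx⟩
        exact ⟨_, ⟨w, hw, rfl, hwE⟩, ⟨x, hx⟩, hxw, rfl⟩)
    obtain ⟨C, hC, hCc, hCs⟩ := hX.exists_isCompact_mem_nhds (mem_univ z)
      (Filter.inter_mem (Filter.inter_mem hball (b.isOpen_dom.mem_nhds hzd))
        ((hX.isOpen_connectedComponent x₀).mem_nhds hzT))
    have hF : IsCompact (C \ interior C) := hCc.diff isOpen_interior
    have hFU : C \ interior C ⊆ U := fun x hx =>
      ⟨⟨Or.inr (hCs hx.1).1.2, (hCs hx.1).2⟩, fun h => hx.2 (by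
        rw [mem_singleton_iff] at h
        rw [h]
        exact mem_interior_iff_mem_nhds.2 hC)⟩
    have hF' : IsCompact (h '' (Subtype.val ⁻¹' (C \ interior C))) :=
      ((IsInducing.subtypeVal.isCompact_preimage_iff (by rwa [Subtype.range_coe])).2 hF).image
        h.continuous
    obtain ⟨n, hn⟩ := E.exists_superset_of_isCompact hF'
    have hCo : IsOpen (H \ C) := by
      rw [isOpen_iff_mem_nhds]
      rintro x ⟨hx, hxC⟩
      exact Filter.inter_mem (hHo.mem_nhds hx) (compl_mem_nhds_of_isCompact hCc fun y hy =>
        hsep y (Or.inr (hCs hy).1.2) x hx fun h => hxC (h ▸ hy))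
    set L : Set X := Subtype.val '' (h ⁻¹' (E (n + 2))) with hL
    have hLc : IsCompact L :=
      (h.isCompact_preimage.2 (E.isCompact _)).image continuous_subtype_val
    have hLz : Lᶜ ∈ 𝓝 z := compl_mem_nhds_of_isCompact hLc (by
      rintro _ ⟨y, -, rfl⟩
      exact hsep y (hUH y.2) z (Or.inr hzd) fun h => y.2.2 h)
    refine hzN (interior C ∩ Lᶜ) (Filter.inter_mem (interior_mem_nhds.2 hC) hLz) ?_
    convert Set.finite_empty
    rw [eq_empty_iff_forall_notMem]
    rintro P ⟨⟨hPD, hPT, p, hp, q, hq, hpq⟩, w, hwP, hwC, hwL⟩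
    have hPU := hDU P hPD hPT
    obtain ⟨y, hyP, hyF⟩ : (P ∩ (C \ interior C)).Nonempty := by
      by_contra hne
      have h1 : ¬ P ⊆ C := fun hPC =>
        absurd (hosc p (hCs (hPC hp)).1.1 q (hCs (hPC hq)).1.1) (not_lt.2 hpq)
      obtain ⟨x, hxP, hxC⟩ := not_subset.1 h1
      obtain ⟨y, -, hy, hy'⟩ := hDc P hPD (interior C) (H \ C) isOpen_interior hCo
        (fun y hy => by
          by_cases hyC : y ∈ C
          · by_contra hy'
            exact hne ⟨y, hy, hyC, fun h => hy' (Or.inl h)⟩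
          · exact Or.inr ⟨hUH (hPU hy), hyC⟩) ⟨w, hwP, hwC⟩ ⟨x, hxP, hUH (hPU hxP), hxC⟩
      exact hy'.2 (interior_subset hy)
    obtain ⟨_, ⟨v, -, rfl, hv⟩, hPv⟩ := hh P hPD.1 hPU
    have hmem : ∀ x (hx : x ∈ P), h ⟨x, hPU hx⟩ ∈ v := fun x hx => by
      obtain ⟨x', hx', he⟩ := hPv ⟨h ⟨x, hPU hx⟩, ⟨⟨x, hPU hx⟩, hx, rfl⟩, rfl⟩
      rwa [← Subtype.ext he]
    have hvE := hv n ⟨h ⟨y, hPU hyP⟩, hmem y hyP, hn ⟨⟨y, hPU hyP⟩, hyF, rfl⟩⟩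
    exact hwL ⟨⟨w, hPU hwP⟩, hvE (hmem w hwP), rfl⟩

end Decomposition

end Null

section Transfer

lemma exists_openPartialHomeomorph_of_homeomorph {X : Type*} [TopologicalSpace X] {U : Set X}
    (hU : IsOpen U) (h : U ≃ₜ U) : ∃ e : OpenPartialHomeomorph X X, e.source = U ∧
      e.target = U ∧ ∀ x (hx : x ∈ U), e x = h ⟨x, hx⟩ := by
  rcases U.eq_empty_or_nonempty with rfl | hne
  · exact ⟨(OpenPartialHomeomorph.refl X).restrOpen ∅ isOpen_empty, by simp, by simp,
      fun x hx => absurd hx (notMem_empty x)⟩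
  · let i := TopologicalSpace.Opens.openPartialHomeomorphSubtypeCoe ⟨U, hU⟩ hne.to_subtype
    let e := i.symm.trans (h.toOpenPartialHomeomorph.trans i)
    have hi : ∀ x (hx : x ∈ U), i.symm x = ⟨x, hx⟩ := fun x hx =>
      i.left_inv (x := ⟨x, hx⟩) (mem_univ _)
    have his : i.source = univ := rfl
    have hit : i.target = U :=
      TopologicalSpace.Opens.openPartialHomeomorphSubtypeCoe_target ⟨U, hU⟩ hne.to_subtype
    refine ⟨e, ?_, ?_, fun x hx => ?_⟩
    · simp [e, his, hit]
    · simp [e, his, hit]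
    · change i (h (i.symm x)) = _
      rw [hi x hx]
      rfl

/-- Conjugation of a homeomorphism of an open set by a partial homeomorphism. -/
lemma exists_conj_openPartialHomeomorph {X Y : Type*} [TopologicalSpace X] [TopologicalSpace Y]
    (J : OpenPartialHomeomorph X Y) {W : Set Y} (hWJ : W ⊆ J.target)
    (hU : IsOpen (J.source ∩ J ⁻¹' W)) (h : ↥(J.source ∩ J ⁻¹' W) ≃ₜ ↥(J.source ∩ J ⁻¹' W)) :
    ∃ e : OpenPartialHomeomorph Y Y, e.source = W ∧ e.target = W ∧
      ∀ x (hx : x ∈ J.source ∩ J ⁻¹' W), e (J x) = J (h ⟨x, hx⟩) := by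
  obtain ⟨e, he, he', heh⟩ := exists_openPartialHomeomorph_of_homeomorph hU h
  have key : ∀ f : OpenPartialHomeomorph X X, f.source = J.source ∩ J ⁻¹' W →
      f.target = J.source ∩ J ⁻¹' W → (J.symm.trans (f.trans J)).source = W := by
    intro f hf hf'
    ext y
    simp only [OpenPartialHomeomorph.trans_source, OpenPartialHomeomorph.symm_source, hf]
    constructor
    · rintro ⟨hy, ⟨⟨-, h1⟩, -⟩⟩
      rwa [mem_preimage, J.right_inv hy] at h1
    · intro hy
      have h1 : J.symm y ∈ J.source ∩ J ⁻¹' W :=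
        ⟨J.map_target (hWJ hy), by rwa [mem_preimage, J.right_inv (hWJ hy)]⟩
      have h2 : f (J.symm y) ∈ J.source ∩ J ⁻¹' W := hf' ▸ f.map_source (hf ▸ h1)
      exact ⟨hWJ hy, h1, h2.1⟩
  refine ⟨J.symm.trans (e.trans J), key e he he', ?_, fun x hx => ?_⟩
  · have := key e.symm he' he
    rw [← OpenPartialHomeomorph.symm_source]
    rw [OpenPartialHomeomorph.trans_symm_eq_symm_trans_symm,
      OpenPartialHomeomorph.trans_symm_eq_symm_trans_symm, OpenPartialHomeomorph.symm_symm,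
      OpenPartialHomeomorph.trans_assoc]
    exact this
  · change J (e (J.symm (J x))) = _
    rw [J.left_inv hx.1, heh x hx]

lemma LocallyCube.target {X Y : Type*} [TopologicalSpace X] [TopologicalSpace Y]
    (hX : LocallyCube (univ : Set X)) (J : OpenPartialHomeomorph X Y) : LocallyCube J.target := by
  intro y hy
  obtain ⟨e, he⟩ := hX (J.symm y) (mem_univ _)
  exact ⟨J.symm.trans e, by simp [hy, he]⟩

namespace Decomposition

variable {X : Type*} [TopologicalSpace X] {D : Decomposition X}

/-- Pieces of a component, transported by a partial homeomorphism defined on the separated part of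
this component. -/
def transported (D : Decomposition X) {Y : Type*} [TopologicalSpace Y]
    (J : OpenPartialHomeomorph X Y) : Set (Set Y) :=
  (fun P => J '' P) '' {P ∈ D.nondegPieces | P ⊆ J.source}

lemma germRelated_transported {A B : Decomposition X} {Y : Type*} [MetricSpace Y]
    (J : OpenPartialHomeomorph X Y)
    (hhom : ∀ P ∈ A.nondegPieces, ∀ Q ∈ B.nondegPieces, ∃ h : X ≃ₜ X, h '' P = Q) :
    GermRelated (A.transported J) (B.transported J) := by
  rintro _ ⟨P, ⟨hP, hPJ⟩, rfl⟩ _ ⟨Q, ⟨hQ, hQJ⟩, rfl⟩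
  obtain ⟨h, rfl⟩ := hhom P hP Q hQ
  refine ⟨J.symm.trans (h.toOpenPartialHomeomorph.trans J), ?_, ?_⟩
  · rintro _ ⟨x, hx, rfl⟩
    simp [hPJ hx, hQJ (mem_image_of_mem h hx)]
  · change _ = J '' (h '' P)
    rw [image_image, image_image]
    refine image_congr fun x hx => ?_
    change J (h (J.symm (J x))) = _
    rw [J.left_inv (hPJ hx)]

variable {Y : Type*} [MetricSpace Y] [CompactSpace Y]

lemma pieceFamily_transported [ParacompactSpace X] (hX : LocallyCube (univ : Set X))
    (hd : D.IsDenseDecomp) (hv : D.Vanishing) (hs : D.StronglyShrinkable)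
    (hDX : ∀ P ∈ D.nondegPieces, P ⊆ hausdorffPart X)
    (hDc : ∀ P ∈ D.nondegPieces, IsPreconnected P) {x₀ : X} {S : Set (Bump X)}
    {J : OpenPartialHomeomorph X Y} (hJ : J.source = connectedComponent x₀ ∩ hausdorffPart X)
    {c : S → Y → unitInterval} (hc : ∀ b, Continuous (c b))
    (hcJ : ∀ b, ∀ x ∈ J.source, c b (J x) = b.1.toFun x)
    (hcY : ∀ y y', (∀ b, c b y = c b y') → y = y') :
    PieceFamily J.target (D.transported J) := by
  have hmeet : ∀ P ∈ D.nondegPieces, (P ∩ J.source).Nonempty → P ⊆ J.source := by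
    rintro P hP ⟨x, hxP, hx⟩ y hy
    rw [hJ] at hx ⊢
    refine ⟨?_, hDX P hP hy⟩
    rw [connectedComponent_eq hx.1]
    exact (hDc P hP).subset_connectedComponent hxP hy
  have hopen : ∀ W, IsOpen W → IsOpen (J.source ∩ J ⁻¹' W) := fun W hW =>
    J.isOpen_inter_preimage hW
  have himg : ∀ P W, P ⊆ J.source →
      (J '' P ∩ W).Nonempty → (P ∩ (J.source ∩ J ⁻¹' W)).Nonempty := by
    rintro P W hPJ ⟨_, ⟨x, hx, rfl⟩, hxW⟩
    exact ⟨x, hx, hPJ hx, hxW⟩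
  have hsat : ∀ W, SatFor (D.transported J) W → D.Saturated (J.source ∩ J ⁻¹' W) := by
    intro W hW
    refine saturated_of_nondegPieces ?_
    rintro P hP ⟨x, hxP, hxJ, hxW⟩
    have hPJ := hmeet P hP ⟨x, hxP, hxJ⟩
    have := hW _ ⟨P, ⟨hP, hPJ⟩, rfl⟩ ⟨J x, mem_image_of_mem J hxP, hxW⟩
    exact fun y hy => ⟨hPJ hy, this (mem_image_of_mem J hy)⟩
  refine ⟨?_, ?_, ?_, ?_, ?_, ?_, ?_, ?_⟩
  · rintro _ ⟨P, ⟨hP, hPJ⟩, rfl⟩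
    exact J.image_source_eq_target ▸ image_mono hPJ
  · rintro _ ⟨P, ⟨hP, hPJ⟩, rfl⟩
    exact (D.isCompact' P hP.1).image_of_continuousOn (J.continuousOn.mono hPJ)
  · rintro _ ⟨P, ⟨hP, hPJ⟩, rfl⟩
    exact (hDc P hP).image _ (J.continuousOn.mono hPJ)
  · rintro _ ⟨P, ⟨hP, hPJ⟩, rfl⟩
    rw [← not_subsingleton_iff]
    intro h
    exact hP.2 fun x hx y hy => J.injOn (hPJ hx) (hPJ hy)
      (h (mem_image_of_mem J hx) (mem_image_of_mem J hy))
  · rintro _ ⟨P, ⟨hP, hPJ⟩, rfl⟩ _ ⟨Q, ⟨hQ, hQJ⟩, rfl⟩ ⟨_, ⟨x, hx, rfl⟩, y, hy, hxy⟩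
    obtain rfl := J.injOn (hQJ hy) (hPJ hx) hxy
    rw [eq_of_mem_of_mem hP.1 hQ.1 hx hy]
  · intro ε hε
    have hK : IsCompact {p : Y × Y | ε ≤ dist p.1 p.2} :=
      (isClosed_le continuous_const continuous_dist).isCompact
    have hfin : {P ∈ D.nondegPieces | P ⊆ J.source ∧ ∃ x ∈ P, ∃ y ∈ P,
        (J x, J y) ∈ {p : Y × Y | ε ≤ dist p.1 p.2}}.Finite := by
      refine hK.induction_on (p := fun s => {P ∈ D.nondegPieces | P ⊆ J.source ∧ ∃ x ∈ P, ∃ y ∈ P,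
        (J x, J y) ∈ s}.Finite) (by simp) ?_ ?_ ?_
      · exact fun s t hst ht => ht.subset fun P ⟨hP, hPJ, x, hx, y, hy, h⟩ =>
          ⟨hP, hPJ, x, hx, y, hy, hst h⟩
      · intro s t hs ht
        refine (hs.union ht).subset ?_
        rintro P ⟨hP, hPJ, x, hx, y, hy, h | h⟩
        · exact Or.inl ⟨hP, hPJ, x, hx, y, hy, h⟩
        · exact Or.inr ⟨hP, hPJ, x, hx, y, hy, h⟩
      · rintro ⟨y, y'⟩ hyy
        obtain ⟨b, hb⟩ : ∃ b, c b y ≠ c b y' := by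
          by_contra! h
          rw [mem_ofPred_eq, hcY y y' h, dist_self] at hyy
          exact absurd hε (not_lt.2 hyy)
        have hpos : 0 < dist (c b y) (c b y') := dist_pos.2 hb
        refine ⟨{p | dist (c b y) (c b y') / 2 < dist (c b p.1) (c b p.2)},
          mem_nhdsWithin_of_mem_nhds ((isOpen_lt continuous_const
            (((hc b).comp continuous_fst).dist ((hc b).comp continuous_snd))).mem_nhds ?_), ?_⟩
        · change dist (c b y) (c b y') / 2 < dist (c b y) (c b y')
          linarith
        · refine (finite_oscillation hX hv hs hDX hDc x₀ b.1 (half_pos hpos)).subset ?_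
          rintro P ⟨hP, hPJ, x, hx, z, hz, h⟩
          refine ⟨hP, fun w hw => (hJ ▸ hPJ hw).1, x, hx, z, hz, ?_⟩
          rw [← hcJ b x (hPJ hx), ← hcJ b z (hPJ hz)]
          exact le_of_lt h
    refine (hfin.image fun P => J '' P).subset ?_
    rintro _ ⟨⟨P, ⟨hP, hPJ⟩, rfl⟩, h⟩
    refine ⟨P, ⟨hP, hPJ, ?_⟩, rfl⟩
    by_contra! hne
    refine h ?_
    rintro _ ⟨x, hx, rfl⟩ _ ⟨y, hy, rfl⟩
    exact not_le.1 (hne x hx y hy)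
  · intro W hW hWJ hWs 𝒰 h𝒰 hW𝒰 𝒱 h𝒱 hW𝒱
    obtain ⟨h, hh, hhD⟩ := hs _ (hopen W hW) (hsat W hWs)
      ((fun u => J.source ∩ J ⁻¹' u) '' 𝒰)
      (by
        rintro _ ⟨u, hu, rfl⟩
        obtain ⟨huo, huW, hus⟩ := h𝒰 u hu
        exact ⟨hopen u huo, inter_subset_inter_right _ (preimage_mono huW),
          fun A hA _ => hsat u hus A hA⟩)
      (by
        rintro x ⟨hx, hxW⟩
        obtain ⟨u, hu, hxu⟩ := hW𝒰 hxW
        exact ⟨_, ⟨u, hu, rfl⟩, hx, hxu⟩)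
      ((fun u => J.source ∩ J ⁻¹' u) '' 𝒱)
      (by
        rintro _ ⟨v, hv, rfl⟩
        exact ⟨hopen v (h𝒱 v hv).1, inter_subset_inter_right _ (preimage_mono (h𝒱 v hv).2)⟩)
      (by
        rintro x ⟨hx, hxW⟩
        obtain ⟨v, hv, hxv⟩ := hW𝒱 hxW
        exact ⟨_, ⟨v, hv, rfl⟩, hx, hxv⟩)
    obtain ⟨e, he, he', heh⟩ := exists_conj_openPartialHomeomorph J hWJ (hopen W hW) h
    have hmem : ∀ y ∈ W, J.symm y ∈ J.source ∩ J ⁻¹' W := fun y hy =>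
      ⟨J.map_target (hWJ hy), by rwa [mem_preimage, J.right_inv (hWJ hy)]⟩
    refine ⟨e, he, he', ?_, ?_⟩
    · intro y hy
      have hey := heh _ (hmem y hy)
      rw [J.right_inv (hWJ hy)] at hey
      by_cases hz : (h ⟨_, hmem y hy⟩ : X) = J.symm y
      · obtain ⟨u, hu, hyu⟩ := hW𝒰 hy
        rw [hz, J.right_inv (hWJ hy)] at hey
        exact ⟨u, hu, hyu, hey.symm ▸ hyu⟩
      · obtain ⟨_, ⟨u, hu, rfl⟩, h1, h2⟩ := hh ⟨_, hmem y hy⟩ hz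
        refine ⟨u, hu, ?_, ?_⟩
        · have := h2.2
          rwa [mem_preimage, J.right_inv (hWJ hy)] at this
        · rw [hey]
          exact h1.2
    · rintro _ ⟨P, ⟨hP, hPJ⟩, rfl⟩ hPW
      have hPU : P ⊆ J.source ∩ J ⁻¹' W := fun x hx => ⟨hPJ hx, hPW (mem_image_of_mem J hx)⟩
      obtain ⟨_, ⟨v, hv, rfl⟩, hPv⟩ := hhD P hP.1 hPU
      refine ⟨v, hv, ?_⟩
      rintro _ ⟨_, ⟨x, hx, rfl⟩, rfl⟩
      rw [heh x (hPU hx)]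
      exact (hPv ⟨h ⟨x, hPU hx⟩, ⟨⟨x, hPU hx⟩, hx, rfl⟩, rfl⟩).2
  · intro W hW hWJ hWs hne
    obtain ⟨y, hy⟩ := hne
    obtain ⟨P, hP, hPW⟩ := exists_subset_of_saturated hd (hopen W hW) (hsat W hWs)
      ⟨J.symm y, J.map_target (hWJ hy), by rwa [mem_preimage, J.right_inv (hWJ hy)]⟩
    refine ⟨_, ⟨P, ⟨hP, hPW.trans inter_subset_left⟩, rfl⟩, ?_⟩
    rintro _ ⟨x, hx, rfl⟩
    exact (hPW hx).2

end Decomposition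

end Transfer

section Extension

variable {X : Type*} [TopologicalSpace X]

open Classical in
/-- The self-map of `X` induced by a self-map of a compactification of an open subset. -/
def liftMap {Y : Type*} [TopologicalSpace Y] (J : OpenPartialHomeomorph X Y) (Φ : Y ≃ₜ Y) (x : X) :
    X :=
  if x ∈ J.source then J.symm (Φ (J x)) else x

variable {Y : Type*} [TopologicalSpace Y] {J : OpenPartialHomeomorph X Y} {Φ : Y ≃ₜ Y}

lemma liftMap_of_mem {x : X} (hx : x ∈ J.source) : liftMap J Φ x = J.symm (Φ (J x)) := if_pos hx

lemma liftMap_of_notMem {x : X} (hx : x ∉ J.source) : liftMap J Φ x = x := if_neg hx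

lemma map_liftMap (hΦ : SuppIn Φ J.target) {x : X} (hx : x ∈ J.source) :
    liftMap J Φ x ∈ J.source ∧ J (liftMap J Φ x) = Φ (J x) := by
  have h1 := hΦ.apply_mem (J.map_source hx)
  rw [liftMap_of_mem hx]
  exact ⟨J.map_target h1, J.right_inv h1⟩

lemma liftMap_symm_liftMap (hΦ : SuppIn Φ J.target) (x : X) :
    liftMap J Φ.symm (liftMap J Φ x) = x := by
  by_cases hx : x ∈ J.source
  · obtain ⟨h1, h2⟩ := map_liftMap hΦ hx
    rw [liftMap_of_mem h1, h2, Φ.symm_apply_apply, J.left_inv hx]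
  · rw [liftMap_of_notMem hx, liftMap_of_notMem hx]

variable [CompactSpace Y]

lemma continuous_liftMap {x₀ : X} {S : Set (Bump X)}
    (hS : ∀ y ∈ connectedComponent x₀, ∀ N ∈ 𝓝 y, ∃ b ∈ S, b.dom ⊆ N ∧ ∀ᶠ z in 𝓝 y, b.toFun z = 1)
    (hJ : J.source = connectedComponent x₀ ∩ hausdorffPart X)
    {c : S → Y → unitInterval} (hc : ∀ b, Continuous (c b))
    (hcJ : ∀ b, ∀ x ∈ J.source, c b (J x) = b.1.toFun x) (hΦ : SuppIn Φ J.target) :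
    Continuous (liftMap J Φ) := by
  rw [continuous_iff_continuousAt]
  intro z
  by_cases hzJ : z ∈ J.source
  · have h1 : ContinuousAt (fun x => J.symm (Φ (J x))) z :=
      ContinuousAt.comp (f := fun x => Φ (J x)) (J.continuousAt_symm (hΦ.apply_mem
        (J.map_source hzJ))) (ContinuousAt.comp (f := J) Φ.continuous.continuousAt
          (J.continuousAt hzJ))
    refine h1.congr ?_
    filter_upwards [J.open_source.mem_nhds hzJ] with x hx using (liftMap_of_mem hx).symm
  by_cases hzT : z ∈ connectedComponent x₀
  swap
  · refine continuousAt_id.congr ?_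
    filter_upwards [isClosed_connectedComponent.isOpen_compl.mem_nhds hzT] with x hx
    exact (liftMap_of_notMem fun h => hx (hJ ▸ h).1).symm
  intro N hN
  rw [liftMap_of_notMem hzJ] at hN
  obtain ⟨b, hbS, hbN, hb⟩ := hS z hzT N hN
  rw [Filter.mem_map, Filter.mem_iff_ultrafilter]
  intro u hu
  by_cases hMu : J.source ∈ u
  swap
  · filter_upwards [Ultrafilter.compl_mem_iff_notMem.2 hMu, hu hN] with x hx hxN
    rwa [mem_preimage, liftMap_of_notMem hx]
  obtain ⟨y, -, hy⟩ := isCompact_univ.ultrafilter_le_nhds (u.map J) (by simp)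
  have hJy : Filter.Tendsto J u (𝓝 y) := hy
  by_cases hyJ : y ∈ J.target
  · exfalso
    have h1 : Filter.Tendsto (fun x => J.symm (J x)) u (𝓝 (J.symm y)) :=
      (J.continuousAt_symm hyJ).tendsto.comp hJy
    have h2 : Filter.Tendsto id (u : Filter X) (𝓝 (J.symm y)) := by
      refine h1.congr' ?_
      filter_upwards [hMu] with x hx using J.left_inv hx
    have h3 := J.map_target hyJ
    have h4 := disjoint_nhds_of_mem_hausdorffPart (hJ ▸ h3).2 (y := z) fun h => hzJ (h ▸ h3)
    exact u.neBot.ne (le_bot_iff.1 (h4 h2 hu))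
  · have h1 : Filter.Tendsto (fun x => c ⟨b, hbS⟩ (J x)) u (𝓝 (c ⟨b, hbS⟩ y)) :=
      ((hc _).tendsto y).comp hJy
    have h2 : Filter.Tendsto (fun x => c ⟨b, hbS⟩ (J x)) u (𝓝 1) := by
      refine tendsto_const_nhds.congr' ?_
      filter_upwards [hMu, hu hb] with x hx hx'
      rw [hcJ _ x hx, hx']
    have h3 : Filter.Tendsto (fun x => c ⟨b, hbS⟩ (Φ (J x))) u (𝓝 1) := by
      have h := (((hc ⟨b, hbS⟩).comp Φ.continuous).tendsto y).comp hJy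
      rwa [Function.comp_apply, hΦ y hyJ, tendsto_nhds_unique h1 h2] at h
    filter_upwards [hMu, h3.eventually_ne one_ne_zero] with x hx hx0
    obtain ⟨h4, h5⟩ := map_liftMap hΦ hx
    rw [← h5, hcJ _ _ h4] at hx0
    by_contra hne
    exact hx0 (b.eq_zero _ fun h => hne (hbN (b.supp_subset h)))

/-- The homeomorphism of `X` induced by a homeomorphism of a compactification. -/
lemma exists_homeomorph_liftMap {x₀ : X} {S : Set (Bump X)}
    (hS : ∀ y ∈ connectedComponent x₀, ∀ N ∈ 𝓝 y, ∃ b ∈ S, b.dom ⊆ N ∧ ∀ᶠ z in 𝓝 y, b.toFun z = 1)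
    (hJ : J.source = connectedComponent x₀ ∩ hausdorffPart X)
    {c : S → Y → unitInterval} (hc : ∀ b, Continuous (c b))
    (hcJ : ∀ b, ∀ x ∈ J.source, c b (J x) = b.1.toFun x) (hΦ : SuppIn Φ J.target) :
    ∃ Ψ : X ≃ₜ X, ⇑Ψ = liftMap J Φ :=
  ⟨{ toFun := liftMap J Φ
     invFun := liftMap J Φ.symm
     left_inv := liftMap_symm_liftMap hΦ
     right_inv := liftMap_symm_liftMap hΦ.symm
     continuous_toFun := continuous_liftMap hS hJ hc hcJ hΦ
     continuous_invFun := continuous_liftMap hS hJ hc hcJ hΦ.symm }, rfl⟩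

end Extension

section Glue

lemma exists_homeomorph_glue_components {X : Type*} [TopologicalSpace X]
    (hX : ∀ x : X, IsOpen (connectedComponent x)) (F : Set X → X ≃ₜ X)
    (hF : ∀ x : X, SuppIn (F (connectedComponent x)) (connectedComponent x)) :
    ∃ Ψ : X ≃ₜ X, ∀ x, Ψ x = F (connectedComponent x) x := by
  have hinv : ∀ F : Set X → X ≃ₜ X,
      (∀ x : X, SuppIn (F (connectedComponent x)) (connectedComponent x)) →
      ∀ x, connectedComponent (F (connectedComponent x) x) = connectedComponent x :=
    fun F hF x => (connectedComponent_eq ((hF x).apply_mem mem_connectedComponent)).symm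
  have hcont : ∀ F : Set X → X ≃ₜ X, Continuous fun x => F (connectedComponent x) x := by
    refine fun F => continuous_iff_continuousAt.2 fun x => ?_
    refine (F (connectedComponent x)).continuous.continuousAt.congr ?_
    filter_upwards [(hX x).mem_nhds mem_connectedComponent] with y hy
    rw [connectedComponent_eq hy]
  refine ⟨{ toFun := fun x => F (connectedComponent x) x
            invFun := fun x => (F (connectedComponent x)).symm x
            left_inv := fun x => ?_
            right_inv := fun x => ?_
            continuous_toFun := hcont F
            continuous_invFun := hcont fun T => (F T).symm }, fun x => rfl⟩
  · dsimp only
    rw [hinv F hF x, Homeomorph.symm_apply_apply]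
  · have := hinv (fun T => (F T).symm) (fun x => (hF x).symm) x
    dsimp only at this ⊢
    rw [this, Homeomorph.apply_symm_apply]

namespace Decomposition

universe u
variable {X : Type u} [TopologicalSpace X]

/-- The properties of a decomposition used to compare it with another one. -/
structure Tame (D : Decomposition X) : Prop where
  dense : D.IsDenseDecomp
  vanishing : D.Vanishing
  shrinkable : D.StronglyShrinkable
  subset_hausdorffPart : ∀ P ∈ D.nondegPieces, P ⊆ hausdorffPart X
  isPreconnected : ∀ P ∈ D.nondegPieces, IsPreconnected P

variable {A B : Decomposition X}

lemma exists_homeomorph_component [ParacompactSpace X] (hX : LocallyCube (univ : Set X))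
    (hA : A.Tame) (hB : B.Tame)
    (hhom : ∀ P ∈ A.nondegPieces, ∀ Q ∈ B.nondegPieces, ∃ h : X ≃ₜ X, h '' P = Q) (x₀ : X) :
    ∃ Ψ : X ≃ₜ X, SuppIn Ψ (connectedComponent x₀) ∧
      (fun P => Ψ '' P) '' {P ∈ A.nondegPieces | P ⊆ connectedComponent x₀} =
        {P ∈ B.nondegPieces | P ⊆ connectedComponent x₀} := by
  set M := connectedComponent x₀ ∩ hausdorffPart X with hM
  have hAM : {P ∈ A.nondegPieces | P ⊆ connectedComponent x₀} = {P ∈ A.nondegPieces | P ⊆ M} :=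
    Set.ext fun P => and_congr_right fun hP =>
      ⟨fun h => subset_inter h (hA.subset_hausdorffPart P hP), fun h => h.trans inter_subset_left⟩
  have hBM : {P ∈ B.nondegPieces | P ⊆ connectedComponent x₀} = {P ∈ B.nondegPieces | P ⊆ M} :=
    Set.ext fun P => and_congr_right fun hP =>
      ⟨fun h => subset_inter h (hB.subset_hausdorffPart P hP), fun h => h.trans inter_subset_left⟩
  rw [hAM, hBM]
  rcases M.eq_empty_or_nonempty with hempty | hne
  · have : ∀ D : Decomposition X, {P ∈ D.nondegPieces | P ⊆ M} = ∅ := by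
      refine fun D => eq_empty_iff_forall_notMem.2 fun P ⟨hP, hPM⟩ => ?_
      obtain ⟨x, hx⟩ := D.nonempty' P hP.1
      exact notMem_empty x (hempty ▸ hPM hx)
    exact ⟨Homeomorph.refl X, fun _ _ => rfl, by simp [this]⟩
  obtain ⟨S, hSc, hS⟩ := exists_countable_bumps hX x₀
  obtain ⟨Y, _, _, J, c, hJ, hc, hcJ, hcY⟩ := exists_compactification
    ((hX.isOpen_connectedComponent x₀).inter isOpen_hausdorffPart) inter_subset_right hne hSc
    fun y hy => hS y hy.1
  rw [← hM] at hJ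
  have hcJ' : ∀ b, ∀ x ∈ J.source, c b (J x) = b.1.toFun x := fun b x hx => hcJ b x (hJ.subset hx)
  obtain ⟨Φ, hΦ, hΦAB⟩ := exists_homeomorph_of_pieceFamily J.open_target (hX.target J)
    (pieceFamily_transported hX hA.dense hA.vanishing hA.shrinkable hA.subset_hausdorffPart
      hA.isPreconnected hJ hc hcJ' hcY)
    (pieceFamily_transported hX hB.dense hB.vanishing hB.shrinkable hB.subset_hausdorffPart
      hB.isPreconnected hJ hc hcJ' hcY)
    (germRelated_transported J hhom)
  obtain ⟨Ψ, hΨ⟩ := exists_homeomorph_liftMap hS hJ hc hcJ' hΦ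
  have himg : ∀ P ⊆ M, ∀ Q ⊆ M, Φ '' (J '' P) = J '' Q → Ψ '' P = Q := by
    intro P hP Q hQ h
    have h1 : Ψ '' P = J.symm '' (Φ '' (J '' P)) := by
      rw [image_image, image_image]
      exact image_congr fun x hx => by rw [hΨ, liftMap_of_mem (hJ ▸ hP hx)]
    rw [h1, h, image_image]
    conv_rhs => rw [← image_id Q]
    exact image_congr fun x hx => J.left_inv (hJ ▸ hQ hx)
  rw [← hJ] at himg ⊢
  refine ⟨Ψ, fun x hx => ?_, Subset.antisymm ?_ ?_⟩
  · rw [hΨ, liftMap_of_notMem fun h => hx (hJ ▸ h).1]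
  · rintro _ ⟨P, hP, rfl⟩
    have : Φ '' (J '' P) ∈ B.transported J := hΦAB ▸ ⟨_, ⟨P, hP, rfl⟩, rfl⟩
    obtain ⟨Q, hQ, hPQ⟩ := this
    dsimp only
    rwa [himg P hP.2 Q hQ.2 hPQ.symm]
  · intro Q hQ
    have : J '' Q ∈ (fun A => Φ '' A) '' A.transported J := hΦAB ▸ ⟨Q, hQ, rfl⟩
    obtain ⟨_, ⟨P, hP, rfl⟩, hPQ⟩ := this
    exact ⟨P, hP, himg P hP.2 Q hQ.2 hPQ⟩

lemma exists_homeomorph_nondegPieces [ParacompactSpace X] (hX : LocallyCube (univ : Set X))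
    (hA : A.Tame) (hB : B.Tame)
    (hhom : ∀ P ∈ A.nondegPieces, ∀ Q ∈ B.nondegPieces, ∃ h : X ≃ₜ X, h '' P = Q) :
    ∃ Ψ : X ≃ₜ X, (fun P => Ψ '' P) '' A.nondegPieces = B.nondegPieces := by
  have hF : ∀ T : Set X, ∃ Ψ : X ≃ₜ X, ∀ x, T = connectedComponent x → SuppIn Ψ T ∧
      (fun P => Ψ '' P) '' {P ∈ A.nondegPieces | P ⊆ T} = {P ∈ B.nondegPieces | P ⊆ T} := by
    intro T
    by_cases hT : ∃ x, T = connectedComponent x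
    · obtain ⟨x, rfl⟩ := hT
      obtain ⟨Ψ, hΨ⟩ := exists_homeomorph_component hX hA hB hhom x
      exact ⟨Ψ, fun _ _ => hΨ⟩
    · exact ⟨Homeomorph.refl X, fun x hx => absurd ⟨x, hx⟩ hT⟩
  choose F hF using hF
  obtain ⟨Ψ, hΨ⟩ := exists_homeomorph_glue_components hX.isOpen_connectedComponent F
    fun x => (hF _ x rfl).1
  have hcomp : ∀ D : Decomposition X, D.Tame → ∀ P ∈ D.nondegPieces,
      ∃ x, P ⊆ connectedComponent x := fun D hD P hP => by
    obtain ⟨x, hx⟩ := D.nonempty' P hP.1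
    exact ⟨x, (hD.isPreconnected P hP).subset_connectedComponent hx⟩
  have himg : ∀ x, ∀ P ⊆ connectedComponent x, Ψ '' P = F (connectedComponent x) '' P :=
    fun x P hP => image_congr fun y hy => by rw [hΨ, ← connectedComponent_eq (hP hy)]
  refine ⟨Ψ, Subset.antisymm ?_ ?_⟩
  · rintro _ ⟨P, hP, rfl⟩
    obtain ⟨x, hx⟩ := hcomp A hA P hP
    have : F (connectedComponent x) '' P ∈ {P ∈ B.nondegPieces | P ⊆ connectedComponent x} :=
      (hF _ x rfl).2 ▸ ⟨P, ⟨hP, hx⟩, rfl⟩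
    dsimp only
    rw [himg x P hx]
    exact this.1
  · intro Q hQ
    obtain ⟨x, hx⟩ := hcomp B hB Q hQ
    have : Q ∈ {P ∈ B.nondegPieces | P ⊆ connectedComponent x} := ⟨hQ, hx⟩
    rw [← (hF _ x rfl).2] at this
    obtain ⟨P, ⟨hP, hPx⟩, hPQ⟩ := this
    exact ⟨P, hP, (himg x P hPx).trans hPQ⟩

lemma image_pieces_subset {Ψ : X ≃ₜ X} (h : (fun P => Ψ '' P) '' A.nondegPieces = B.nondegPieces) :
    (fun P => Ψ '' P) '' A.pieces ⊆ B.pieces := by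
  rintro _ ⟨P, hP, rfl⟩
  by_cases hs : P.Subsingleton
  swap
  · have : Ψ '' P ∈ B.nondegPieces := h ▸ ⟨P, ⟨hP, hs⟩, rfl⟩
    exact this.1
  obtain ⟨x, hx⟩ := A.nonempty' P hP
  obtain ⟨Q, hQ, hxQ⟩ := B.covers (Ψ x)
  have hQs : Q.Subsingleton := by
    by_contra hQs
    have : Q ∈ B.nondegPieces := ⟨hQ, hQs⟩
    rw [← h] at this
    obtain ⟨P', hP', rfl⟩ := this
    obtain ⟨x', hx', he⟩ := hxQ
    rw [Ψ.injective he] at hx'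
    exact hP'.2 (eq_of_mem_of_mem hP'.1 hP hx' hx ▸ hs)
  have : (fun P => Ψ '' P) P = Q := by
    dsimp only
    rw [hs.eq_singleton_of_mem hx, image_singleton, hQs.eq_singleton_of_mem hxQ]
  exact this.symm ▸ hQ

lemma topEquivDecomp_of_nondegPieces {Ψ : X ≃ₜ X}
    (h : (fun P => Ψ '' P) '' A.nondegPieces = B.nondegPieces) : TopEquivDecomp A B := by
  refine ⟨Ψ, Subset.antisymm (image_pieces_subset h) fun Q hQ => ⟨Ψ.symm '' Q, ?_, ?_⟩⟩
  · refine image_pieces_subset (A := B) (B := A) (Ψ := Ψ.symm) ?_ ⟨Q, hQ, rfl⟩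
    rw [← h, image_image]
    simp [image_image]
  · simp [image_image]

end Decomposition

lemma IsManifoldModeledOn.locallyCube {X : Type*} [TopologicalSpace X]
    (hX : IsManifoldModeledOn X HilbertCube) : LocallyCube (univ : Set X) := by
  intro x _
  obtain ⟨O, hO, hxO, U, hU, ⟨e⟩⟩ := hX.2 x
  let i := TopologicalSpace.Opens.openPartialHomeomorphSubtypeCoe ⟨O, hO⟩ ⟨⟨x, hxO⟩⟩
  let j := TopologicalSpace.Opens.openPartialHomeomorphSubtypeCoe ⟨U, hU⟩ ⟨e ⟨x, hxO⟩⟩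
  have hi : i.target = O :=
    TopologicalSpace.Opens.openPartialHomeomorphSubtypeCoe_target ⟨O, hO⟩ ⟨⟨x, hxO⟩⟩
  have hj : j.source = univ := rfl
  refine ⟨i.symm.trans (e.toOpenPartialHomeomorph.trans j), ?_⟩
  simp [hi, hj, hxO]

end Glue

/-- Corollary: two cellular dense vanishing strongly shrinkable decompositions of a
Hilbert cube manifold are topologically equivalent provided any two non-degenerate
pieces are ambiently homeomorphic. -/
theorem cellular_decompositions_topEquiv (X : Type*) [TopologicalSpace X]
    (hX : IsManifoldModeledOn X HilbertCube)
    (A B : Decomposition X)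
    (hAd : A.IsDenseDecomp) (hBd : B.IsDenseDecomp)
    (hAv : A.Vanishing) (hBv : B.Vanishing)
    (hAs : A.StronglyShrinkable) (hBs : B.StronglyShrinkable)
    (hAc : ∀ P ∈ A.pieces, CellularIn HilbertHalfOpen P)
    (hBc : ∀ P ∈ B.pieces, CellularIn HilbertHalfOpen P)
    (hhom : ∀ P ∈ A.pieces, ¬ P.Subsingleton → ∀ Q ∈ B.pieces, ¬ Q.Subsingleton →
      ∃ h : X ≃ₜ X, ⇑h '' P = Q) :
    TopEquivDecomp A B := by
  have hXc := hX.locallyCube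
  have hXp : ParacompactSpace X := hX.1
  rcases isEmpty_or_nonempty X with hXe | hXn
  · refine Decomposition.topEquivDecomp_of_nondegPieces (Ψ := Homeomorph.refl X) ?_
    have : ∀ D : Decomposition X, D.nondegPieces = ∅ := fun D =>
      eq_empty_iff_forall_notMem.2 fun P hP => hP.2 fun x => isEmptyElim x
    simp [this]
  have hhom' : ∀ P ∈ A.nondegPieces, ∀ Q ∈ B.nondegPieces, ∃ h : X ≃ₜ X, h '' P = Q :=
    fun P hP Q hQ => hhom P hP.1 hP.2 Q hQ.1 hQ.2
  obtain ⟨P₀, hP₀, hP₀X⟩ := Decomposition.exists_subset_hausdorffPart hXc hAd hAv hAs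
  obtain ⟨Q₀, hQ₀, hQ₀X⟩ := Decomposition.exists_subset_hausdorffPart hXc hBd hBv hBs
  have hAX : ∀ P ∈ A.nondegPieces, P ⊆ hausdorffPart X := fun P hP x hx => by
    obtain ⟨h, rfl⟩ := hhom' P hP Q₀ hQ₀
    simpa using h.symm.mem_hausdorffPart (hQ₀X (mem_image_of_mem h hx))
  have hBX : ∀ Q ∈ B.nondegPieces, Q ⊆ hausdorffPart X := fun Q hQ x hx => by
    obtain ⟨h, rfl⟩ := hhom' P₀ hP₀ Q hQ
    obtain ⟨y, hy, rfl⟩ := hx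
    exact h.mem_hausdorffPart (hP₀X hy)
  obtain ⟨Ψ, hΨ⟩ := Decomposition.exists_homeomorph_nondegPieces hXc
    ⟨hAd, hAv, hAs, hAX, fun P hP =>
      Decomposition.isPreconnected_of_cellular (A.isCompact' P hP.1) (hAc P hP.1) (hAX P hP)⟩
    ⟨hBd, hBv, hBs, hBX, fun P hP =>
      Decomposition.isPreconnected_of_cellular (B.isCompact' P hP.1) (hBc P hP.1) (hBX P hP)⟩ hhom'
  exact Decomposition.topEquivDecomp_of_nondegPieces hΨ

end
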